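/- For every A > 0 there exist constants C_1(A), C_2(A) > 0 with the following property. Let 0 < ε < 1, let N ≥ 2, and let α = a/q + β where a/q is a reduced fraction with 1 ≤ q ≤ ((1−ε) log N)^A and |β| < (log N)^A / N. Then |(1/N) ∑_{n≤N} Λ(n) e(nα) − (μ(q)/φ(q)) · (1/N) ∑_{n≤N} e(nβ)| ≤ C_1(A) exp(−C_2(A) (1−ε) √(log N)), where C_2(A) can be taken to be the constant in the Siegel–Walfisz theorem for modulus exponent A. -/

import Mathlib

/-- `e(x) = exp(2πix)`. -/
noncomputable def ce (x : ℝ) : ℂ := Complex.exp (Complex.I * (2 * Real.pi * x))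

section

open Complex Metric

/-- Borel–Carathéodory bound for the logarithmic derivative of a nonvanishing function. -/
theorem norm_logDeriv_le_of_ne_zero {g : ℂ → ℂ} {c : ℂ} {R M : ℝ} (hR : 0 < R) (hM : 0 < M)
    (hg : DifferentiableOn ℂ g (ball c R)) (h0 : ∀ z ∈ ball c R, g z ≠ 0)
    (hb : ∀ z ∈ ball c R, ‖g z‖ ≤ Real.exp M * ‖g c‖) {z : ℂ} (hz : ‖z - c‖ ≤ 3 * R / 4) :
    ‖deriv g z / g z‖ ≤ 112 * M / R := by
  have hc : c ∈ ball c R := mem_ball_self hR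
  have hlog : DifferentiableOn ℂ (fun z => deriv g z / g z) (ball c R) :=
    (hg.deriv isOpen_ball).div hg h0
  obtain ⟨h, hh⟩ := hlog.isExactOn_ball
  have hquot : ∀ z ∈ ball c R, g z * exp (-(h z - h c)) = g c := by
    have hconst : ∀ w ∈ ball c R, HasDerivAt (fun z => g z * exp (-(h z - h c))) 0 w := by
      intro w hw
      have h1 : HasDerivAt g (deriv g w) w :=
        (hg.differentiableAt (isOpen_ball.mem_nhds hw)).hasDerivAt
      have h2 : HasDerivAt (fun z => g z * exp (-(h z - h c))) (deriv g w * exp (-(h w - h c)) +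
          g w * (exp (-(h w - h c)) * -(deriv g w / g w))) w :=
        h1.mul ((hh w hw).sub_const (h c)).neg.cexp
      refine h2.congr_deriv ?_
      have := h0 w hw
      field_simp
      ring
    intro z hz
    have := (convex_ball c R).is_const_of_fderivWithin_eq_zero (𝕜 := ℂ)
      (f := fun z => g z * exp (-(h z - h c)))
      (fun w hw => (hconst w hw).differentiableAt.differentiableWithinAt)
      (fun w hw => by
        rw [fderivWithin_of_isOpen isOpen_ball hw]
        ext; rw [fderiv_apply_one_eq_deriv, (hconst w hw).deriv]; simp) hz hc
    simpa using this
  have hre : ∀ z ∈ ball c R, (h z - h c).re ≤ M := by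
    intro z hz
    have h1 : g z = g c * exp (h z - h c) := by
      rw [← hquot z hz, mul_assoc, ← exp_add]; simp
    have h2 := hb z hz
    rw [h1, norm_mul, norm_exp, mul_comm] at h2
    have := le_of_mul_le_mul_right h2 (norm_pos_iff.mpr (h0 c hc))
    simpa using Real.exp_le_exp.mp this
  have hhd : DifferentiableOn ℂ h (ball c R) :=
    fun w hw => (hh w hw).differentiableAt.differentiableWithinAt
  have hbd : ∀ w, ‖w - c‖ < 7 * R / 8 + R / 1000 → ‖w - c‖ ≤ 7 * R / 8 → ‖h w - h c‖ ≤ 14 * M := by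
    intro w _ hw
    have := borelCaratheodory_zero (f := fun u => h (c + u) - h c) (z := w - c) (R := R) hM
      (by
        apply DifferentiableOn.sub_const
        apply hhd.comp (by fun_prop)
        intro u hu; simpa using hu)
      (by
        intro u hu
        exact hre (c + u) (by simpa using hu))
      hR (by simp; linarith) (by simp)
    simp only [add_sub_cancel] at this
    refine this.trans ?_
    rw [div_le_iff₀ (by linarith)]
    nlinarith
  have hzb : z ∈ ball c R := by rw [mem_ball, dist_eq_norm]; linarith
  have hder : deriv h z = deriv g z / g z := (hh z hzb).deriv
  have hsub : closedBall z (R / 8) ⊆ ball c R := by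
    intro w hw
    rw [mem_closedBall, dist_eq_norm] at hw
    rw [mem_ball, dist_eq_norm]
    have := norm_sub_le_norm_sub_add_norm_sub w z c
    linarith
  have := norm_deriv_le_of_forall_mem_sphere_norm_le (f := fun w => h w - h c) (c := z)
    (R := R / 8) (C := 14 * M) (by positivity)
    (by
      apply DifferentiableOn.diffContOnCl
      apply (hhd.sub_const _).mono
      exact (closure_ball_subset_closedBall).trans hsub)
    (by
      intro w hw
      rw [mem_sphere, dist_eq_norm] at hw
      have := norm_sub_le_norm_sub_add_norm_sub w z c
      exact hbd w (by linarith) (by linarith))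
  rw [deriv_sub_const, hder] at this
  refine this.trans (le_of_eq ?_)
  field_simp
  norm_num

/-- Removing a zero `ρ` of an entire function, normalised at the point `c`. -/
theorem exists_eq_mul_one_sub_div {f : ℂ → ℂ} (hf : Differentiable ℂ f) {c ρ : ℂ} (hρ : f ρ = 0)
    (hc : f c ≠ 0) : ∃ g : ℂ → ℂ, Differentiable ℂ g ∧ g c = f c ∧
      (∀ z, f z = g z * (1 - (z - c) / (ρ - c))) ∧
      deriv f c / f c = deriv g c / g c - 1 / (ρ - c) := by
  have hne : ρ - c ≠ 0 := by
    intro h; apply hc; rw [← sub_eq_zero.mp h, hρ]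
  have hfac : ∀ z, f z = (c - ρ) * dslope f ρ z * (1 - (z - c) / (ρ - c)) := by
    intro z
    have := sub_smul_dslope f ρ z
    rw [hρ, sub_zero, smul_eq_mul] at this
    rw [← this]
    field_simp
    ring
  have hd : Differentiable ℂ (fun z => (c - ρ) * dslope f ρ z) := by
    intro z
    have hd2 : DifferentiableOn ℂ (dslope f ρ) Set.univ :=
      (differentiableOn_dslope Filter.univ_mem).mpr hf.differentiableOn
    exact ((hd2 z trivial).differentiableAt Filter.univ_mem).const_mul _
  refine ⟨fun z => (c - ρ) * dslope f ρ z, hd, by simpa using (hfac c).symm, hfac, ?_⟩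
  set g := fun z => (c - ρ) * dslope f ρ z with hg
  have hgc : g c = f c := by simpa using (hfac c).symm
  have h1 : HasDerivAt f (deriv g c * (1 - (c - c) / (ρ - c)) + g c * (-(1 / (ρ - c)))) c := by
    have : f = fun z => g z * (1 - (z - c) / (ρ - c)) := funext hfac
    rw [this]
    exact (hd c).hasDerivAt.mul
      ((((hasDerivAt_id c).sub_const c).div_const (ρ - c)).const_sub 1)
  rw [h1.deriv, hgc]
  field_simp
  simp
  ring

theorem norm_le_of_eq_mul_one_sub_div {f g : ℂ → ℂ} (hg : Differentiable ℂ g) {c ρ : ℂ} {R B : ℝ}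
    (hR : 0 < R) (hfg : ∀ z, f z = g z * (1 - (z - c) / (ρ - c))) (hne : ρ ≠ c)
    (hρ : ‖ρ - c‖ ≤ R / 3) (hb : ∀ z ∈ closedBall c R, ‖f z‖ ≤ B) :
    ∀ z ∈ closedBall c R, ‖g z‖ ≤ B / 2 := by
  intro z hz
  have hsph : ∀ w ∈ frontier (ball c R), ‖g w‖ ≤ B / 2 := by
    intro w hw
    rw [frontier_ball c hR.ne', mem_sphere, dist_eq_norm] at hw
    have h1 := hb w (by rw [mem_closedBall, dist_eq_norm, hw])
    rw [hfg, norm_mul] at h1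
    have hpos : 0 < ‖ρ - c‖ := norm_pos_iff.mpr (sub_ne_zero.mpr hne)
    have h2 : (2 : ℝ) ≤ ‖1 - (w - c) / (ρ - c)‖ := by
      have h3 : 3 ≤ ‖(w - c) / (ρ - c)‖ := by
        rw [norm_div, le_div_iff₀ hpos, hw]; linarith
      have := norm_sub_norm_le ((w - c) / (ρ - c)) 1
      rw [norm_sub_rev] at this
      simp only [norm_one] at this
      linarith
    nlinarith [norm_nonneg (g w)]
  refine norm_le_of_forall_mem_frontier_norm_le isBounded_ball hg.diffContOnCl hsph ?_
  rwa [closure_ball c hR.ne']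

theorem re_logDeriv_ge_neg {c : ℂ} {R : ℝ} (hR : 0 < R) (n : ℕ) :
    ∀ (f : ℂ → ℂ) (M : ℝ), Differentiable ℂ f → f c ≠ 0 → M < n * Real.log 2 →
    (∀ z ∈ closedBall c R, ‖f z‖ ≤ Real.exp M * ‖f c‖) →
    (∀ z ∈ closedBall c (R / 3), f z = 0 → z.re ≤ c.re) →
    -(336 * (M + 1) / R) ≤ (deriv f c / f c).re := by
  induction n with
  | zero =>
    intro f M hf hc hM hb _
    have := hb c (mem_closedBall_self hR.le)
    have h2 : 1 ≤ Real.exp M :=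
      le_of_mul_le_mul_right (by linarith) (norm_pos_iff.mpr hc)
    rw [Real.one_le_exp_iff] at h2
    simp at hM
    linarith
  | succ n ih =>
    intro f M hf hc hM hb hre
    by_cases hz : ∃ ρ ∈ closedBall c (R / 3), f ρ = 0
    · obtain ⟨ρ, hρ, hρ0⟩ := hz
      obtain ⟨g, hg, hgc, hfg, hd⟩ := exists_eq_mul_one_sub_div hf hρ0 hc
      have hne : ρ ≠ c := by rintro rfl; exact hc hρ0
      have hb2 := norm_le_of_eq_mul_one_sub_div hg hR hfg hne
        (by simpa [dist_eq_norm] using hρ) hb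
      have := ih g (M - Real.log 2) hg (hgc ▸ hc) (by push_cast at hM; linarith)
        (by
          intro z hz
          rw [Real.exp_sub, Real.exp_log two_pos, hgc]
          exact (hb2 z hz).trans (le_of_eq (by ring)))
        (by
          intro z hz h0
          exact hre z hz (by rw [hfg, h0, zero_mul]))
      have hneg : (1 / (ρ - c)).re ≤ 0 := by
        rw [one_div, inv_re]
        apply div_nonpos_of_nonpos_of_nonneg _ (normSq_nonneg _)
        simpa using hre ρ hρ hρ0
      rw [hd, sub_re]
      have hl := Real.log_pos one_lt_two
      have : -(336 * (M + 1) / R) ≤ -(336 * (M - Real.log 2 + 1) / R) := by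
        gcongr; linarith
      linarith
    · push Not at hz
      have hM0 : 0 ≤ M := by
        have := hb c (mem_closedBall_self hR.le)
        have h2 : 1 ≤ Real.exp M :=
          le_of_mul_le_mul_right (by linarith) (norm_pos_iff.mpr hc)
        rwa [Real.one_le_exp_iff] at h2
      have := norm_logDeriv_le_of_ne_zero (c := c) (z := c) (R := R / 3) (M := M + 1) (g := f)
        (by positivity) (by linarith) hf.differentiableOn
        (fun z hz' => hz z (ball_subset_closedBall hz'))
        (fun z hz' => (hb z (closedBall_subset_closedBall (by linarith)
          (ball_subset_closedBall hz'))).trans (by gcongr; linarith))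
        (by simp; positivity)
      have h3 := (abs_le.mp (abs_re_le_norm (deriv f c / f c))).1
      have h4 : 112 * (M + 1) / (R / 3) = 336 * (M + 1) / R := by field_simp; norm_num
      linarith

/-- Landau's lemma: a lower bound for the real part of the logarithmic derivative of an entire
function having no zeros to the right of `c` in a small disc. -/
theorem neg_le_re_logDeriv {c : ℂ} {R M : ℝ} (hR : 0 < R) {f : ℂ → ℂ} (hf : Differentiable ℂ f)
    (hc : f c ≠ 0) (hb : ∀ z ∈ closedBall c R, ‖f z‖ ≤ Real.exp M * ‖f c‖)
    (hre : ∀ z ∈ closedBall c (R / 3), f z = 0 → z.re ≤ c.re) :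
    -(336 * (M + 1) / R) ≤ (deriv f c / f c).re := by
  obtain ⟨n, hn⟩ := exists_nat_gt (M / Real.log 2)
  refine re_logDeriv_ge_neg hR n f M hf hc ?_ hb hre
  rwa [div_lt_iff₀ (Real.log_pos one_lt_two)] at hn

/-- Landau's lemma, keeping the contribution of one zero at the same height as `c`. -/
theorem inv_sub_le_re_logDeriv {c : ℂ} {R M d : ℝ} (hR : 0 < R) (hd : 0 < d) (hdR : d ≤ R / 3)
    {f : ℂ → ℂ} (hf : Differentiable ℂ f)
    (hc : f c ≠ 0) (hb : ∀ z ∈ closedBall c R, ‖f z‖ ≤ Real.exp M * ‖f c‖)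
    (hre : ∀ z ∈ closedBall c (R / 3), f z = 0 → z.re ≤ c.re) (h0 : f (c - d) = 0) :
    1 / d - 336 * (M + 1) / R ≤ (deriv f c / f c).re := by
  obtain ⟨g, hg, hgc, hfg, hder⟩ := exists_eq_mul_one_sub_div hf h0 hc
  have hsub : (c - d - c : ℂ) = -(d : ℂ) := by ring
  have hb2 := norm_le_of_eq_mul_one_sub_div hg hR hfg
    (by intro h; apply hc; rw [← h, h0]) (by rw [hsub]; simpa [abs_of_pos hd]) hb
  have := neg_le_re_logDeriv (M := M) hR hg (hgc ▸ hc)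
    (fun z hz => (hb2 z hz).trans (by
      rw [hgc]; have := mul_nonneg (Real.exp_pos M).le (norm_nonneg (f c)); linarith))
    (fun z hz h => hre z hz (by rw [hfg, h, zero_mul]))
  rw [hder, hsub, sub_re]
  have : (1 / (-(d : ℂ))).re = -(1 / d) := by
    rw [one_div, inv_neg, neg_re, ← ofReal_inv, ofReal_re, one_div]
  linarith

end

open Complex Metric Finset

/-- The mean value of a Dirichlet character. -/
noncomputable def charMean {q : ℕ} [NeZero q] (χ : DirichletCharacter ℂ q) : ℂ :=
  (∑ a : ZMod q, χ a) / q

theorem charMean_of_ne_one {q : ℕ} [NeZero q] {χ : DirichletCharacter ℂ q} (h : χ ≠ 1) :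
    charMean χ = 0 := by
  rw [charMean, χ.sum_eq_zero_of_ne_one h, zero_div]

theorem norm_charMean_le {q : ℕ} [NeZero q] (χ : DirichletCharacter ℂ q) : ‖charMean χ‖ ≤ 1 := by
  rw [charMean, norm_div, norm_natCast]
  refine div_le_one_of_le₀ ?_ (Nat.cast_nonneg q)
  calc ‖∑ a : ZMod q, χ a‖ ≤ ∑ a : ZMod q, (1 : ℝ) := norm_sum_le_of_le _ fun a _ => χ.norm_le_one a
    _ = q := by simp

theorem sum_range_natCast_zmod {q : ℕ} [NeZero q] (g : ZMod q → ℂ) :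
    ∑ k ∈ range q, g (k : ZMod q) = ∑ a : ZMod q, g a := by
  refine Finset.sum_bij' (fun k _ => (k : ZMod q)) (fun a _ => a.val) ?_ ?_ ?_ ?_ ?_
  · simp
  · intro a _; simpa using ZMod.val_lt a
  · intro k hk; exact ZMod.val_cast_of_lt (by simpa using hk)
  · intro a _; simp
  · simp

theorem sum_Icc_charMean_mod {q : ℕ} [NeZero q] (χ : DirichletCharacter ℂ q) (n : ℕ) :
    ∑ k ∈ Icc 1 (n + q), (χ k - charMean χ) = ∑ k ∈ Icc 1 n, (χ k - charMean χ) := by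
  induction n with
  | zero =>
    have hq : (q : ℂ) ≠ 0 := NeZero.ne _
    have h : ∑ k ∈ range q, (χ (k : ZMod q) - charMean χ) = 0 := by
      rw [sum_range_natCast_zmod (fun a => χ a - charMean χ), sum_sub_distrib, charMean]
      simp
      field_simp
      simp
    have h2 := sum_range_succ' (fun k : ℕ => χ (k : ZMod q) - charMean χ) q
    rw [sum_range_succ, h] at h2
    rw [zero_add, ← Finset.Ico_add_one_right_eq_Icc, sum_Ico_eq_sum_range]
    simp only [CharP.cast_eq_zero, zero_add] at h2
    simpa [add_comm] using h2.symm
  | succ n ih =>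
    rw [add_right_comm, sum_Icc_succ_top (by omega), sum_Icc_succ_top (by omega), ih]
    simp

theorem norm_sum_Icc_sub_charMean_le {q : ℕ} [NeZero q] (χ : DirichletCharacter ℂ q) (n : ℕ) :
    ‖∑ k ∈ Icc 1 n, (χ k - charMean χ)‖ ≤ 2 * min (n : ℝ) q := by
  have htriv : ∀ n : ℕ, ‖∑ k ∈ Icc 1 n, (χ k - charMean χ)‖ ≤ 2 * (n : ℝ) := by
    intro n
    calc ‖∑ k ∈ Icc 1 n, (χ k - charMean χ)‖ ≤ ∑ k ∈ Icc 1 n, (2 : ℝ) := by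
          refine norm_sum_le_of_le _ fun k _ => (norm_sub_le _ _).trans ?_
          linarith [χ.norm_le_one k, norm_charMean_le χ]
      _ = 2 * n := by simp [mul_comm]
  have hper : ∀ m r : ℕ, ∑ k ∈ Icc 1 (r + q * m), (χ k - charMean χ)
      = ∑ k ∈ Icc 1 r, (χ k - charMean χ) := by
    intro m r
    induction m with
    | zero => simp
    | succ m ih => rw [mul_add, mul_one, ← add_assoc, sum_Icc_charMean_mod, ih]
  have hq : n % q < q := Nat.mod_lt _ (NeZero.pos q)
  have h1 := htriv (n % q)
  rw [← hper (n / q), Nat.mod_add_div] at h1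
  have h2 : ((n % q : ℕ) : ℝ) ≤ q := by exact_mod_cast hq.le
  rcases min_choice (n : ℝ) q with h | h <;> rw [h]
  · exact htriv n
  · linarith

theorem min_le_rpow_mul_rpow {a b θ : ℝ} (ha : 0 ≤ a) (hb : 0 ≤ b) (h0 : 0 ≤ θ) (h1 : θ ≤ 1) :
    min a b ≤ b ^ θ * a ^ (1 - θ) := by
  have hm : 0 ≤ min a b := le_min ha hb
  calc min a b = (min a b) ^ θ * (min a b) ^ (1 - θ) := by
        rw [← Real.rpow_add' hm (by simp)]; simp
    _ ≤ b ^ θ * a ^ (1 - θ) := by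
        gcongr
        · exact min_le_right _ _
        · exact min_le_left _ _

/-- The remainder in the summatory function of `χ`. -/
noncomputable def charErr {q : ℕ} [NeZero q] (χ : DirichletCharacter ℂ q) (t : ℝ) : ℂ :=
  ∑ k ∈ Icc 1 ⌊t⌋₊, χ k - charMean χ * t

theorem norm_charErr_le {q : ℕ} [NeZero q] (χ : DirichletCharacter ℂ q) {θ t : ℝ} (h0 : 0 ≤ θ)
    (h1 : θ ≤ 1) (ht : 1 ≤ t) : ‖charErr χ t‖ ≤ 3 * (q : ℝ) ^ θ * t ^ (1 - θ) := by
  have hq : (1 : ℝ) ≤ q := by exact_mod_cast NeZero.one_le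
  have ht0 : 0 ≤ t := by linarith
  have hfl : (⌊t⌋₊ : ℝ) ≤ t := Nat.floor_le ht0
  have h2 : charErr χ t = ∑ k ∈ Icc 1 ⌊t⌋₊, (χ k - charMean χ) - charMean χ * ((t - ⌊t⌋₊ : ℝ) : ℂ) := by
    rw [charErr, sum_sub_distrib]; simp; ring
  have h3 : (1 : ℝ) ≤ (q : ℝ) ^ θ * t ^ (1 - θ) :=
    one_le_mul_of_one_le_of_one_le (Real.one_le_rpow hq h0) (Real.one_le_rpow ht (by linarith))
  have h4 : ‖charMean χ * ((t - ⌊t⌋₊ : ℝ) : ℂ)‖ ≤ 1 := by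
    rw [norm_mul, norm_real, Real.norm_eq_abs, abs_of_nonneg (by linarith)]
    have := Nat.lt_floor_add_one t
    exact mul_le_one₀ (norm_charMean_le χ) (by linarith) (by linarith)
  have h5 := norm_sum_Icc_sub_charMean_le χ ⌊t⌋₊
  have h6 : min (⌊t⌋₊ : ℝ) q ≤ (q : ℝ) ^ θ * t ^ (1 - θ) :=
    (min_le_min_right _ hfl).trans (min_le_rpow_mul_rpow ht0 (by linarith) h0 h1)
  rw [h2]
  refine (norm_sub_le _ _).trans ?_
  linarith

theorem measurable_charErr {q : ℕ} [NeZero q] (χ : DirichletCharacter ℂ q) :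
    Measurable (charErr χ) := by
  unfold charErr
  refine Measurable.sub ?_ (by fun_prop)
  exact (measurable_from_nat (f := fun n => ∑ k ∈ Icc 1 n, χ k)).comp Nat.measurable_floor

open MeasureTheory Set in
theorem integral_Ioi_eq_mellin (E : ℝ → ℂ) (s : ℂ) :
    ∫ t in Ioi (1 : ℝ), E t * (t : ℂ) ^ (-(s + 1)) = mellin ((Ioi (1 : ℝ)).indicator E) (-s) := by
  rw [mellin]
  have : ∀ t : ℝ, (t : ℂ) ^ (-s - 1) • (Ioi (1 : ℝ)).indicator E t =
      (Ioi (1 : ℝ)).indicator (fun t => E t * (t : ℂ) ^ (-(s + 1))) t := by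
    intro t
    rw [smul_eq_mul, neg_add', mul_comm]
    by_cases h : t ∈ Ioi (1 : ℝ) <;> simp [h]
  simp_rw [this]
  rw [setIntegral_indicator measurableSet_Ioi]
  congr 2
  ext t
  simp only [Set.mem_inter_iff, Set.mem_Ioi]
  exact ⟨fun h => ⟨by linarith, h⟩, fun h => h.2⟩

open MeasureTheory Set Filter Topology Asymptotics in
theorem differentiableAt_integral_Ioi {E : ℝ → ℂ} (hE : Measurable E) {B θ : ℝ}
    (hb : ∀ t : ℝ, 1 ≤ t → ‖E t‖ ≤ B * t ^ (1 - θ)) {s : ℂ} (hs : 1 - θ < s.re) :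
    DifferentiableAt ℂ (fun s : ℂ => ∫ t in Ioi (1 : ℝ), E t * (t : ℂ) ^ (-(s + 1))) s := by
  simp_rw [integral_Ioi_eq_mellin]
  have hloc : LocallyIntegrableOn ((Ioi (1 : ℝ)).indicator E) (Ioi 0) := by
    have hg : LocallyIntegrableOn (fun t : ℝ => |B| * t ^ (1 - θ)) (Ioi 0) := by
      refine ContinuousOn.locallyIntegrableOn ?_ measurableSet_Ioi
      intro t ht
      exact (continuousAt_const.mul (Real.continuousAt_rpow_const _ _ (Or.inl (ne_of_gt ht)))).continuousWithinAt
    refine hg.mono (hE.indicator measurableSet_Ioi).aestronglyMeasurable ?_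
    refine Eventually.of_forall fun t => ?_
    by_cases h : t ∈ Ioi (1 : ℝ)
    · rw [Set.indicator_of_mem h, Real.norm_eq_abs]
      have h1 : (1 : ℝ) < t := h
      have ht0 : (0 : ℝ) < t := by linarith
      refine (hb t h1.le).trans ((mul_le_mul_of_nonneg_right (le_abs_self B)
        (by positivity)).trans (le_abs_self _))
    · rw [Set.indicator_of_notMem h]; simp; positivity
  have htop : (Ioi (1 : ℝ)).indicator E =O[atTop] (· ^ (-(θ - 1))) := by
    refine IsBigO.of_bound B ?_
    filter_upwards [eventually_gt_atTop 1] with t ht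
    rw [Set.indicator_of_mem (show t ∈ Ioi (1 : ℝ) from ht), neg_sub, Real.norm_eq_abs, abs_of_nonneg (by positivity)]
    exact hb t ht.le
  have hbot : (Ioi (1 : ℝ)).indicator E =O[𝓝[>] 0] (· ^ (-((-s).re - 1))) := by
    refine IsBigO.of_bound 1 ?_
    filter_upwards [mem_nhdsWithin_of_mem_nhds (Iio_mem_nhds zero_lt_one)] with t ht
    rw [Set.indicator_of_notMem (by simpa using le_of_lt (show t < 1 from ht))]
    simp
  have := mellin_differentiableAt_of_isBigO_rpow hloc htop
    (by rw [neg_re]; linarith) hbot (by linarith)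
  exact this.comp s differentiable_neg.differentiableAt

open MeasureTheory Set in
theorem norm_integral_Ioi_le {E : ℝ → ℂ} {B θ : ℝ}
    (hb : ∀ t : ℝ, 1 ≤ t → ‖E t‖ ≤ B * t ^ (1 - θ)) {s : ℂ} (hs : 1 - θ < s.re) :
    ‖∫ t in Ioi (1 : ℝ), E t * (t : ℂ) ^ (-(s + 1))‖ ≤ B / (s.re - 1 + θ) := by
  have hlt : -(s.re + θ) < -1 := by linarith
  have hInt : IntegrableOn (fun t : ℝ => B * t ^ (-(s.re + θ))) (Ioi 1) :=
    (integrableOn_Ioi_rpow_of_lt hlt zero_lt_one).const_mul B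
  refine (norm_integral_le_of_norm_le hInt ?_).trans (le_of_eq ?_)
  · refine (ae_restrict_mem measurableSet_Ioi).mono ?_
    intro t ht
    have ht1 : (1 : ℝ) < t := ht
    have ht0 : (0 : ℝ) < t := by linarith
    rw [norm_mul, norm_cpow_eq_rpow_re_of_pos ht0]
    calc ‖E t‖ * t ^ (-(s + 1)).re ≤ B * t ^ (1 - θ) * t ^ (-(s + 1)).re := by
          gcongr; exact hb t ht1.le
      _ = B * t ^ (-(s.re + θ)) := by
          rw [mul_assoc, ← Real.rpow_add ht0]
          congr 2
          simp; ring
  · rw [integral_const_mul, integral_Ioi_rpow_of_lt hlt zero_lt_one, Real.one_rpow]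
    rw [mul_div_assoc', mul_neg_one, neg_div, ← div_neg]
    congr 1
    ring

open MeasureTheory Set in
theorem integrableOn_Ioi_of_norm_le {E : ℝ → ℂ} (hE : Measurable E) {B θ : ℝ}
    (hb : ∀ t : ℝ, 1 ≤ t → ‖E t‖ ≤ B * t ^ (1 - θ)) {s : ℂ} (hs : 1 - θ < s.re) :
    IntegrableOn (fun t : ℝ => E t * (t : ℂ) ^ (-(s + 1))) (Ioi 1) := by
  have hlt : -(s.re + θ) < -1 := by linarith
  have hInt : IntegrableOn (fun t : ℝ => B * t ^ (-(s.re + θ))) (Ioi 1) :=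
    (integrableOn_Ioi_rpow_of_lt hlt zero_lt_one).const_mul B
  refine hInt.mono' (hE.mul (by fun_prop)).aestronglyMeasurable ?_
  refine (ae_restrict_mem measurableSet_Ioi).mono ?_
  intro t ht
  have ht1 : (1 : ℝ) < t := ht
  have ht0 : (0 : ℝ) < t := by linarith
  rw [norm_mul, norm_cpow_eq_rpow_re_of_pos ht0]
  calc ‖E t‖ * t ^ (-(s + 1)).re ≤ B * t ^ (1 - θ) * t ^ (-(s + 1)).re := by
        gcongr; exact hb t ht1.le
    _ = B * t ^ (-(s.re + θ)) := by
        rw [mul_assoc, ← Real.rpow_add ht0]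
        congr 2
        simp; ring

/-- The integral representation of a Dirichlet `L`-series. -/
theorem LFunction_eq_of_one_lt {q : ℕ} [NeZero q] (χ : DirichletCharacter ℂ q) {s : ℂ}
    (hs : 1 < s.re) : (s - 1) * χ.LFunction s = charMean χ * s +
      (s - 1) * (s * ∫ t in Set.Ioi (1 : ℝ), charErr χ t * (t : ℂ) ^ (-(s + 1))) := by
  have hs1 : s - 1 ≠ 0 := by
    intro h
    rw [sub_eq_zero.mp h, one_re] at hs
    exact lt_irrefl _ hs
  have hO : (fun n : ℕ => ∑ k ∈ Icc 1 n, ‖χ k‖) =O[Filter.atTop] fun n : ℕ => (n : ℝ) ^ (1 : ℝ) := by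
    refine Asymptotics.IsBigO.of_bound 1 (Filter.Eventually.of_forall fun n => ?_)
    rw [Real.norm_of_nonneg (by positivity), Real.rpow_one, one_mul, Real.norm_natCast]
    calc ∑ k ∈ Icc 1 n, ‖χ k‖ ≤ ∑ k ∈ Icc 1 n, (1 : ℝ) :=
          sum_le_sum fun k _ => χ.norm_le_one k
      _ = n := by simp
  rw [χ.LFunction_eq_LSeries hs, LSeries_eq_mul_integral' _ zero_le_one hs hO]
  have hcp : MeasureTheory.IntegrableOn (fun t : ℝ => (t : ℂ) ^ (-s)) (Set.Ioi 1) :=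
    integrableOn_Ioi_cpow_of_lt (by simpa using hs) zero_lt_one
  have hE := integrableOn_Ioi_of_norm_le (measurable_charErr χ) (θ := 0) (B := 3 * (q : ℝ) ^ (0 : ℝ))
    (fun t ht => norm_charErr_le χ le_rfl zero_le_one ht) (s := s) (by simpa using hs)
  have hsplit : ∫ t in Set.Ioi (1 : ℝ), (∑ k ∈ Icc 1 ⌊t⌋₊, χ k) * (t : ℂ) ^ (-(s + 1)) =
      (∫ t in Set.Ioi (1 : ℝ), charErr χ t * (t : ℂ) ^ (-(s + 1))) +
        ∫ t in Set.Ioi (1 : ℝ), charMean χ * (t : ℂ) ^ (-s) := by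
    rw [← MeasureTheory.integral_add hE (hcp.const_mul _)]
    refine MeasureTheory.setIntegral_congr_fun measurableSet_Ioi fun t ht => ?_
    have ht0 : (t : ℂ) ≠ 0 := by
      have : (1 : ℝ) < t := ht
      exact_mod_cast (by linarith : (0 : ℝ) < t).ne'
    have : (t : ℂ) ^ (-s) = t * (t : ℂ) ^ (-(s + 1)) := by
      rw [show -s = 1 + -(s + 1) by ring, cpow_add _ _ ht0, cpow_one]
    simp only [this, charErr]
    ring
  rw [hsplit, MeasureTheory.integral_const_mul,
    integral_Ioi_cpow_of_lt (by simpa using hs) zero_lt_one, ofReal_one, one_cpow]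
  have : -s + 1 = -(s - 1) := by ring
  rw [this]
  field_simp
  ring

theorem isPreconnected_re_gt (a : ℝ) : IsPreconnected {s : ℂ | a < s.re} :=
  (convex_halfSpace_re_gt a).isPreconnected

/-- The integral representation of the entire function `H` extending `(s - 1) L(s, χ)`. -/
theorem eq_integral_of_eqOn {q : ℕ} [NeZero q] (χ : DirichletCharacter ℂ q) {H : ℂ → ℂ}
    (hH : Differentiable ℂ H) (hHL : ∀ s : ℂ, 1 < s.re → H s = (s - 1) * χ.LFunction s)
    {s : ℂ} (hs : 0 < s.re) : H s = charMean χ * s +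
      (s - 1) * (s * ∫ t in Set.Ioi (1 : ℝ), charErr χ t * (t : ℂ) ^ (-(s + 1))) := by
  have hopen : IsOpen {s : ℂ | 0 < s.re} := isOpen_lt continuous_const continuous_re
  have h1 : AnalyticOnNhd ℂ H {s : ℂ | 0 < s.re} := hH.differentiableOn.analyticOnNhd hopen
  have h2 : AnalyticOnNhd ℂ (fun s => charMean χ * s +
      (s - 1) * (s * ∫ t in Set.Ioi (1 : ℝ), charErr χ t * (t : ℂ) ^ (-(s + 1))))
      {s : ℂ | 0 < s.re} := by
    refine DifferentiableOn.analyticOnNhd (fun z hz => ?_) hopen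
    have := differentiableAt_integral_Ioi (measurable_charErr χ) (θ := 1) (B := 3 * (q : ℝ) ^ (1 : ℝ))
      (fun t ht => norm_charErr_le χ zero_le_one le_rfl ht) (s := z) (by simpa using hz)
    exact (((differentiableAt_id.const_mul _).add ((differentiableAt_id.sub_const 1).mul
      (differentiableAt_id.mul this)))).differentiableWithinAt
  refine h1.eqOn_of_preconnected_of_eventuallyEq h2 (isPreconnected_re_gt 0) (z₀ := 2)
    (by simp) ?_ hs
  have : {s : ℂ | 1 < s.re} ∈ nhds (2 : ℂ) :=
    (isOpen_lt continuous_const continuous_re).mem_nhds (by simp)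
  filter_upwards [this] with z hz
  rw [hHL z hz, LFunction_eq_of_one_lt χ hz]

theorem norm_le_of_eqOn {q : ℕ} [NeZero q] (χ : DirichletCharacter ℂ q) {H : ℂ → ℂ}
    (hH : Differentiable ℂ H) (hHL : ∀ s : ℂ, 1 < s.re → H s = (s - 1) * χ.LFunction s)
    {s : ℂ} (hs : 0 < s.re) : ‖H s‖ ≤ ‖s‖ + ‖s - 1‖ * (‖s‖ * (3 * q / s.re)) := by
  rw [eq_integral_of_eqOn χ hH hHL hs]
  refine (norm_add_le _ _).trans ?_
  rw [norm_mul, norm_mul, norm_mul]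
  have := norm_integral_Ioi_le (B := 3 * (q : ℝ) ^ (1 : ℝ)) (θ := 1)
      (fun t ht => norm_charErr_le χ zero_le_one le_rfl ht) (s := s) (by simpa using hs)
  simp only [Real.rpow_one, sub_add_cancel] at this
  gcongr
  exact mul_le_of_le_one_left (norm_nonneg s) (norm_charMean_le χ)

theorem norm_LFunction_le {q : ℕ} [NeZero q] {χ : DirichletCharacter ℂ q} (hχ : χ ≠ 1) {θ : ℝ}
    (h0 : 0 ≤ θ) (h1 : θ ≤ 1) {s : ℂ} (hs0 : 0 < s.re) (hs : 1 - θ < s.re) :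
    ‖χ.LFunction s‖ ≤ ‖s‖ * (3 * (q : ℝ) ^ θ / (s.re - 1 + θ)) := by
  have key : ∀ s : ℂ, 0 < s.re → s ≠ 1 → χ.LFunction s =
      s * ∫ t in Set.Ioi (1 : ℝ), charErr χ t * (t : ℂ) ^ (-(s + 1)) := by
    intro s hs hs1
    have := eq_integral_of_eqOn χ (H := fun s => (s - 1) * χ.LFunction s)
      ((differentiable_id.sub_const 1).mul (χ.differentiable_LFunction hχ)) (fun _ _ => rfl) hs
    rw [charMean_of_ne_one hχ, zero_mul, zero_add] at this
    exact mul_left_cancel₀ (sub_ne_zero.mpr hs1) this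
  have hne : ∀ s : ℂ, 0 < s.re → 1 - θ < s.re → s ≠ 1 →
      ‖χ.LFunction s‖ ≤ ‖s‖ * (3 * (q : ℝ) ^ θ / (s.re - 1 + θ)) := by
    intro s hs0 hs hs1
    rw [key s hs0 hs1, norm_mul]
    gcongr
    exact norm_integral_Ioi_le (fun t ht => norm_charErr_le χ h0 h1 ht) hs
  by_cases hs1 : s = 1
  · subst hs1
    have hθ : 0 < θ := by simpa using hs
    have hden : (1 : ℂ).re - 1 + θ ≠ 0 := by simpa using hθ.ne'
    have hc1 : ContinuousAt (fun s => ‖χ.LFunction s‖) 1 :=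
      (χ.differentiable_LFunction hχ).continuous.continuousAt.norm
    have hc2 : ContinuousAt (fun s : ℂ => ‖s‖ * (3 * (q : ℝ) ^ θ / (s.re - 1 + θ))) 1 := by
      refine continuous_norm.continuousAt.mul (continuousAt_const.div ?_ hden)
      fun_prop
    refine le_of_tendsto_of_tendsto (hc1.mono_left nhdsWithin_le_nhds)
      (hc2.mono_left nhdsWithin_le_nhds) (b := nhdsWithin 1 {1}ᶜ) ?_
    have ho : {s : ℂ | 0 < s.re ∧ 1 - θ < s.re} ∈ nhds (1 : ℂ) :=
      ((isOpen_lt continuous_const continuous_re).inter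
        (isOpen_lt continuous_const continuous_re)).mem_nhds ⟨hs0, hs⟩
    filter_upwards [mem_nhdsWithin_of_mem_nhds ho, self_mem_nhdsWithin] with z hz hz1
    exact hne z hz.1 hz.2 hz1
  · exact hne s hs0 hs hs1

open Classical in
/-- The entire function `L(s, χ)`, or `(s - 1) L(s, χ)` if `χ` is trivial. -/
noncomputable def entireL {q : ℕ} [NeZero q] (χ : DirichletCharacter ℂ q) : ℂ → ℂ :=
  if χ = 1 then DirichletCharacter.LFunctionTrivChar₁ q else χ.LFunction

section entireL

variable {q : ℕ} [NeZero q]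

theorem entireL_of_ne_one {χ : DirichletCharacter ℂ q} (h : χ ≠ 1) : entireL χ = χ.LFunction := by
  rw [entireL, if_neg h]

theorem entireL_one : entireL (1 : DirichletCharacter ℂ q) =
    DirichletCharacter.LFunctionTrivChar₁ q := by
  rw [entireL, if_pos rfl]

theorem entireL_one_apply {s : ℂ} (hs : s ≠ 1) : entireL (1 : DirichletCharacter ℂ q) s =
    (s - 1) * DirichletCharacter.LFunction (1 : DirichletCharacter ℂ q) s := by
  rw [entireL_one, DirichletCharacter.LFunctionTrivChar₁, Function.update_of_ne hs]

theorem differentiable_entireL (χ : DirichletCharacter ℂ q) : Differentiable ℂ (entireL χ) := by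
  by_cases h : χ = 1
  · rw [h, entireL_one]
    exact DirichletCharacter.differentiable_LFunctionTrivChar₁ q
  · rw [entireL_of_ne_one h]
    exact χ.differentiable_LFunction h

theorem entireL_ne_zero_of_one_le_re (χ : DirichletCharacter ℂ q) {s : ℂ} (hs : 1 ≤ s.re) :
    entireL χ s ≠ 0 := by
  by_cases h : χ = 1
  · subst h
    by_cases h1 : s = 1
    · rw [h1, entireL_one]
      exact DirichletCharacter.LFunctionTrivChar₁_apply_one_ne_zero q
    · rw [entireL_one_apply h1]
      exact mul_ne_zero (sub_ne_zero.mpr h1)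
        (DirichletCharacter.LFunction_ne_zero_of_one_le_re _ (Or.inr h1) hs)
  · rw [entireL_of_ne_one h]
    exact DirichletCharacter.LFunction_ne_zero_of_one_le_re _ (Or.inl h) hs

theorem ne_one_of_one_lt_re {s : ℂ} (hs : 1 < s.re) : s ≠ 1 := by
  rintro rfl
  simp at hs

theorem norm_entireL_le' (χ : DirichletCharacter ℂ q) {s : ℂ} (hs : 0 < s.re) :
    ‖entireL χ s‖ ≤ ‖s‖ + (‖s - 1‖ + 1) * (‖s‖ * (3 * q / s.re)) := by
  have h0 : 0 ≤ ‖s‖ * (3 * q / s.re) := by positivity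
  by_cases h : χ = 1
  · subst h
    refine (norm_le_of_eqOn 1 (differentiable_entireL _)
      (fun s hs => entireL_one_apply (ne_one_of_one_lt_re hs)) hs).trans ?_
    gcongr
    linarith
  · rw [entireL_of_ne_one h]
    have := norm_LFunction_le h zero_le_one le_rfl hs (by simpa using hs)
    simp only [Real.rpow_one, sub_add_cancel] at this
    nlinarith [norm_nonneg s, norm_nonneg (s - 1)]

theorem norm_entireL_le (χ : DirichletCharacter ℂ q) {s : ℂ} (hs : 1 / 4 ≤ s.re) :
    ‖entireL χ s‖ ≤ 36 * q * (‖s‖ + 1) ^ 2 := by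
  refine (norm_entireL_le' χ (by linarith)).trans ?_
  have hq : (1 : ℝ) ≤ q := by exact_mod_cast NeZero.one_le
  have h1 : 3 * (q : ℝ) / s.re ≤ 12 * q := by
    rw [div_le_iff₀ (by linarith)]; nlinarith
  have h2 : ‖s - 1‖ ≤ ‖s‖ + 1 := by simpa using norm_sub_le s 1
  have h3 := norm_nonneg s
  calc ‖s‖ + (‖s - 1‖ + 1) * (‖s‖ * (3 * q / s.re))
      ≤ ‖s‖ + (‖s‖ + 1 + 1) * (‖s‖ * (12 * q)) := by gcongr
    _ ≤ 36 * q * (‖s‖ + 1) ^ 2 := by nlinarith [mul_nonneg h3 h3, mul_nonneg (mul_nonneg h3 h3) (by linarith : (0:ℝ) ≤ q), mul_nonneg h3 (by linarith : (0:ℝ) ≤ q)]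

open Classical in
/-- The logarithmic derivative of `entireL`. -/
theorem LSeries_twist_eq_entireL (χ : DirichletCharacter ℂ q) {s : ℂ} (hs : 1 < s.re) :
    LSeries (fun n => χ n * (ArithmeticFunction.vonMangoldt n : ℂ)) s =
      -(deriv (entireL χ) s / entireL χ s) + if χ = 1 then 1 / (s - 1) else 0 := by
  have h1 := χ.LSeries_twist_vonMangoldt_eq hs
  rw [← χ.deriv_LFunction_eq_deriv_LSeries hs, ← χ.LFunction_eq_LSeries hs] at h1
  have hs1 := ne_one_of_one_lt_re hs
  have hne : χ.LFunction s ≠ 0 :=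
    χ.LFunction_ne_zero_of_one_le_re (Or.inr hs1) hs.le
  change LSeries ((fun n : ℕ => χ n) * fun n => (ArithmeticFunction.vonMangoldt n : ℂ)) s = _
  rw [h1]
  by_cases h : χ = 1
  · subst h
    rw [if_pos rfl, entireL_one_apply hs1, entireL_one,
      DirichletCharacter.deriv_LFunctionTrivChar₁_apply_of_ne_one q hs1]
    have := sub_ne_zero.mpr hs1
    simp only [DirichletCharacter.LFunctionTrivChar]
    field_simp
    ring
  · rw [if_neg h, entireL_of_ne_one h, neg_div, add_zero]

end entireL

theorem LSeriesSummable_twist (q : ℕ) (χ : DirichletCharacter ℂ q) {s : ℂ} (hs : 1 < s.re) :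
    LSeriesSummable (fun n => χ n * (ArithmeticFunction.vonMangoldt n : ℂ)) s :=
  χ.LSeriesSummable_twist_vonMangoldt hs

theorem LSeries_one_char (s : ℂ) :
    LSeries (fun n : ℕ => (1 : DirichletCharacter ℂ 1) n) s = LSeries 1 s := by
  congr 1
  ext n
  simp [Subsingleton.elim (n : ZMod 1) 1]

theorem norm_riemannZeta_le {σ : ℝ} (h1 : 1 < σ) (h2 : σ ≤ 2) :
    ‖riemannZeta σ‖ ≤ 5 / (σ - 1) := by
  have h := norm_le_of_eqOn (1 : DirichletCharacter ℂ 1) (differentiable_entireL _)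
    (fun s hs => entireL_one_apply (ne_one_of_one_lt_re hs)) (s := σ) (by simp; linarith)
  rw [entireL_one_apply (ne_one_of_one_lt_re (by simpa using h1)),
    DirichletCharacter.LFunction_modOne_eq] at h
  rw [le_div_iff₀' (by linarith)]
  rw [norm_mul, ← ofReal_one, ← ofReal_sub, norm_real, norm_real, Real.norm_of_nonneg (by linarith),
    Real.norm_of_nonneg (by linarith)] at h
  simp only [ofReal_re, Nat.cast_one, mul_one] at h
  rw [mul_div_cancel₀ _ (by linarith)] at h
  linarith

theorem norm_term_le_of_norm_le_one {f : ℕ → ℂ} (hf : ∀ n, ‖f n‖ ≤ 1) (s : ℂ) (n : ℕ) :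
    ‖LSeries.term f s n‖ ≤ ‖LSeries.term 1 s n‖ :=
  LSeries.norm_term_le s (by simpa using hf n)

theorem norm_LSeries_le_zeta {f : ℕ → ℂ} (hf : ∀ n, ‖f n‖ ≤ 1) {s : ℂ} (hs : 1 < s.re) :
    ‖LSeries f s‖ ≤ ‖riemannZeta s.re‖ := by
  have hs' : 1 < (s.re : ℂ).re := by simpa using hs
  have hsum : Summable fun n => ‖LSeries.term 1 s n‖ := (LSeriesSummable_one_iff.mpr hs).norm
  have hre : ∀ n, LSeries.term 1 (s.re : ℂ) n = (‖LSeries.term 1 s n‖ : ℂ) := by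
    intro n
    rw [LSeries.norm_term_eq, LSeries.term_def]
    split_ifs with h
    · simp
    · simp [ofReal_cpow]
  rw [← LSeries_one_eq_riemannZeta hs', LSeries, LSeries]
  simp_rw [hre]
  rw [← ofReal_tsum, norm_real]
  refine le_trans ?_ (le_abs_self _)
  exact tsum_of_norm_bounded hsum.hasSum (norm_term_le_of_norm_le_one hf s)

theorem norm_LFunction_ge {q : ℕ} [NeZero q] (χ : DirichletCharacter ℂ q) {s : ℂ} (h1 : 1 < s.re)
    (h2 : s.re ≤ 2) : (s.re - 1) / 5 ≤ ‖χ.LFunction s‖ := by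
  have h := DirichletCharacter.LSeries.mul_mu_eq_one χ h1
  rw [← χ.LFunction_eq_LSeries h1] at h
  have h3 : ‖LSeries ((fun n : ℕ => χ n) * fun n => (ArithmeticFunction.moebius n : ℂ)) s‖ ≤
      5 / (s.re - 1) := by
    refine (norm_LSeries_le_zeta (fun n => ?_) h1).trans (norm_riemannZeta_le h1 h2)
    rw [Pi.mul_apply, norm_mul]
    refine mul_le_one₀ (χ.norm_le_one _) (norm_nonneg _) ?_
    rw [norm_intCast]
    exact_mod_cast ArithmeticFunction.abs_moebius_le_one
  have h4 := congrArg norm h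
  rw [norm_mul, norm_one] at h4
  have hp : 0 < s.re - 1 := by linarith
  have h5 : 1 ≤ ‖χ.LFunction s‖ * (5 / (s.re - 1)) := by
    exact h4.symm.le.trans (by gcongr)
  rw [← mul_div_assoc, le_div_iff₀ hp] at h5
  linarith

theorem exists_re_LSeries_vonMangoldt_le : ∃ C : ℝ, 0 < C ∧ ∀ σ : ℝ, 1 < σ → σ ≤ 2 →
    (LSeries (fun n => (ArithmeticFunction.vonMangoldt n : ℂ)) σ).re ≤ 1 / (σ - 1) + C := by
  have hcont : ContinuousOn (fun σ : ℝ => ‖deriv (entireL (1 : DirichletCharacter ℂ 1)) σ /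
      entireL (1 : DirichletCharacter ℂ 1) σ‖) (Set.Icc 1 2) := by
    have hd : Differentiable ℂ (deriv (entireL (1 : DirichletCharacter ℂ 1))) :=
      (differentiable_entireL _).deriv
    refine (ContinuousOn.div (hd.continuous.comp continuous_ofReal).continuousOn
      ((differentiable_entireL _).continuous.comp continuous_ofReal).continuousOn ?_).norm
    intro σ hσ
    exact entireL_ne_zero_of_one_le_re _ (by simpa using hσ.1)
  obtain ⟨C, hC⟩ := isCompact_Icc.exists_bound_of_continuousOn hcont
  refine ⟨|C| + 1, by positivity, fun σ h1 h2 => ?_⟩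
  have hs : 1 < (σ : ℂ).re := by simpa using h1
  have h := LSeries_twist_eq_entireL (1 : DirichletCharacter ℂ 1) hs
  rw [if_pos rfl] at h
  have h3 : (fun n : ℕ => (1 : DirichletCharacter ℂ 1) n * (ArithmeticFunction.vonMangoldt n : ℂ)) =
      fun n => (ArithmeticFunction.vonMangoldt n : ℂ) := by
    ext n
    simp [Subsingleton.elim (n : ZMod 1) 1]
  rw [h3] at h
  rw [h, add_re, neg_re]
  have h4 : (1 / ((σ : ℂ) - 1)).re = 1 / (σ - 1) := by
    rw [← ofReal_one, ← ofReal_sub, ← ofReal_div, ofReal_re]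
  have h5 := hC σ ⟨h1.le, h2⟩
  rw [norm_norm] at h5
  have h6 := (abs_le.mp ((abs_re_le_norm _).trans h5)).1
  rw [h4]
  linarith [le_abs_self C]

theorem three_four_one (z : ℂ) (hz : ‖z‖ = 1) : 0 ≤ 3 + 4 * z.re + (z ^ 2).re := by
  have h : z.re ^ 2 + z.im ^ 2 = 1 := by
    rw [← sq_norm_sub_sq_re z, hz]; ring
  rw [pow_two, mul_re]
  nlinarith [sq_nonneg (z.re + 1)]

theorem three_four_one_LSeries {q : ℕ} (χ : DirichletCharacter ℂ q) {σ : ℝ}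
    (hσ : 1 < σ) (t : ℝ) :
    0 ≤ 3 * (LSeries (fun n => (ArithmeticFunction.vonMangoldt n : ℂ)) σ).re +
      4 * (LSeries (fun n => χ n * (ArithmeticFunction.vonMangoldt n : ℂ)) (σ + t * I)).re +
      (LSeries (fun n => (χ ^ 2) n * (ArithmeticFunction.vonMangoldt n : ℂ))
        (σ + (2 * t : ℝ) * I)).re := by
  have hs : 1 < (σ : ℂ).re := by simpa using hσ
  have s0 := ArithmeticFunction.LSeriesSummable_vonMangoldt hs
  have s1 := LSeriesSummable_twist q χ (s := σ + t * I) (by simpa using hσ)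
  have s2 := LSeriesSummable_twist q (χ ^ 2) (s := σ + (2 * t : ℝ) * I) (by simpa using hσ)
  have e0 := (hasSum_re s0.hasSum).mul_left 3
  have e1 := (hasSum_re s1.hasSum).mul_left 4
  have e2 := hasSum_re s2.hasSum
  refine ((e0.add e1).add e2).nonneg fun n => ?_
  rcases eq_or_ne n 0 with rfl | hn
  · simp
  have hnpos : (0 : ℝ) < n := by exact_mod_cast Nat.pos_of_ne_zero hn
  have hnC : (n : ℂ) ≠ 0 := by exact_mod_cast hn
  set L : ℝ := ArithmeticFunction.vonMangoldt n with hL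
  have hL0 : 0 ≤ L := ArithmeticFunction.vonMangoldt_nonneg
  set w : ℂ := (n : ℂ) ^ (-(t * I)) with hw
  have hw1 : ‖w‖ = 1 := by
    rw [hw, ← ofReal_natCast, norm_cpow_eq_rpow_re_of_pos hnpos]
    simp
  have t0 : LSeries.term (fun n => (ArithmeticFunction.vonMangoldt n : ℂ)) σ n =
      ((L * (n : ℝ) ^ (-σ) : ℝ) : ℂ) := by
    rw [LSeries.term_of_ne_zero hn, div_eq_mul_inv, ← cpow_neg]
    push_cast [ofReal_cpow hnpos.le]
    rfl
  have hx : ((n : ℂ) ^ (-(σ : ℂ))) = (((n : ℝ) ^ (-σ) : ℝ) : ℂ) := by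
    push_cast [ofReal_cpow hnpos.le]; rfl
  have t1 : LSeries.term (fun n => χ n * (ArithmeticFunction.vonMangoldt n : ℂ)) (σ + t * I) n =
      ((L * (n : ℝ) ^ (-σ) : ℝ) : ℂ) * (χ n * w) := by
    rw [LSeries.term_of_ne_zero hn, div_eq_mul_inv, ← cpow_neg, neg_add, cpow_add _ _ hnC, hx,
      ofReal_mul]
    ring
  have t2 : LSeries.term (fun n => (χ ^ 2) n * (ArithmeticFunction.vonMangoldt n : ℂ))
      (σ + (2 * t : ℝ) * I) n = ((L * (n : ℝ) ^ (-σ) : ℝ) : ℂ) * (χ n * w) ^ 2 := by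
    have : (n : ℂ) ^ (-(((2 * t : ℝ) : ℂ) * I)) = w ^ 2 := by
      rw [hw, ← cpow_nat_mul]; congr 1; push_cast; ring
    rw [LSeries.term_of_ne_zero hn, div_eq_mul_inv, ← cpow_neg, neg_add, cpow_add _ _ hnC, hx,
      this, ofReal_mul, MulChar.pow_apply' _ two_ne_zero]
    ring
  rw [t0, t1, t2, ofReal_re, re_ofReal_mul, re_ofReal_mul]
  have hP : 0 ≤ L * (n : ℝ) ^ (-σ) := by positivity
  by_cases hu : IsUnit (n : ZMod q)
  · have hz : ‖χ n * w‖ = 1 := by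
      rw [norm_mul, hw1, mul_one, ← hu.unit_spec, DirichletCharacter.unit_norm_eq_one χ hu.unit]
    nlinarith [mul_nonneg hP (three_four_one _ hz)]
  · rw [MulChar.map_nonunit _ hu]
    simp
    positivity

theorem le_norm_entireL {q : ℕ} [NeZero q] (χ : DirichletCharacter ℂ q) {s : ℂ} {δ : ℝ}
    (hδ : 0 < δ) (hδ1 : δ ≤ 1) (hs : s.re = 1 + δ) : δ ^ 2 / 5 ≤ ‖entireL χ s‖ := by
  have h1 : 1 < s.re := by linarith
  have h := norm_LFunction_ge χ h1 (by linarith)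
  have h2 : δ / 5 ≤ ‖χ.LFunction s‖ := by rwa [hs, add_sub_cancel_left] at h
  by_cases hχ : χ = 1
  · subst hχ
    rw [entireL_one_apply (ne_one_of_one_lt_re h1), norm_mul]
    have h3 : δ ≤ ‖s - 1‖ := by
      refine le_trans ?_ (abs_re_le_norm _)
      rw [sub_re, hs, one_re, add_sub_cancel_left]
      exact le_abs_self δ
    calc δ ^ 2 / 5 = δ * (δ / 5) := by ring
      _ ≤ _ := by gcongr
  · rw [entireL_of_ne_one hχ]
    nlinarith

theorem norm_entireL_le_exp_mul {q : ℕ} [NeZero q] (χ : DirichletCharacter ℂ q) {s : ℂ} {δ M : ℝ}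
    (hδ : 0 < δ) (hδ1 : δ ≤ 1 / 8) (hs : s.re = 1 + δ)
    (hM : Real.log (180 * q * (|s.im| + 3) ^ 2 / δ ^ 2) ≤ M) :
    ∀ z ∈ closedBall s (1 / 2), ‖entireL χ z‖ ≤ Real.exp M * ‖entireL χ s‖ := by
  intro z hz
  rw [mem_closedBall, dist_eq_norm] at hz
  have hq : (1 : ℝ) ≤ q := by exact_mod_cast NeZero.one_le
  have hre := abs_le.mp ((abs_re_le_norm _).trans hz)
  rw [sub_re, hs] at hre
  have h1 := norm_entireL_le χ (s := z) (by linarith)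
  have h2 : ‖z‖ ≤ |s.im| + 2 := by
    have h3 : ‖z‖ ≤ ‖z - s‖ + ‖s‖ := by simpa using norm_add_le (z - s) s
    have h4 := norm_le_abs_re_add_abs_im s
    rw [hs, abs_of_pos (by linarith)] at h4
    linarith
  have h5 := le_norm_entireL χ hδ (by linarith) hs
  have hX : 0 < 180 * q * (|s.im| + 3) ^ 2 / δ ^ 2 := by positivity
  calc ‖entireL χ z‖ ≤ 36 * q * (‖z‖ + 1) ^ 2 := h1
    _ ≤ 36 * q * (|s.im| + 3) ^ 2 := by
        have : ‖z‖ + 1 ≤ |s.im| + 3 := by linarith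
        gcongr
    _ = 180 * q * (|s.im| + 3) ^ 2 / δ ^ 2 * (δ ^ 2 / 5) := by field_simp; ring
    _ ≤ Real.exp M * ‖entireL χ s‖ := by
        gcongr
        exact (Real.log_le_iff_le_exp hX).mp hM

theorem one_le_log_mul_add_three {q : ℕ} [NeZero q] (t : ℝ) : 1 ≤ Real.log (q * (|t| + 3)) := by
  have hq : (1 : ℝ) ≤ q := by exact_mod_cast NeZero.one_le
  rw [Real.le_log_iff_exp_le (by positivity)]
  nlinarith [Real.exp_one_lt_d9, abs_nonneg t]

theorem log_growth_le {q : ℕ} [NeZero q] {t δ : ℝ} (hδ : 0 < δ) :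
    Real.log (180 * q * (|t| + 3) ^ 2 / δ ^ 2) ≤
      8 * Real.log (q * (|t| + 3)) + 2 * Real.log (1 / δ) := by
  have hq : (1 : ℝ) ≤ q := by exact_mod_cast NeZero.one_le
  have h1 := one_le_log_mul_add_three (q := q) t
  have h180 : Real.log 180 ≤ 6 := by
    rw [Real.log_le_iff_le_exp (by norm_num)]
    have h := Real.exp_one_gt_d9
    calc (180 : ℝ) ≤ 2.7 ^ 6 := by norm_num
      _ ≤ Real.exp 1 ^ 6 := by gcongr; linarith
      _ = Real.exp 6 := by rw [← Real.exp_nat_mul]; norm_num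
  have h2 : 180 * (q : ℝ) * (|t| + 3) ^ 2 / δ ^ 2 ≤ 180 * (q * (|t| + 3)) ^ 2 * (1 / δ) ^ 2 := by
    rw [one_div, inv_pow, ← div_eq_mul_inv]
    have h3 : (q : ℝ) ≤ q ^ 2 := by nlinarith
    have h4 : 180 * (q : ℝ) * (|t| + 3) ^ 2 ≤ 180 * (q * (|t| + 3)) ^ 2 := by
      rw [mul_pow, ← mul_assoc]
      gcongr
    gcongr
  refine (Real.log_le_log (by positivity) h2).trans ?_
  rw [Real.log_mul (by positivity) (by positivity), Real.log_mul (by positivity) (by positivity),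
    Real.log_pow, Real.log_pow]
  push_cast
  linarith

theorem log_two_mul_le {q : ℕ} [NeZero q] (t : ℝ) :
    Real.log (q * (|2 * t| + 3)) ≤ 2 * Real.log (q * (|t| + 3)) := by
  have hq : (1 : ℝ) ≤ q := by exact_mod_cast NeZero.one_le
  have h2 : (2 : ℝ) * Real.log (q * (|t| + 3)) = Real.log ((q * (|t| + 3)) ^ 2) := by
    rw [Real.log_pow]; norm_num
  rw [h2]
  refine Real.log_le_log (by positivity) ?_
  rw [abs_mul, abs_two, mul_pow, pow_two (q : ℝ), mul_assoc (q : ℝ)]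
  gcongr
  nlinarith [abs_nonneg t, mul_nonneg (abs_nonneg t) (abs_nonneg t)]

theorem mul_log_inv_le {δ k : ℝ} (hδ : 0 < δ) (hk : 0 ≤ k) (hδk : δ ≤ k ^ 2) :
    δ * Real.log (1 / δ) ≤ 2 * k := by
  have hs : 0 < Real.sqrt δ := Real.sqrt_pos.mpr hδ
  have h1 : Real.sqrt δ ≤ k := by rw [Real.sqrt_le_left hk]; exact hδk
  have h2 : Real.log (1 / Real.sqrt δ) ≤ 1 / Real.sqrt δ :=
    (Real.log_le_sub_one_of_pos (by positivity)).trans (by linarith)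
  have h3 : Real.log (1 / δ) = 2 * Real.log (1 / Real.sqrt δ) := by
    rw [one_div, one_div, Real.log_inv, Real.log_inv, Real.log_sqrt hδ.le]; ring
  have h4 : δ = Real.sqrt δ * Real.sqrt δ := (Real.mul_self_sqrt hδ.le).symm
  have h5 : δ * (1 / Real.sqrt δ) = Real.sqrt δ := by
    nth_rewrite 1 [h4]; field_simp
  rw [h3]
  nlinarith

theorem re_one_div_le {δ t η k : ℝ} (hδ : 0 < δ) 
    (hδη : δ ≤ k ^ 2 * η) (ht : η ^ 2 / 2 ≤ t ^ 2) :
    (1 / (((1 + δ : ℝ) : ℂ) + (t : ℂ) * I - 1)).re ≤ 2 * k ^ 4 / δ := by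
  have h : ((1 + δ : ℝ) : ℂ) + (t : ℂ) * I - 1 = ⟨δ, t⟩ := by
    apply Complex.ext <;> simp
  have hpos : 0 < δ * δ + t * t := add_pos_of_pos_of_nonneg (mul_pos hδ hδ) (mul_self_nonneg t)
  rw [h, one_div, inv_re, normSq_mk, div_le_div_iff₀ hpos hδ]
  have h2 : δ ^ 2 ≤ k ^ 4 * η ^ 2 := by
    calc δ ^ 2 ≤ (k ^ 2 * η) ^ 2 := by gcongr
      _ = k ^ 4 * η ^ 2 := by ring
  nlinarith [mul_le_mul_of_nonneg_left ht (by positivity : (0:ℝ) ≤ k ^ 4), mul_pos hδ hδ, (by positivity : 0 ≤ k ^ 4 * (δ * δ))]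

theorem sq_div_two_le_im_sq {ρ : ℂ} {η : ℝ} (hη : 0 < η) (h2 : η ≤ ‖ρ - 1‖) (h0 : ρ.re < 1)
    (h1 : 1 - ρ.re ≤ η / 8) : η ^ 2 / 2 ≤ ρ.im ^ 2 := by
  have h4 : η ^ 2 ≤ (ρ.re - 1) ^ 2 + ρ.im ^ 2 := by
    calc η ^ 2 ≤ ‖ρ - 1‖ ^ 2 := by gcongr
      _ = (ρ.re - 1) ^ 2 + ρ.im ^ 2 := by
        rw [Complex.sq_norm, normSq_apply]; simp; ring
  have h5 : (1 - ρ.re) ^ 2 ≤ (η / 8) ^ 2 := by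
    have : 0 ≤ 1 - ρ.re := by linarith
    gcongr
  nlinarith

theorem zero_free_numerics {C k δ d ℒ M : ℝ} (hC : 0 < C) (hk0 : 0 < k)
    (hkC : k * (3 * C + 80000) = 1 / 2) (hδ : 0 < δ) (hδk : δ ≤ k) (hδk2 : δ ≤ k ^ 2)
    (hδL : δ * ℒ ≤ k ^ 2) (hd0 : 0 < d) (hd9 : d ≤ 9 * δ / 8)
    (hM : M = 16 * ℒ + 2 * Real.log (1 / δ))
    (hfin : 4 * (1 / d) ≤ 3 * (1 / δ + C) + 3360 * (M + 1) + 10 * k ^ 4 / δ) : False := by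
  have hk1 : k ≤ 1 / 8 := by nlinarith
  have hk2 : k ^ 2 ≤ k := by nlinarith
  have h4d : 3.5 * (1 / δ) ≤ 4 * (1 / d) := by
    rw [mul_one_div, mul_one_div, div_le_div_iff₀ hδ hd0]; linarith
  have hmul : δ * (3.5 * (1 / δ)) ≤ δ * (3 * (1 / δ + C) + 3360 * (M + 1) + 10 * k ^ 4 / δ) :=
    mul_le_mul_of_nonneg_left (h4d.trans hfin) hδ.le
  have hexp : δ * (3 * (1 / δ + C) + 3360 * (M + 1) + 10 * k ^ 4 / δ) =
      3 + 3 * C * δ + 3360 * (16 * (δ * ℒ) + 2 * (δ * Real.log (1 / δ)) + δ) + 10 * k ^ 4 := by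
    rw [hM]; field_simp
  have hexp2 : δ * (3.5 * (1 / δ)) = 3.5 := by field_simp
  rw [hexp, hexp2] at hmul
  have hlog := mul_log_inv_le hδ hk0.le hδk2
  have hk4 : k ^ 4 ≤ k := by
    calc k ^ 4 ≤ k ^ 1 := pow_le_pow_of_le_one hk0.le (by linarith) (by norm_num)
      _ = k := pow_one k
  have := mul_le_mul_of_nonneg_left hδk hC.le
  linarith

theorem sq_le_sq_two_mul (t : ℝ) : t ^ 2 ≤ (2 * t) ^ 2 := by nlinarith [sq_nonneg t]

set_option maxHeartbeats 1000000 in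
/-- The classical zero-free region, relative to a disc around `1`. -/
theorem exists_zero_free_region : ∃ κ : ℝ, 0 < κ ∧ κ ≤ 1 / 8 ∧ ∀ (q : ℕ) [NeZero q]
    (χ : DirichletCharacter ℂ q) (η : ℝ), 0 < η →
    (χ ^ 2 = 1 → ∀ s : ℂ, ‖s - 1‖ < η → entireL χ s ≠ 0) →
    ∀ ρ : ℂ, entireL χ ρ = 0 →
      ρ.re ≤ 1 - κ * min η (1 / Real.log (q * (|ρ.im| + 3))) := by
  obtain ⟨C, hC, hCb⟩ := exists_re_LSeries_vonMangoldt_le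
  set k : ℝ := 1 / (2 * (3 * C + 80000)) with hk
  have hk0 : 0 < k := by positivity
  have hkC : k * (3 * C + 80000) = 1 / 2 := by rw [hk]; field_simp
  have hk1 : k ≤ 1 / 8 := by nlinarith
  have hk2 : k ^ 2 ≤ k := by nlinarith
  refine ⟨k ^ 2 / 8, by positivity, by nlinarith, ?_⟩
  intro q _ χ η hη hηz ρ hρ
  by_contra! hcon
  set ℒ := Real.log (q * (|ρ.im| + 3)) with hℒ
  have hL1 : 1 ≤ ℒ := one_le_log_mul_add_three ρ.im
  set m := min η (1 / ℒ) with hm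
  have hm0 : 0 < m := lt_min hη (by positivity)
  have hmη : m ≤ η := min_le_left _ _
  have hmL : m ≤ 1 / ℒ := min_le_right _ _
  have hm1 : m ≤ 1 := hmL.trans (by rw [div_le_one₀ (by linarith)]; exact hL1)
  set δ := k ^ 2 * m with hδdef
  have hδ : 0 < δ := by positivity
  have hδk2 : δ ≤ k ^ 2 := by rw [hδdef]; nlinarith [sq_nonneg k]
  have hδk : δ ≤ k := hδk2.trans hk2
  have hδη : δ ≤ k ^ 2 * η := by rw [hδdef]; gcongr
  have hδL : δ * ℒ ≤ k ^ 2 := by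
    calc δ * ℒ ≤ k ^ 2 * (1 / ℒ) * ℒ := by rw [hδdef]; gcongr
      _ = k ^ 2 := by field_simp
  have hβ : ρ.re < 1 := by
    by_contra! h
    exact entireL_ne_zero_of_one_le_re χ h hρ
  have hβ2 : 1 - ρ.re < δ / 8 := by rw [hδdef]; linarith
  set d := δ + (1 - ρ.re) with hd
  have hd0 : 0 < d := by linarith
  have hs1 : (1 : ℝ) < 1 + δ := by linarith
  set s₁ : ℂ := ((1 + δ : ℝ) : ℂ) + (ρ.im : ℂ) * I with hs₁
  set s₂ : ℂ := ((1 + δ : ℝ) : ℂ) + ((2 * ρ.im : ℝ) : ℂ) * I with hs₂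
  have hs₁re : s₁.re = 1 + δ := by simp [hs₁]
  have hs₂re : s₂.re = 1 + δ := by simp [hs₂]
  have hs₁im : s₁.im = ρ.im := by simp [hs₁]
  have hs₂im : s₂.im = 2 * ρ.im := by simp [hs₂]
  set M := 16 * ℒ + 2 * Real.log (1 / δ) with hM
  have hM1 : Real.log (180 * q * (|s₁.im| + 3) ^ 2 / δ ^ 2) ≤ M := by
    refine (log_growth_le hδ).trans ?_
    rw [hs₁im]
    linarith
  have hM2 : Real.log (180 * q * (|s₂.im| + 3) ^ 2 / δ ^ 2) ≤ M := by
    refine (log_growth_le hδ).trans ?_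
    rw [hs₂im]
    linarith [log_two_mul_le (q := q) ρ.im]
  have hzre : ∀ ψ : DirichletCharacter ℂ q, ∀ s : ℂ, s.re = 1 + δ →
      ∀ z ∈ closedBall s ((1 / 2) / 3), entireL ψ z = 0 → z.re ≤ s.re := by
    intro ψ s hs z _ hz
    by_contra! h
    exact entireL_ne_zero_of_one_le_re ψ (by linarith) hz
  have hρ' : entireL χ (s₁ - d) = 0 := by
    have : s₁ - d = ρ := by apply Complex.ext <;> simp [hs₁, hd]; ring
    rw [this, hρ]
  have b1 := inv_sub_le_re_logDeriv (R := 1 / 2) (M := M) (by norm_num) hd0 (by linarith)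
    (differentiable_entireL χ) (entireL_ne_zero_of_one_le_re χ (by linarith))
    (norm_entireL_le_exp_mul χ hδ (by linarith) hs₁re hM1) (hzre χ s₁ hs₁re) hρ'
  have b2 := neg_le_re_logDeriv (R := 1 / 2) (M := M) (by norm_num)
    (differentiable_entireL (χ ^ 2)) (entireL_ne_zero_of_one_le_re (χ ^ 2) (s := s₂) (by linarith))
    (norm_entireL_le_exp_mul (χ ^ 2) hδ (by linarith) hs₂re hM2) (hzre (χ ^ 2) s₂ hs₂re)
  have h341 := three_four_one_LSeries χ hs1 ρ.im
  have hz := hCb (1 + δ) hs1 (by linarith)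
  rw [← hs₁, ← hs₂, LSeries_twist_eq_entireL χ (by linarith),
    LSeries_twist_eq_entireL (χ ^ 2) (by linarith), add_re, add_re, neg_re, neg_re] at h341
  have him : χ ^ 2 = 1 → η ^ 2 / 2 ≤ ρ.im ^ 2 := by
    intro h
    have h2 : η ≤ ‖ρ - 1‖ := by
      by_contra! h3
      exact hηz h ρ h3 hρ
    exact sq_div_two_le_im_sq hη h2 hβ (by nlinarith)
  have p1 : (if χ = 1 then 1 / (s₁ - 1) else (0 : ℂ)).re ≤ 2 * k ^ 4 / δ := by
    split_ifs with h
    · exact re_one_div_le hδ hδη (him (by rw [h, one_pow]))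
    · simp; positivity
  have p2 : (if χ ^ 2 = 1 then 1 / (s₂ - 1) else (0 : ℂ)).re ≤ 2 * k ^ 4 / δ := by
    split_ifs with h
    · exact re_one_div_le hδ hδη ((him h).trans (sq_le_sq_two_mul _))
    · simp; positivity
  have hfin : 4 * (1 / d) ≤ 3 * (1 / δ + C) + 3360 * (M + 1) + 10 * k ^ 4 / δ := by
    rw [add_sub_cancel_left] at hz
    have e : 10 * k ^ 4 / δ = 5 * (2 * k ^ 4 / δ) := by ring
    rw [e]
    linarith
  exact zero_free_numerics hC hk0 hkC hδ hδk hδk2 hδL hd0 (by linarith) hM hfin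

theorem abs_tsum_tail_le {h : ℕ → ℝ} {B r : ℝ} (hB : 0 ≤ B) (hr0 : 0 ≤ r) (hr : r ≤ 3 / 4)
    (hh : ∀ m, |h m| ≤ B * r ^ m) (M : ℕ) :
    Summable h ∧ |(∑' m, h m) - ∑ m ∈ range M, h m| ≤ 4 * B * r ^ M := by
  have hg : Summable fun m => B * r ^ m :=
    (summable_geometric_of_lt_one hr0 (by linarith)).mul_left B
  have hs : Summable h := Summable.of_norm_bounded hg hh
  refine ⟨hs, ?_⟩
  rw [← hs.sum_add_tsum_nat_add M, add_sub_cancel_left]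
  have hgM : HasSum (fun m => B * r ^ (m + M)) (B * r ^ M * (1 - r)⁻¹) := by
    have := (hasSum_geometric_of_lt_one hr0 (by linarith)).mul_left (B * r ^ M)
    refine this.congr_fun ?_
    intro m
    ring
  refine (tsum_of_norm_bounded (f := fun m => h (m + M)) hgM fun m => hh (m + M)).trans ?_
  have h1 : (1 - r)⁻¹ ≤ 4 := by
    rw [inv_le_comm₀ (by linarith) (by norm_num)]
    linarith
  have h2 : 0 ≤ B * r ^ M := by positivity
  nlinarith

theorem half_le_tsum_mul_exp {h : ℕ → ℝ} {B d : ℝ} (hd : 0 < d) (hd1 : d ≤ 1 / 8) (hB : 1 ≤ B)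
    (hh : ∀ m, |h m| ≤ B * (2 / 3) ^ m) (h0 : 1 ≤ h 0) (hS : ∀ m, 0 ≤ ∑ j ∈ range (m + 1), h j)
    (hw : 0 ≤ ∑' m, h m * (1 + d) ^ m) :
    d / 2 ≤ (∑' m, h m) * Real.exp (d * (4 * Real.log (20 * B / d) + 2)) := by
  have abel : ∀ M : ℕ, ∑ m ∈ range (M + 2), h m * (1 + d) ^ m ≤
      (∑ m ∈ range (M + 2), h m) * (1 + d) ^ (M + 1) - d := by
    intro M
    induction M with
    | zero => simp [sum_range_succ]; nlinarith
    | succ M ih =>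
      rw [sum_range_succ, sum_range_succ _ (M + 2)]
      have := hS (M + 1)
      have h2 : 0 ≤ (∑ m ∈ range (M + 2), h m) * (1 + d) ^ (M + 1) := by
        apply mul_nonneg this; positivity
      rw [pow_succ (1 + d) (M + 1)]
      nlinarith
  set M := ⌈4 * Real.log (20 * B / d)⌉₊ with hM
  have hL : 0 ≤ Real.log (20 * B / d) := by
    apply Real.log_nonneg
    rw [le_div_iff₀ hd]; linarith
  have hM1 : 4 * Real.log (20 * B / d) ≤ M := Nat.le_ceil _
  have hM2 : (M : ℝ) ≤ 4 * Real.log (20 * B / d) + 1 := (Nat.ceil_lt_add_one (by positivity)).le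
  obtain ⟨-, t1⟩ := abs_tsum_tail_le (by linarith) (by norm_num : (0:ℝ) ≤ 2 / 3) (by norm_num) hh (M + 2)
  obtain ⟨-, t2⟩ := abs_tsum_tail_le (h := fun m => h m * (1 + d) ^ m) (B := B) (r := 3 / 4)
    (by linarith) (by norm_num) le_rfl (fun m => by
      rw [abs_mul, abs_of_nonneg (by positivity : 0 ≤ (1 + d) ^ m)]
      calc |h m| * (1 + d) ^ m ≤ B * (2 / 3) ^ m * (9 / 8) ^ m := by
            gcongr
            · exact hh m
            · linarith
        _ = _ := by rw [mul_assoc, ← mul_pow]; norm_num) (M + 2)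
  have hp : (3 / 4 : ℝ) ^ M ≤ d / (20 * B) := by
    have h1 : (3 / 4 : ℝ) ≤ Real.exp (-(1 / 4)) := by
      have := Real.add_one_le_exp (-(1 / 4) : ℝ); linarith
    calc (3 / 4 : ℝ) ^ M ≤ Real.exp (-(1 / 4)) ^ M := by gcongr
      _ = Real.exp (-(M / 4)) := by rw [← Real.exp_nat_mul]; ring_nf
      _ ≤ Real.exp (-Real.log (20 * B / d)) := by
          apply Real.exp_le_exp.mpr; linarith
      _ = d / (20 * B) := by
          rw [Real.exp_neg, Real.exp_log (by positivity), inv_div]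
  have hBp : B * (3 / 4 : ℝ) ^ M ≤ d / 20 := by
    calc B * (3 / 4 : ℝ) ^ M ≤ B * (d / (20 * B)) := by gcongr
      _ = d / 20 := by field_simp
  have hwp : (1 + d) ^ (M + 1) ≤ Real.exp (d * (4 * Real.log (20 * B / d) + 2)) := by
    calc (1 + d) ^ (M + 1) ≤ Real.exp d ^ (M + 1) := by
          gcongr; linarith [Real.add_one_le_exp d]
      _ = Real.exp (d * (M + 1)) := by rw [← Real.exp_nat_mul]; push_cast; ring_nf
      _ ≤ _ := by
          apply Real.exp_le_exp.mpr
          apply mul_le_mul_of_nonneg_left _ hd.le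
          linarith
  have hab := abel M
  rw [abs_le] at t1 t2
  have hp0 : 0 ≤ (1 + d) ^ (M + 1) := by positivity
  have hmul : (2 / 3 : ℝ) ^ (M + 2) * (1 + d) ^ (M + 1) ≤ (3 / 4) ^ (M + 1) := by
    calc (2 / 3 : ℝ) ^ (M + 2) * (1 + d) ^ (M + 1) ≤ (2 / 3 : ℝ) ^ (M + 1) * (9 / 8) ^ (M + 1) := by
          gcongr ?_ * ?_ ^ _
          · exact pow_le_pow_of_le_one (by norm_num) (by norm_num) (by lia)
          · linarith
      _ = _ := by rw [← mul_pow]; norm_num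
  have e1 : (∑ m ∈ range (M + 2), h m) * (1 + d) ^ (M + 1) ≤
      (∑' m, h m) * (1 + d) ^ (M + 1) + 4 * B * (3 / 4) ^ (M + 1) := by
    have : 4 * B * ((2 / 3 : ℝ) ^ (M + 2) * (1 + d) ^ (M + 1)) ≤ 4 * B * (3 / 4) ^ (M + 1) := by
      gcongr
    nlinarith [t1.1]
  have e3 : d / 2 ≤ (∑' m, h m) * (1 + d) ^ (M + 1) := by
    have := t2.2
    have p1 : (3 / 4 : ℝ) ^ (M + 1) = 3 / 4 * (3 / 4) ^ M := by ring
    have p2 : (3 / 4 : ℝ) ^ (M + 2) = 9 / 16 * (3 / 4) ^ M := by ring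
    rw [p1] at e1
    rw [p2] at this
    linarith
  have hpos : 0 < (∑' m, h m) := by
    by_contra hcon
    nlinarith
  exact e3.trans (mul_le_mul_of_nonneg_left hwp hpos.le)

theorem iteratedDeriv_succ_eq_of_eqOn {H L : ℂ → ℂ} {U : Set ℂ} (hU : IsOpen U)
    (hL : DifferentiableOn ℂ L U) (hH : ∀ s ∈ U, H s = (s - 1) * L s) (n : ℕ) :
    ∀ s ∈ U, iteratedDeriv (n + 1) H s =
      (s - 1) * iteratedDeriv (n + 1) L s + (n + 1) * iteratedDeriv n L s := by
  have hd : ∀ n, ∀ s ∈ U, HasDerivAt (iteratedDeriv n L) (iteratedDeriv (n + 1) L s) s := by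
    intro n s hs
    rw [iteratedDeriv_succ]
    refine DifferentiableAt.hasDerivAt ?_
    rw [iteratedDeriv_eq_iterate]
    exact (AnalyticAt.iterated_deriv (hL.analyticAt (hU.mem_nhds hs)) n).differentiableAt
  have hid : ∀ s : ℂ, HasDerivAt (fun s : ℂ => s - 1) 1 s := fun s => (hasDerivAt_id s).sub_const 1
  induction n with
  | zero =>
    intro s hs
    have h1 := (hid s).mul (hd 0 s hs)
    have h2 : H =ᶠ[nhds s] fun s => (s - 1) * iteratedDeriv 0 L s := by
      filter_upwards [hU.mem_nhds hs] with z hz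
      simpa using hH z hz
    rw [iteratedDeriv_succ, iteratedDeriv_zero, h2.deriv_eq]
    refine h1.deriv.trans ?_
    push_cast
    ring
  | succ n ih =>
    intro s hs
    have h1 := ((hid s).mul (hd (n + 1) s hs)).add ((hd n s hs).const_mul ((n : ℂ) + 1))
    have h2 : iteratedDeriv (n + 1) H =ᶠ[nhds s] fun s =>
        (s - 1) * iteratedDeriv (n + 1) L s + (n + 1) * iteratedDeriv n L s := by
      filter_upwards [hU.mem_nhds hs] with z hz using ih z hz
    rw [iteratedDeriv_succ, h2.deriv_eq]
    refine h1.deriv.trans ?_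
    push_cast
    ring

open scoped ComplexOrder Nat in
theorem half_le_re_mul_exp {b : ℕ → ℂ} (hb : 0 ≤ b) (hb1 : b 1 = 1)
    (hs : ∀ s : ℂ, 1 < s.re → LSeriesSummable b s) {H : ℂ → ℂ} (hH : Differentiable ℂ H)
    (hHb : ∀ s : ℂ, 1 < s.re → H s = (s - 1) * LSeries b s) {B : ℝ} (hB : 1 ≤ B)
    (hHB : ∀ z, ‖z - 2‖ ≤ 3 / 2 → ‖H z‖ ≤ B) {d : ℝ} (hd : 0 < d) (hd1 : d ≤ 1 / 8)
    (hβ : H (1 - d) = 0 ∨ ∀ x : ℝ, 1 - d ≤ x → H x ≠ 0) :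
    d / 2 ≤ (H 1).re * Real.exp (d * (4 * Real.log (20 * B / d) + 2)) := by
  have habs : LSeries.abscissaOfAbsConv b ≤ 1 :=
    LSeries.abscissaOfAbsConv_le_of_forall_lt_LSeriesSummable fun y hy => hs y (by simpa using hy)
  have habs2 : LSeries.abscissaOfAbsConv b < ((2 : ℝ) : EReal) :=
    habs.trans_lt (by norm_cast)
  have hU : IsOpen {s : ℂ | 1 < s.re} := continuous_re.isOpen_preimage _ isOpen_Ioi
  have hL : DifferentiableOn ℂ (LSeries b) {s : ℂ | 1 < s.re} := fun s hs' =>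
    (LSeries_hasDerivAt (habs.trans_lt (by exact_mod_cast hs'))).differentiableAt.differentiableWithinAt
  have h2U : (2 : ℂ) ∈ {s : ℂ | 1 < s.re} := by simp
  set a : ℕ → ℂ := fun m => (-1) ^ m * iteratedDeriv m (LSeries b) 2 / m ! with ha
  have ha0 : ∀ m, 0 ≤ (a m).re := by
    intro m
    have h1 := LSeries.iteratedDeriv_alternating hb habs2 m
    rw [ofReal_ofNat, Complex.le_def] at h1
    rw [ha]
    simp only [← ofReal_natCast, div_ofReal_re]
    exact div_nonneg h1.1 (Nat.cast_nonneg _)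
  have ha1 : ∀ m, (a m).im = 0 := by
    intro m
    have h1 := LSeries.iteratedDeriv_alternating hb habs2 m
    rw [ofReal_ofNat, Complex.le_def] at h1
    rw [ha]
    simp only [← ofReal_natCast, div_ofReal_im]
    rw [← h1.2]
    simp
  set h : ℕ → ℂ := fun m => (-1) ^ m * iteratedDeriv m H 2 / m ! with hh
  have hsum : ∀ m, ∑ j ∈ range (m + 1), h j = a m := by
    intro m
    induction m with
    | zero =>
      simp [hh, ha, hHb 2 h2U]; norm_num
    | succ m ih =>
      rw [sum_range_succ, ih]
      simp only [hh, ha]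
      rw [iteratedDeriv_succ_eq_of_eqOn hU hL hHb m 2 h2U, Nat.factorial_succ]
      have : (m ! : ℂ) ≠ 0 := by exact_mod_cast m.factorial_ne_zero
      have : (m : ℂ) + 1 ≠ 0 := by exact_mod_cast m.succ_ne_zero
      push_cast
      field_simp
      ring
  have him : ∀ m, (h m).im = 0 := by
    intro m
    cases m with
    | zero => rw [← ha1 0, ← hsum 0, sum_range_one]
    | succ m =>
      have h1 := hsum (m + 1)
      rw [sum_range_succ, hsum m] at h1
      have h2 := congrArg Complex.im h1
      rw [add_im, ha1, ha1, zero_add] at h2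
      exact h2
  have htay : ∀ w : ℂ, HasSum (fun m => h m * w ^ m) (H (2 - w)) := by
    intro w
    refine (hasSum_taylorSeries_of_entire hH 2 (2 - w)).congr_fun ?_
    intro m
    simp only [hh, smul_eq_mul]
    rw [show (2 : ℂ) - w - 2 = -1 * w by ring, mul_pow]
    ring
  have htayr : ∀ w : ℝ, HasSum (fun m => (h m).re * w ^ m) (H (2 - w)).re := by
    intro w
    refine (hasSum_re (htay w)).congr_fun ?_
    intro m
    rw [← ofReal_pow, re_mul_ofReal]
  have hreal : ∀ x : ℝ, (H x).im = 0 := by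
    intro x
    have h1 := hasSum_im (htay ((2 - x : ℝ) : ℂ))
    have h2 : (2 : ℂ) - ((2 - x : ℝ) : ℂ) = x := by push_cast; ring
    rw [h2] at h1
    rw [← h1.tsum_eq]
    refine (tsum_congr fun m => ?_).trans tsum_zero
    rw [← ofReal_pow, im_mul_ofReal, him, zero_mul]
  have hL2 : 1 ≤ (LSeries b 2).re := by
    have hsm := hs 2 h2U
    have hre := hasSum_re hsm.hasSum
    have h1 := le_hasSum hre 1 (fun j _ => by
      have := LSeries.term_nonneg (hb j) 2
      rw [ofReal_ofNat, Complex.le_def] at this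
      exact this.1)
    refine le_trans ?_ h1
    simp [LSeries.term_of_ne_zero, hb1]
  have hβ : 0 ≤ (H (1 - d)).re := by
    rcases hβ with h | h
    · rw [h]; simp
    by_contra! hneg
    have hcont : ContinuousOn (fun x : ℝ => (H x).re) (Set.Icc (1 - d) 2) :=
      (continuous_re.comp (hH.continuous.comp continuous_ofReal)).continuousOn
    have h2 : 1 ≤ (H (2 : ℝ)).re := by
      rw [ofReal_ofNat, hHb 2 h2U]
      norm_num
      exact hL2
    obtain ⟨x, hx, hx0⟩ := intermediate_value_Icc (by linarith : 1 - d ≤ 2) hcont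
      (show (0 : ℝ) ∈ Set.Icc _ _ from ⟨by push_cast; exact hneg.le, by linarith⟩)
    exact h x hx.1 (Complex.ext hx0 (hreal x))
  have e1 : (H 1).re = ∑' m, (h m).re := by
    have := (htayr 1).tsum_eq
    simp only [one_pow, mul_one] at this
    rw [this]
    norm_num
  rw [e1]
  apply half_le_tsum_mul_exp hd hd1 hB
  · intro m
    refine (abs_re_le_norm _).trans ?_
    have := norm_iteratedDeriv_le_of_forall_mem_sphere_norm_le (c := 2) (R := 3 / 2) (C := B) m (by norm_num)
      hH.diffContOnCl (fun z hz => hHB z (by rw [mem_sphere, dist_eq_norm] at hz; exact hz.le))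
    have hm : (0 : ℝ) < m ! := by exact_mod_cast m.factorial_pos
    simp only [hh, norm_div, norm_mul, norm_pow, norm_neg, norm_one, one_pow, one_mul, Complex.norm_natCast]
    rw [div_le_iff₀ hm]
    refine this.trans (le_of_eq ?_)
    rw [show (2 / 3 : ℝ) = (3 / 2)⁻¹ by norm_num, inv_pow]
    field_simp
  · have h00 : h 0 = LSeries b 2 := by simp [hh, hHb 2 h2U]; norm_num
    rw [h00]
    exact hL2
  · intro m
    have := hsum m
    rw [← re_sum, this]
    exact ha0 m
  · rw [(htayr (1 + d)).tsum_eq]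
    convert hβ using 3
    push_cast
    ring

/-- A completely multiplicative function as an arithmetic function. -/
noncomputable def cmul (c : ℕ →* ℂ) : ArithmeticFunction ℂ := toArithmeticFunction c

/-- The arithmetic function `n ↦ c n * Λ n`. -/
noncomputable def cmulMangoldt (c : ℕ →* ℂ) : ArithmeticFunction ℂ :=
  toArithmeticFunction fun n => c n * (ArithmeticFunction.vonMangoldt n : ℂ)

/-- Multiplication by the logarithm, as a derivation on arithmetic functions. -/
noncomputable def logMul (f : ArithmeticFunction ℂ) : ArithmeticFunction ℂ :=
  toArithmeticFunction fun n => f n * (Real.log n : ℂ)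

theorem toArithmeticFunction_apply {f : ℕ → ℂ} {n : ℕ} (hn : n ≠ 0) :
    toArithmeticFunction f n = f n := by
  simp [toArithmeticFunction, hn]

theorem logMul_mul (f g : ArithmeticFunction ℂ) : logMul (f * g) = logMul f * g + f * logMul g := by
  ext n
  by_cases hn : n = 0
  · subst hn; simp
  rw [ArithmeticFunction.add_apply, logMul, toArithmeticFunction_apply hn,
    ArithmeticFunction.mul_apply, ArithmeticFunction.mul_apply, ArithmeticFunction.mul_apply,
    Finset.sum_mul, ← Finset.sum_add_distrib]
  refine Finset.sum_congr rfl fun p hp => ?_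
  obtain ⟨h1, h2⟩ := Nat.mem_divisorsAntidiagonal.mp hp
  have hp1 : p.1 ≠ 0 := by rintro h; simp [h] at h1; exact h2 h1.symm
  have hp2 : p.2 ≠ 0 := by rintro h; simp [h] at h1; exact h2 h1.symm
  rw [logMul, logMul, toArithmeticFunction_apply hp1, toArithmeticFunction_apply hp2, ← h1]
  push_cast
  rw [Real.log_mul (by exact_mod_cast hp1) (by exact_mod_cast hp2)]
  push_cast
  ring

theorem logMul_cmul (c : ℕ →* ℂ) : logMul (cmul c) = cmul c * cmulMangoldt c := by
  ext n
  by_cases hn : n = 0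
  · subst hn; simp
  rw [logMul, toArithmeticFunction_apply hn, ArithmeticFunction.mul_apply,
    ← ArithmeticFunction.vonMangoldt_sum,
    ← Nat.sum_divisorsAntidiagonal' fun _ b => ArithmeticFunction.vonMangoldt b, ofReal_sum,
    Finset.mul_sum]
  refine Finset.sum_congr rfl fun p hp => ?_
  obtain ⟨h1, h2⟩ := Nat.mem_divisorsAntidiagonal.mp hp
  have hp1 : p.1 ≠ 0 := by rintro h; simp [h] at h1; exact h2 h1.symm
  have hp2 : p.2 ≠ 0 := by rintro h; simp [h] at h1; exact h2 h1.symm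
  rw [cmul, cmulMangoldt, toArithmeticFunction_apply hp1, toArithmeticFunction_apply hp2,
    toArithmeticFunction_apply hn, ← h1, map_mul]
  ring

/-- The Dirichlet convolution of completely multiplicative functions. -/
noncomputable def cmulProd (l : List (ℕ →* ℂ)) : ArithmeticFunction ℂ := (l.map cmul).prod

theorem logMul_cmulProd (l : List (ℕ →* ℂ)) :
    logMul (cmulProd l) = cmulProd l * (l.map cmulMangoldt).sum := by
  induction l with
  | nil =>
    simp only [cmulProd, List.map_nil, List.prod_nil, List.sum_nil, mul_zero]
    ext n
    by_cases hn : n = 0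
    · subst hn; simp
    rw [logMul, toArithmeticFunction_apply hn]
    by_cases h1 : n = 1 <;> simp [h1]
  | cons c l ih =>
    simp only [cmulProd, List.map_cons, List.prod_cons, List.sum_cons] at ih ⊢
    rw [logMul_mul, ih, logMul_cmul]
    ring

theorem cmulProd_one (l : List (ℕ →* ℂ)) : cmulProd l 1 = 1 := by
  induction l with
  | nil => simp [cmulProd]
  | cons c l ih =>
    simp only [cmulProd, List.map_cons, List.prod_cons] at ih ⊢
    rw [ArithmeticFunction.mul_apply_one, ih, cmul, toArithmeticFunction_apply one_ne_zero]
    simp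

theorem sum_cmulMangoldt_apply (l : List (ℕ →* ℂ)) {n : ℕ} (hn : n ≠ 0) :
    (l.map cmulMangoldt).sum n =
      (l.map fun c => c n).sum * (ArithmeticFunction.vonMangoldt n : ℂ) := by
  induction l with
  | nil => simp
  | cons c l ih =>
    simp only [List.map_cons, List.sum_cons, ArithmeticFunction.add_apply, ih, add_mul]
    rw [cmulMangoldt, toArithmeticFunction_apply hn]

open scoped ComplexOrder in
theorem cmulProd_nonneg {l : List (ℕ →* ℂ)} (hl : ∀ n : ℕ, 0 ≤ (l.map fun c => c n).sum) (n : ℕ) :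
    0 ≤ cmulProd l n := by
  induction n using Nat.strong_induction_on with
  | _ n ih =>
    rcases Nat.lt_or_ge n 2 with h | h
    · interval_cases n
      · simp
      · rw [cmulProd_one]; exact zero_le_one
    have hn : n ≠ 0 := by lia
    have h1 := congrArg (fun f : ArithmeticFunction ℂ => f n) (logMul_cmulProd l)
    simp only [logMul] at h1
    rw [toArithmeticFunction_apply hn, ArithmeticFunction.mul_apply] at h1
    have hlog : 0 < Real.log n := Real.log_pos (by exact_mod_cast h)
    have h2 : cmulProd l n = (∑ p ∈ n.divisorsAntidiagonal,
        cmulProd l p.1 * (l.map cmulMangoldt).sum p.2) * ((Real.log n)⁻¹ : ℝ) := by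
      rw [← h1, mul_assoc, ← ofReal_mul, mul_inv_cancel₀ hlog.ne']
      simp
    rw [h2]
    refine mul_nonneg (Finset.sum_nonneg fun p hp => ?_) (by exact_mod_cast (inv_pos.mpr hlog).le)
    obtain ⟨h3, -⟩ := Nat.mem_divisorsAntidiagonal.mp hp
    have hp1 : p.1 ≠ 0 := by rintro h; simp [h] at h3; exact hn h3.symm
    have hp2 : p.2 ≠ 0 := by rintro h; simp [h] at h3; exact hn h3.symm
    rw [sum_cmulMangoldt_apply l hp2]
    by_cases hp21 : p.2 = 1
    · simp [hp21]
    · refine mul_nonneg (ih _ ?_) (mul_nonneg (hl _) ?_)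
      · rw [← h3]
        exact lt_mul_of_one_lt_right (Nat.pos_of_ne_zero hp1) (by lia)
      · exact_mod_cast ArithmeticFunction.vonMangoldt_nonneg

theorem LSeries_cmulProd {l : List (ℕ →* ℂ)} (hl : ∀ c ∈ l, ∀ n, ‖c n‖ ≤ 1) {s : ℂ}
    (hs : 1 < s.re) : LSeriesSummable (cmulProd l) s ∧
      LSeries (cmulProd l) s = (l.map fun c : ℕ →* ℂ => LSeries (fun n => c n) s).prod := by
  induction l with
  | nil =>
    have h : LSeriesSummable (LSeries.delta) s := LSeriesSummable_of_bounded_of_one_lt_re (m := 1)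
      (fun n hn => by by_cases h : n = 1 <;> simp [LSeries.delta, h]) hs
    have : ((1 : ArithmeticFunction ℂ) : ℕ → ℂ) = LSeries.delta := by
      ext n; simp [ArithmeticFunction.one_apply, LSeries.delta]
    simp only [cmulProd, List.map_nil, List.prod_nil]
    rw [this, LSeries_delta]
    exact ⟨h, rfl⟩
  | cons c l ih =>
    obtain ⟨h1, h2⟩ := ih fun c hc => hl c (List.mem_cons_of_mem _ hc)
    have h3 : LSeriesSummable (cmul c) s :=
      LSeriesSummable_of_bounded_of_one_lt_re (m := 1) (fun n hn => by
        rw [cmul, toArithmeticFunction_apply hn]; exact hl c (by simp) n) hs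
    have h4 : LSeries (cmul c) s = LSeries c s :=
      LSeries_congr (fun hn => toArithmeticFunction_apply hn) s
    simp only [cmulProd, List.map_cons, List.prod_cons] at h1 h2 ⊢
    refine ⟨ArithmeticFunction.LSeriesSummable_mul h3 h1, ?_⟩
    rw [ArithmeticFunction.LSeries_mul' h3 h1, h4, h2]

/-- A Dirichlet character as a completely multiplicative function on `ℕ`. -/
noncomputable def charHom {q : ℕ} (χ : DirichletCharacter ℂ q) : ℕ →* ℂ :=
  χ.toMonoidHom.comp (Nat.castRingHom (ZMod q)).toMonoidHom

theorem charHom_apply {q : ℕ} (χ : DirichletCharacter ℂ q) (n : ℕ) : charHom χ n = χ n := rfl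

theorem one_sub_mul_cpow_ne_zero {p : ℕ} (hp : p.Prime) {z s : ℂ} (hz : ‖z‖ ≤ 1) (hs : 0 < s.re) :
    1 - z * (p : ℂ) ^ (-s) ≠ 0 := by
  intro h
  have h1 : ‖z * (p : ℂ) ^ (-s)‖ = 1 := by
    rw [← sub_eq_zero.mp h, norm_one]
  have h2 : ‖(p : ℂ) ^ (-s)‖ < 1 := by
    rw [norm_natCast_cpow_of_pos hp.pos]
    exact Real.rpow_lt_one_of_one_lt_of_neg (by exact_mod_cast hp.one_lt) (by simpa using hs)
  rw [norm_mul] at h1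
  nlinarith [norm_nonneg z, norm_nonneg ((p : ℂ) ^ (-s))]

theorem entireL_changeLevel_eq_zero_iff {m n : ℕ} [NeZero m] [NeZero n] (h : m ∣ n)
    (χ : DirichletCharacter ℂ m) {s : ℂ} (hs : 0 < s.re) :
    entireL (DirichletCharacter.changeLevel h χ) s = 0 ↔ entireL χ s = 0 := by
  by_cases hs1 : s = 1
  · simp [entireL_ne_zero_of_one_le_re _ (by simp [hs1] : 1 ≤ s.re)]
  have hP : ∏ p ∈ n.primeFactors, (1 - χ p * (p : ℂ) ^ (-s)) ≠ 0 :=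
    Finset.prod_ne_zero_iff.mpr fun p hp =>
      one_sub_mul_cpow_ne_zero (Nat.prime_of_mem_primeFactors hp) (χ.norm_le_one _) hs
  have hL := DirichletCharacter.LFunction_changeLevel h χ (s := s) (Or.inr hs1)
  by_cases hχ : χ = 1
  · subst hχ
    have h1 : DirichletCharacter.changeLevel h (1 : DirichletCharacter ℂ m) = 1 := map_one _
    rw [h1] at hL ⊢
    rw [entireL_one_apply hs1, entireL_one_apply hs1, hL]
    simp [hP]
  · rw [entireL_of_ne_one hχ, entireL_of_ne_one
      (fun h' => hχ ((DirichletCharacter.changeLevel_eq_one_iff h).mp h')), hL]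
    simp [hP]

theorem LSeries_charHom {q : ℕ} [NeZero q] {χ : DirichletCharacter ℂ q} (hχ : χ ≠ 1) {s : ℂ}
    (hs : 1 < s.re) : LSeries (fun n => charHom χ n) s = entireL χ s := by
  rw [entireL_of_ne_one hχ, χ.LFunction_eq_LSeries hs]
  rfl

theorem mul_LSeries_one {s : ℂ} (hs : 1 < s.re) :
    (s - 1) * LSeries (fun n => (1 : ℕ →* ℂ) n) s = entireL (1 : DirichletCharacter ℂ 1) s := by
  rw [entireL_one_apply (ne_one_of_one_lt_re hs), DirichletCharacter.LFunction_eq_LSeries _ hs,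
    LSeries_one_char]
  rfl

open scoped ComplexOrder in
/-- Estermann's lower bound for a product of values at `1`. -/
theorem le_norm_prod_entireL {d : ℝ} (hd : 0 < d) (hd1 : d ≤ 1 / 8) : ∃ c : ℝ, 0 < c ∧
    ∀ (q : ℕ) [NeZero q] (l : List (DirichletCharacter ℂ q)), l.length ≤ 3 → (∀ χ ∈ l, χ ≠ 1) →
    (∀ n : ℕ, 0 ≤ 1 + (l.map fun χ => χ n).sum) →
    ((∃ χ ∈ l, entireL χ (1 - d) = 0) ∨ (∀ x : ℝ, 1 - d ≤ x →
      entireL (1 : DirichletCharacter ℂ 1) x ≠ 0 ∧ ∀ χ ∈ l, entireL χ x ≠ 0)) →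
    c * (q : ℝ) ^ (-(12 * d)) ≤ (l.map fun χ => ‖entireL χ 1‖).prod := by
  set Z := entireL (1 : DirichletCharacter ℂ 1) with hZ
  have hZ1 : 0 < ‖Z 1‖ := norm_pos_iff.mpr (entireL_ne_zero_of_one_le_re _ (by simp))
  set K : ℝ := 20 * (729 * 729 ^ 3) / d with hK
  have hK0 : 0 < K := by positivity
  refine ⟨d / 2 / ‖Z 1‖ * Real.exp (-(d * (4 * Real.log K + 2))), by positivity, ?_⟩
  intro q _ l hlen hne hnn hor
  have hq : (1 : ℝ) ≤ q := by exact_mod_cast NeZero.one_le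
  set H : ℂ → ℂ := fun s => Z s * (l.map fun χ => entireL χ s).prod with hH
  have hprod : ∀ l : List (DirichletCharacter ℂ q),
      Differentiable ℂ fun s => (l.map fun χ => entireL χ s).prod := by
    intro l
    induction l with
    | nil => simp
    | cons χ l ih =>
      simp only [List.map_cons, List.prod_cons]
      exact (differentiable_entireL χ).mul ih
  have hprodle : ∀ (z : ℂ), ‖z - 2‖ ≤ 3 / 2 → ∀ l : List (DirichletCharacter ℂ q),
      ‖(l.map fun χ => entireL χ z).prod‖ ≤ (729 * (q : ℝ)) ^ l.length := by
    intro z hz l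
    have hre : 1 / 4 ≤ z.re := by
      have := (abs_le.mp ((abs_re_le_norm (z - 2)).trans hz)).1
      simp at this; linarith
    have hz2 : ‖z‖ ≤ 7 / 2 := by
      have := norm_sub_norm_le z 2
      simp at this; linarith
    induction l with
    | nil => simp
    | cons χ l ih =>
      simp only [List.map_cons, List.prod_cons, norm_mul, List.length_cons, pow_succ']
      refine mul_le_mul ((norm_entireL_le χ hre).trans ?_) ih (norm_nonneg _) (by positivity)
      have h9 : (‖z‖ + 1) ^ 2 ≤ (9 / 2) ^ 2 := by
        gcongr
        linarith
      nlinarith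
  have hZle : ∀ (z : ℂ), ‖z - 2‖ ≤ 3 / 2 → ‖Z z‖ ≤ 729 := by
    intro z hz
    have hre : 1 / 4 ≤ z.re := by
      have := (abs_le.mp ((abs_re_le_norm (z - 2)).trans hz)).1
      simp at this; linarith
    have hz2 : ‖z‖ ≤ 7 / 2 := by
      have := norm_sub_norm_le z 2
      simp at this; linarith
    refine (norm_entireL_le _ hre).trans ?_
    have h9 : (‖z‖ + 1) ^ 2 ≤ (9 / 2) ^ 2 := by
      gcongr
      linarith
    push_cast
    linarith
  have hbd : ∀ c ∈ (1 : ℕ →* ℂ) :: l.map charHom, ∀ n, ‖c n‖ ≤ 1 := by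
    intro c hc n
    simp only [List.mem_cons, List.mem_map] at hc
    rcases hc with rfl | ⟨χ, -, rfl⟩
    · simp
    · rw [charHom_apply]; exact χ.norm_le_one _
  have key := half_le_re_mul_exp (b := cmulProd (1 :: l.map charHom)) (H := H)
    (B := 729 * (729 * q) ^ 3) (d := d)
    (fun n => cmulProd_nonneg (fun n => by
      have := hnn n
      simpa [List.map_map, Function.comp_def, charHom_apply] using this) n)
    (cmulProd_one _) (fun s hs => (LSeries_cmulProd hbd hs).1)
    ((differentiable_entireL _).mul (hprod l))
    (fun s hs => by
      rw [(LSeries_cmulProd hbd hs).2, List.map_cons, List.prod_cons, ← mul_assoc,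
        mul_LSeries_one hs, List.map_map]
      change Z s * (l.map fun χ => entireL χ s).prod = Z s * _
      congr 2
      refine List.map_congr_left fun χ hχ => ?_
      exact (LSeries_charHom (hne χ hχ) hs).symm)
    (by
      have : (1 : ℝ) ≤ (729 * q) ^ 3 := one_le_pow₀ (by linarith)
      linarith)
    (fun z hz => by
      rw [hH, norm_mul]
      refine mul_le_mul (hZle z hz) ((hprodle z hz l).trans ?_) (norm_nonneg _) (by norm_num)
      exact pow_le_pow_right₀ (by linarith) hlen)
    hd hd1
    (by
      rcases hor with ⟨χ, hχ, h0⟩ | h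
      · left
        simp only [hH, mul_eq_zero, List.prod_eq_zero_iff, List.mem_map]
        right
        exact ⟨χ, hχ, h0⟩
      · right
        intro x hx
        obtain ⟨h1, h2⟩ := h x hx
        simp only [hH, ne_eq, mul_eq_zero, List.prod_eq_zero_iff, List.mem_map, not_or, not_exists,
          not_and]
        exact ⟨h1, fun χ hχ => h2 χ hχ⟩)
  have hlog : Real.log (20 * (729 * (729 * q) ^ 3) / d) = Real.log K + 3 * Real.log q := by
    rw [show 20 * (729 * (729 * (q : ℝ)) ^ 3) / d = K * (q : ℝ) ^ 3 by rw [hK]; ring,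
      Real.log_mul hK0.ne' (by positivity), Real.log_pow]
    norm_num
  rw [hlog] at key
  have hH1 : (H 1).re ≤ ‖Z 1‖ * (l.map fun χ => ‖entireL χ 1‖).prod := by
    refine (re_le_norm _).trans (le_of_eq ?_)
    rw [hH, norm_mul]
    congr 1
    generalize l = l'
    induction l' with
    | nil => simp
    | cons χ l ih => simp [ih]
  have hexp : Real.exp (d * (4 * (Real.log K + 3 * Real.log q) + 2)) =
      Real.exp (d * (4 * Real.log K + 2)) * (q : ℝ) ^ (12 * d) := by
    rw [Real.rpow_def_of_pos (by linarith), ← Real.exp_add]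
    ring_nf
  rw [hexp] at key
  set P := (l.map fun χ => ‖entireL χ 1‖).prod
  have hE := Real.exp_pos (d * (4 * Real.log K + 2))
  have hQ : 0 < (q : ℝ) ^ (12 * d) := by positivity
  rw [Real.exp_neg, Real.rpow_neg (by linarith), ← div_eq_mul_inv, ← div_eq_mul_inv,
    div_le_iff₀ hQ, div_le_iff₀ hE, div_le_iff₀ hZ1]
  refine key.trans ?_
  calc _ ≤ ‖Z 1‖ * P * (Real.exp (d * (4 * Real.log K + 2)) * (q : ℝ) ^ (12 * d)) := by gcongr
    _ = _ := by ring

theorem norm_entireL_one_le {q : ℕ} [NeZero q] {χ : DirichletCharacter ℂ q} (hχ : χ ≠ 1) {θ : ℝ}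
    (h0 : 0 < θ) (h1 : θ ≤ 1) : ‖entireL χ 1‖ ≤ 3 * (q : ℝ) ^ θ / θ := by
  rw [entireL_of_ne_one hχ]
  have := norm_LFunction_le hχ h0.le h1 (s := 1) (by simp) (by simpa using h0)
  simpa using this

theorem entireL_ne_zero_of_near_one {q : ℕ} [NeZero q] {χ : DirichletCharacter ℂ q} (hχ : χ ≠ 1)
    {θ : ℝ} (h0 : 0 < θ) (h1 : θ ≤ 1) {s : ℂ}
    (hs : ‖s - 1‖ < θ ^ 2 / 48 * (q : ℝ) ^ (-θ) * ‖entireL χ 1‖) : entireL χ s ≠ 0 := by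
  have hq : (1 : ℝ) ≤ q := by exact_mod_cast NeZero.one_le
  have hQ : 0 < (q : ℝ) ^ θ := by positivity
  have hs4 : ‖s - 1‖ ≤ θ / 4 := by
    refine hs.le.trans ?_
    calc θ ^ 2 / 48 * (q : ℝ) ^ (-θ) * ‖entireL χ 1‖
        ≤ θ ^ 2 / 48 * (q : ℝ) ^ (-θ) * (3 * (q : ℝ) ^ θ / θ) := by
          gcongr; exact norm_entireL_one_le hχ h0 h1
      _ = θ / 16 := by rw [Real.rpow_neg (by linarith)]; field_simp; norm_num
      _ ≤ θ / 4 := by linarith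
  have hbd : ∀ z : ℂ, ‖z - 1‖ ≤ θ / 2 → ‖entireL χ z‖ ≤ 12 * (q : ℝ) ^ θ / θ := by
    intro z hz
    have h2 := (abs_le.mp ((abs_re_le_norm (z - 1)).trans hz)).1
    simp only [sub_re, one_re] at h2
    have h3 : ‖z‖ ≤ 2 := by
      have := norm_sub_norm_le z 1
      simp at this; linarith
    rw [entireL_of_ne_one hχ]
    refine (norm_LFunction_le hχ h0.le h1 (by linarith) (by linarith)).trans ?_
    calc ‖z‖ * (3 * (q : ℝ) ^ θ / (z.re - 1 + θ)) ≤ 2 * (3 * (q : ℝ) ^ θ / (θ / 2)) := by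
          have h4 : 0 < z.re - 1 + θ := by linarith
          gcongr
          linarith
      _ = _ := by field_simp; norm_num
  have hder : ∀ z ∈ closedBall (1 : ℂ) (θ / 4), ‖deriv (entireL χ) z‖ ≤ 48 * (q : ℝ) ^ θ / θ ^ 2 := by
    intro z hz
    rw [mem_closedBall, dist_eq_norm] at hz
    have := norm_deriv_le_of_forall_mem_sphere_norm_le (c := z) (R := θ / 4) (by positivity)
      (differentiable_entireL χ).diffContOnCl (fun w hw => hbd w (by
        rw [mem_sphere, dist_eq_norm] at hw
        calc ‖w - 1‖ = ‖(w - z) + (z - 1)‖ := by ring_nf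
          _ ≤ θ / 4 + θ / 4 := (norm_add_le _ _).trans (by linarith)
          _ = θ / 2 := by ring))
    refine this.trans (le_of_eq ?_)
    field_simp
    norm_num
  have hmv := (convex_closedBall (1 : ℂ) (θ / 4)).norm_image_sub_le_of_norm_deriv_le
    (fun z _ => (differentiable_entireL χ).differentiableAt) hder
    (mem_closedBall_self (by positivity)) (y := s) (by rwa [mem_closedBall, dist_eq_norm])
  intro hzero
  rw [hzero, zero_sub, norm_neg] at hmv
  rw [Real.rpow_neg (by linarith)] at hs
  have h5 : 48 * (q : ℝ) ^ θ / θ ^ 2 * ‖s - 1‖ < ‖entireL χ 1‖ := by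
    calc 48 * (q : ℝ) ^ θ / θ ^ 2 * ‖s - 1‖ < 48 * (q : ℝ) ^ θ / θ ^ 2 *
          (θ ^ 2 / 48 * ((q : ℝ) ^ θ)⁻¹ * ‖entireL χ 1‖) := by gcongr
      _ = _ := by field_simp
  linarith

open scoped ComplexOrder in
theorem one_add_nonneg_of_sq_eq_one {q : ℕ} {χ : DirichletCharacter ℂ q} (h : χ ^ 2 = 1)
    (a : ZMod q) : 0 ≤ 1 + χ a := by
  rcases MulChar.isQuadratic_iff_sq_eq_one.mpr h a with h | h | h <;> rw [h]
  · simp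
  · norm_num
  · simp

open scoped ComplexOrder in
theorem le_norm_entireL_one_of_no_zeros {d : ℝ} (hd : 0 < d) (hd1 : d ≤ 1 / 8)
    (hZ : ∀ x : ℝ, 1 - d ≤ x → entireL (1 : DirichletCharacter ℂ 1) x ≠ 0) :
    ∃ c : ℝ, 0 < c ∧ ∀ (q : ℕ) [NeZero q] (χ : DirichletCharacter ℂ q), χ ≠ 1 → χ ^ 2 = 1 →
    (∀ x : ℝ, 1 - d ≤ x → x < 1 → entireL χ x ≠ 0) → c * (q : ℝ) ^ (-(12 * d)) ≤ ‖entireL χ 1‖ := by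
  obtain ⟨c, hc, h⟩ := le_norm_prod_entireL hd hd1
  refine ⟨c, hc, fun q _ χ h1 h2 h3 => ?_⟩
  have := h q [χ] (by simp) (by simpa using h1)
    (fun n => by simpa using one_add_nonneg_of_sq_eq_one h2 _)
    (Or.inr fun x hx => ⟨hZ x hx, fun χ' hχ' => by
      rw [List.mem_singleton] at hχ'
      subst hχ'
      rcases lt_or_ge x 1 with hx1 | hx1
      · exact h3 x hx hx1
      · exact entireL_ne_zero_of_one_le_re _ (by simpa using hx1)⟩)
  simpa using this

open scoped ComplexOrder in
theorem le_norm_entireL_one_of_zero {d θ : ℝ} (hd : 0 < d) (hd1 : d ≤ 1 / 8) (hθ : 0 < θ)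
    (hθ1 : θ ≤ 1) :
    ∃ c : ℝ, 0 < c ∧ ∀ (q : ℕ) [NeZero q] (χ₁ χ₂ : DirichletCharacter ℂ q), χ₁ ≠ 1 → χ₁ ^ 2 = 1 →
    χ₂ ≠ 1 → χ₂ ^ 2 = 1 → χ₁ ≠ χ₂ → entireL χ₁ (1 - d) = 0 →
    c * (q : ℝ) ^ (-(12 * d + 2 * θ)) ≤ ‖entireL χ₂ 1‖ := by
  obtain ⟨c, hc, h⟩ := le_norm_prod_entireL hd hd1
  refine ⟨c * (θ / 3) ^ 2, by positivity, fun q _ χ₁ χ₂ h1 h1' h2 h2' h12 h0 => ?_⟩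
  have hψ : χ₁ * χ₂ ≠ 1 := by
    intro h3
    apply h12
    have : χ₁ * χ₂ = χ₁ * χ₁ := by rw [h3, ← pow_two, h1']
    exact (mul_left_cancel this).symm
  have key := h q [χ₁, χ₂, χ₁ * χ₂] (by simp) (by
      simp only [List.mem_cons, List.not_mem_nil, or_false]
      rintro χ (rfl | rfl | rfl) <;> assumption)
    (fun n => by
      have := mul_nonneg (one_add_nonneg_of_sq_eq_one h1' (n : ZMod q))
        (one_add_nonneg_of_sq_eq_one h2' (n : ZMod q))
      refine this.trans_eq ?_
      simp
      ring)
    (Or.inl ⟨χ₁, by simp, h0⟩)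
  simp only [List.map_cons, List.map_nil, List.prod_cons, List.prod_nil, mul_one] at key
  have hq : (1 : ℝ) ≤ q := by exact_mod_cast NeZero.one_le
  have hQ : 0 < (q : ℝ) ^ θ := by positivity
  have key2 : c * (q : ℝ) ^ (-(12 * d)) ≤
      (3 * (q : ℝ) ^ θ / θ) * (‖entireL χ₂ 1‖ * (3 * (q : ℝ) ^ θ / θ)) := by
    refine key.trans ?_
    gcongr
    · exact norm_entireL_one_le h1 hθ hθ1
    · exact norm_entireL_one_le hψ hθ hθ1
  have e : (q : ℝ) ^ (-(12 * d + 2 * θ)) = (q : ℝ) ^ (-(12 * d)) / ((q : ℝ) ^ θ * (q : ℝ) ^ θ) := by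
    rw [← Real.rpow_add (by linarith), ← Real.rpow_sub (by linarith)]
    ring_nf
  rw [e]
  calc c * (θ / 3) ^ 2 * ((q : ℝ) ^ (-(12 * d)) / ((q : ℝ) ^ θ * (q : ℝ) ^ θ))
      = (c * (q : ℝ) ^ (-(12 * d))) * ((θ / 3) ^ 2 / ((q : ℝ) ^ θ * (q : ℝ) ^ θ)) := by ring
    _ ≤ ((3 * (q : ℝ) ^ θ / θ) * (‖entireL χ₂ 1‖ * (3 * (q : ℝ) ^ θ / θ))) *
        ((θ / 3) ^ 2 / ((q : ℝ) ^ θ * (q : ℝ) ^ θ)) := by gcongr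
    _ = ‖entireL χ₂ 1‖ := by field_simp

theorem exists_ball_ne_zero {q : ℕ} [NeZero q] (χ : DirichletCharacter ℂ q) : ∃ η : ℝ, 0 < η ∧
    η ≤ 1 / 2 ∧ ∀ s : ℂ, ‖s - 1‖ < η → entireL χ s ≠ 0 := by
  have h1 : entireL χ 1 ≠ 0 := entireL_ne_zero_of_one_le_re _ (by simp)
  have h2 := (differentiable_entireL χ).continuous.continuousAt.eventually_ne h1
  obtain ⟨η, h0, h⟩ := Metric.eventually_nhds_iff.mp h2
  refine ⟨min η (1 / 2), by positivity, min_le_right _ _, fun s hs => h ?_⟩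
  rw [dist_eq_norm]
  exact hs.trans_le (min_le_left _ _)

theorem re_pos_of_norm_sub_one_lt {s : ℂ} (h : ‖s - 1‖ < 1) : 0 < s.re := by
  have := (abs_lt.mp ((abs_re_le_norm (s - 1)).trans_lt h)).1
  simp at this
  exact this

/-- Siegel's theorem. -/
theorem exists_siegel {ε : ℝ} (hε : 0 < ε) : ∃ c : ℝ, 0 < c ∧ ∀ (q : ℕ) [NeZero q]
    (χ : DirichletCharacter ℂ q), χ ^ 2 = 1 → ∀ s : ℂ, ‖s - 1‖ < c * (q : ℝ) ^ (-ε) →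
    entireL χ s ≠ 0 := by
  obtain ⟨η, hη, hη2, hZ⟩ := exists_ball_ne_zero (1 : DirichletCharacter ℂ 1)
  have hpow : ∀ (q : ℕ) [NeZero q] (x : ℝ), x ≤ 0 → (q : ℝ) ^ x ≤ 1 := fun q _ x hx =>
    Real.rpow_le_one_of_one_le_of_nonpos (by exact_mod_cast NeZero.one_le) hx
  have htriv : ∀ (q : ℕ) [NeZero q] (s : ℂ), ‖s - 1‖ < η →
      entireL (1 : DirichletCharacter ℂ q) s ≠ 0 := by
    intro q _ s hs h
    rw [← map_one (DirichletCharacter.changeLevel (one_dvd q)),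
      entireL_changeLevel_eq_zero_iff _ _ (re_pos_of_norm_sub_one_lt (by linarith))] at h
    exact hZ s hs h
  set θ : ℝ := min (ε / 6) 1 with hθ
  have hθ0 : 0 < θ := by positivity
  have hθ1 : θ ≤ 1 := min_le_right _ _
  have hθε : θ ≤ ε / 6 := min_le_left _ _
  set D : ℝ := min (min (1 / 8) (ε / 24)) (η / 2) with hD
  have hD0 : 0 < D := by positivity
  have hD8 : D ≤ 1 / 8 := (min_le_left _ _).trans (min_le_left _ _)
  have hDε : D ≤ ε / 24 := (min_le_left _ _).trans (min_le_right _ _)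
  have hDη : D ≤ η / 2 := min_le_right _ _
  by_cases hcase : ∃ (q : ℕ) (_ : NeZero q) (χ : DirichletCharacter ℂ q) (x : ℝ), χ ≠ 1 ∧
      χ ^ 2 = 1 ∧ 1 - D ≤ x ∧ x < 1 ∧ entireL χ x = 0
  · obtain ⟨q₁, _, χ₁, x, h1, h1', hx1, hx2, hx0⟩ := hcase
    obtain ⟨c, hc, hlow⟩ := le_norm_entireL_one_of_zero (d := 1 - x) (by linarith) (by linarith)
      hθ0 hθ1
    obtain ⟨η₁, hη₁, hη₁2, hZ₁⟩ := exists_ball_ne_zero χ₁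
    have hq₁ : (1 : ℝ) ≤ q₁ := by exact_mod_cast NeZero.one_le
    refine ⟨min (min η η₁) (θ ^ 2 / 48 * c * (q₁ : ℝ) ^ (-ε)), by positivity, ?_⟩
    intro q _ χ hχ2 s hs
    have hsη : ‖s - 1‖ < min η η₁ := hs.trans_le
      ((mul_le_of_le_one_right (by positivity) (hpow q _ (by linarith))).trans (min_le_left _ _))
    by_cases hχ : χ = 1
    · subst hχ
      exact htriv q s (hsη.trans_le (min_le_left _ _))
    have hre : 0 < s.re := re_pos_of_norm_sub_one_lt
      ((hsη.trans_le (min_le_left _ _)).trans (by linarith))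
    have hq : (1 : ℝ) ≤ q := by exact_mod_cast NeZero.one_le
    have : NeZero (q₁ * q) := ⟨mul_ne_zero (NeZero.ne _) (NeZero.ne _)⟩
    set ψ₁ := DirichletCharacter.changeLevel (dvd_mul_right q₁ q) χ₁ with hψ₁
    set ψ := DirichletCharacter.changeLevel (dvd_mul_left q q₁) χ with hψ
    rw [ne_eq, ← entireL_changeLevel_eq_zero_iff (dvd_mul_left q q₁) χ hre]
    by_cases hψψ : ψ₁ = ψ
    · rw [← hψ, ← hψψ, hψ₁, entireL_changeLevel_eq_zero_iff _ _ hre]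
      exact hZ₁ s (hsη.trans_le (min_le_right _ _))
    have hψne : ψ ≠ 1 := fun h => hχ ((DirichletCharacter.changeLevel_eq_one_iff _).mp h)
    have hl := hlow (q₁ * q) ψ₁ ψ
      (fun h => h1 ((DirichletCharacter.changeLevel_eq_one_iff _).mp h))
      (by rw [hψ₁, ← map_pow, h1', map_one]) hψne (by rw [hψ, ← map_pow, hχ2, map_one]) hψψ
      (by
        rw [hψ₁]
        have hx : (1 : ℂ) - ((1 - x : ℝ) : ℂ) = x := by push_cast; ring
        rw [hx, entireL_changeLevel_eq_zero_iff _ _ (by simp; linarith)]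
        exact hx0)
    refine entireL_ne_zero_of_near_one hψne hθ0 hθ1 ?_
    have hqq : (1 : ℝ) ≤ (q₁ * q : ℕ) := by exact_mod_cast NeZero.one_le
    calc ‖s - 1‖ < _ := hs
      _ ≤ (θ ^ 2 / 48 * c * (q₁ : ℝ) ^ (-ε)) * (q : ℝ) ^ (-ε) := by
          gcongr; exact min_le_right _ _
      _ = θ ^ 2 / 48 * c * ((q₁ * q : ℕ) : ℝ) ^ (-ε) := by
          push_cast
          rw [Real.mul_rpow (by linarith) (by linarith)]
          ring
      _ ≤ θ ^ 2 / 48 * c * ((q₁ * q : ℕ) : ℝ) ^ (-θ + -(12 * (1 - x) + 2 * θ)) := by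
          gcongr
          · linarith
      _ = θ ^ 2 / 48 * ((q₁ * q : ℕ) : ℝ) ^ (-θ) *
          (c * ((q₁ * q : ℕ) : ℝ) ^ (-(12 * (1 - x) + 2 * θ))) := by
          rw [Real.rpow_add (by linarith)]
          ring
      _ ≤ _ := by gcongr
  · push Not at hcase
    obtain ⟨c, hc, hlow⟩ := le_norm_entireL_one_of_no_zeros hD0 hD8 (fun x hx => by
      rcases lt_or_ge x 1 with hx1 | hx1
      · apply hZ
        rw [← ofReal_one, ← ofReal_sub, norm_real, Real.norm_eq_abs, abs_lt]
        constructor <;> linarith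
      · exact entireL_ne_zero_of_one_le_re _ (by simpa using hx1))
    refine ⟨min η (θ ^ 2 / 48 * c), by positivity, ?_⟩
    intro q _ χ hχ2 s hs
    by_cases hχ : χ = 1
    · subst hχ
      exact htriv q s (hs.trans_le
        ((mul_le_of_le_one_right (by positivity) (hpow q _ (by linarith))).trans (min_le_left _ _)))
    have hq : (1 : ℝ) ≤ q := by exact_mod_cast NeZero.one_le
    have hl := hlow q χ hχ hχ2 fun x hx1 hx2 => hcase q inferInstance χ x hχ hχ2 hx1 hx2
    refine entireL_ne_zero_of_near_one hχ hθ0 hθ1 ?_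
    calc ‖s - 1‖ < _ := hs
      _ ≤ (θ ^ 2 / 48 * c) * (q : ℝ) ^ (-θ + -(12 * D)) := by
          gcongr
          · exact min_le_right _ _
          · linarith
      _ = θ ^ 2 / 48 * (q : ℝ) ^ (-θ) * (c * (q : ℝ) ^ (-(12 * D))) := by
          rw [Real.rpow_add (by linarith)]
          ring
      _ ≤ _ := by gcongr

theorem norm_logDeriv_entireL_le {q : ℕ} [NeZero q] (χ : DirichletCharacter ℂ q) {δ T : ℝ}
    (hδ : 0 < δ) (hδ1 : δ ≤ 1 / 8)
    (hz : ∀ ρ, entireL χ ρ = 0 → |ρ.im| ≤ T + 1 → ρ.re ≤ 1 - 3 * δ) {s : ℂ}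
    (h1 : 1 - 2 * δ ≤ s.re) (h2 : s.re ≤ 1 + 4 * δ) (hT : |s.im| ≤ T) :
    ‖deriv (entireL χ) s / entireL χ s‖ ≤
      28 * Real.log (180 * q * (T + 3) ^ 2 / δ ^ 2) / δ := by
  have hq : (1 : ℝ) ≤ q := by exact_mod_cast NeZero.one_le
  have hT0 : 0 ≤ T := (abs_nonneg _).trans hT
  set M := Real.log (180 * q * (T + 3) ^ 2 / δ ^ 2) with hM
  have hMpos : 0 < M := by
    refine Real.log_pos ?_
    rw [lt_div_iff₀ (by positivity)]
    nlinarith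
  set c : ℂ := ⟨1 + δ, s.im⟩ with hc
  have hlog : Real.log (180 * q * (|c.im| + 3) ^ 2 / δ ^ 2) ≤ M := by
    refine Real.log_le_log (by positivity) ?_
    gcongr
  have hgrow := norm_entireL_le_exp_mul χ hδ hδ1 (s := c) rfl hlog
  have hsub : ball c (4 * δ) ⊆ closedBall c (1 / 2) :=
    ball_subset_closedBall.trans (closedBall_subset_closedBall (by linarith))
  have hdist : ‖s - c‖ ≤ 3 * (4 * δ) / 4 := by
    have : s - c = ((s.re - (1 + δ) : ℝ) : ℂ) := by apply Complex.ext <;> simp [hc]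
    rw [this, norm_real, Real.norm_eq_abs, abs_le]
    constructor <;> linarith
  have h0 : ∀ z ∈ ball c (4 * δ), entireL χ z ≠ 0 := by
    intro z hzb h
    rw [mem_ball, dist_eq_norm] at hzb
    have hre := (abs_re_le_norm _).trans_lt hzb
    have him := (abs_im_le_norm _).trans_lt hzb
    rw [sub_re, abs_lt] at hre
    rw [sub_im] at him
    have := hz z h (by
      calc |z.im| = |(z.im - c.im) + c.im| := by ring_nf
        _ ≤ |z.im - c.im| + |c.im| := abs_add_le _ _
        _ ≤ 1 + T := by gcongr; linarith
        _ = T + 1 := by ring)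
    have hcre : c.re = 1 + δ := rfl
    linarith [hre.1]
  refine (norm_logDeriv_le_of_ne_zero (by positivity) hMpos
    (differentiable_entireL χ).differentiableOn h0 (fun z hzb => hgrow z (hsub hzb)) hdist).trans
    (le_of_eq ?_)
  field_simp
  ring

/-- The function `ζ(s) - 1 / (s - 1)`, for `Re s > 0`. -/
noncomputable def zetaRegular (s : ℂ) : ℂ :=
  1 + s * ∫ t in Set.Ioi (1 : ℝ), charErr (1 : DirichletCharacter ℂ 1) t * (t : ℂ) ^ (-(s + 1))

theorem norm_charErr_one_le (t : ℝ) (ht : 1 ≤ t) :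
    ‖charErr (1 : DirichletCharacter ℂ 1) t‖ ≤ 3 * t ^ (1 - (1 : ℝ)) := by
  simpa using norm_charErr_le (1 : DirichletCharacter ℂ 1) zero_le_one le_rfl ht

theorem differentiableAt_zetaRegular {s : ℂ} (hs : 0 < s.re) :
    DifferentiableAt ℂ zetaRegular s := by
  refine (differentiableAt_const _).add (differentiableAt_id.mul ?_)
  exact differentiableAt_integral_Ioi (measurable_charErr _) (B := 3) (θ := 1)
    norm_charErr_one_le (by simpa using hs)

theorem norm_zetaRegular_le {s : ℂ} (hs : 0 < s.re) : ‖zetaRegular s‖ ≤ 1 + ‖s‖ * (3 / s.re) := by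
  rw [zetaRegular]
  refine (norm_add_le _ _).trans ?_
  rw [norm_one, norm_mul]
  have := norm_integral_Ioi_le (B := 3) (θ := 1) norm_charErr_one_le (s := s) (by simpa using hs)
  simp only [sub_add_cancel] at this
  gcongr

theorem LSeries_one_eq_zetaRegular {s : ℂ} (hs : 1 < s.re) :
    LSeries 1 s = 1 / (s - 1) + zetaRegular s := by
  have hs1 := sub_ne_zero.mpr (ne_one_of_one_lt_re hs)
  have h := eq_integral_of_eqOn (1 : DirichletCharacter ℂ 1) (differentiable_entireL _)
    (fun s hs => entireL_one_apply (ne_one_of_one_lt_re hs)) (s := s) (by linarith)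
  have hm : charMean (1 : DirichletCharacter ℂ 1) = 1 := by
    simp only [charMean, univ_unique, sum_singleton, Nat.cast_one, div_one]
    exact map_one (1 : DirichletCharacter ℂ 1)
  rw [entireL_one_apply (ne_one_of_one_lt_re hs),
    DirichletCharacter.LFunction_eq_LSeries _ hs, LSeries_one_char, hm] at h
  apply mul_left_cancel₀ hs1
  rw [h, zetaRegular]
  field_simp
  ring

open Classical in
/-- The coefficients `χ(n) Λ(n)`, with the mean value `1` removed if `χ` is trivial. -/
noncomputable def centeredTwist {q : ℕ} (χ : DirichletCharacter ℂ q) (n : ℕ) : ℂ :=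
  χ n * (ArithmeticFunction.vonMangoldt n : ℂ) - if χ = 1 then 1 else 0

open Classical in
/-- The continuation of the Dirichlet series of `centeredTwist χ`. -/
noncomputable def centeredTwistL {q : ℕ} [NeZero q] (χ : DirichletCharacter ℂ q) (s : ℂ) : ℂ :=
  -(deriv (entireL χ) s / entireL χ s) - if χ = 1 then zetaRegular s else 0

theorem norm_centeredTwist_le {q : ℕ} (χ : DirichletCharacter ℂ q) (n : ℕ) :
    ‖centeredTwist χ n‖ ≤ ArithmeticFunction.vonMangoldt n + 1 := by
  rw [centeredTwist]
  refine (norm_sub_le _ _).trans ?_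
  gcongr
  · rw [norm_mul, norm_real, Real.norm_of_nonneg ArithmeticFunction.vonMangoldt_nonneg]
    exact mul_le_of_le_one_left ArithmeticFunction.vonMangoldt_nonneg (χ.norm_le_one _)
  · split_ifs <;> simp

theorem LSeries_centeredTwist {q : ℕ} [NeZero q] (χ : DirichletCharacter ℂ q) {s : ℂ}
    (hs : 1 < s.re) : LSeries (centeredTwist χ) s = centeredTwistL χ s := by
  have h1 := LSeries_twist_eq_entireL χ hs
  have h2 := LSeriesSummable_twist q χ hs
  rw [centeredTwistL]
  by_cases hχ : χ = 1
  · have h3 : centeredTwist χ = (fun n : ℕ => χ n * (ArithmeticFunction.vonMangoldt n : ℂ)) - 1 := by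
      ext n; simp [centeredTwist, hχ]
    rw [h3, LSeries_sub h2 (LSeriesSummable_one_iff.mpr hs), h1, if_pos hχ, if_pos hχ,
      LSeries_one_eq_zetaRegular hs]
    ring
  · have h3 : centeredTwist χ = (fun n : ℕ => χ n * (ArithmeticFunction.vonMangoldt n : ℂ)) := by
      ext n; simp [centeredTwist, hχ]
    rw [h3, h1, if_neg hχ, if_neg hχ]
    ring

theorem differentiableAt_centeredTwistL {q : ℕ} [NeZero q] {χ : DirichletCharacter ℂ q} {s : ℂ}
    (hs : 0 < s.re) (h0 : entireL χ s ≠ 0) : DifferentiableAt ℂ (centeredTwistL χ) s := by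
  have h1 : DifferentiableAt ℂ (fun s => -(deriv (entireL χ) s / entireL χ s)) s :=
    (((differentiable_entireL χ).deriv s).div (differentiable_entireL χ s) h0).neg
  unfold centeredTwistL
  refine h1.sub ?_
  split_ifs
  · exact differentiableAt_zetaRegular hs
  · exact differentiableAt_const _

theorem norm_centeredTwistL_le {q : ℕ} [NeZero q] {χ : DirichletCharacter ℂ q} {δ T : ℝ}
    (hδ : 0 < δ) (hδ1 : δ ≤ 1 / 8)
    (hz : ∀ ρ, entireL χ ρ = 0 → |ρ.im| ≤ T + 1 → ρ.re ≤ 1 - 3 * δ) {s : ℂ}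
    (h1 : 1 - 2 * δ ≤ s.re) (h2 : s.re ≤ 1 + 4 * δ) (hT : |s.im| ≤ T) :
    ‖centeredTwistL χ s‖ ≤
      28 * Real.log (180 * q * (T + 3) ^ 2 / δ ^ 2) / δ + (13 + 6 * T) := by
  have hT0 : 0 ≤ T := (abs_nonneg _).trans hT
  rw [centeredTwistL]
  refine (norm_sub_le _ _).trans ?_
  rw [norm_neg]
  gcongr
  · exact norm_logDeriv_entireL_le χ hδ hδ1 hz h1 h2 hT
  · split_ifs
    · refine (norm_zetaRegular_le (by linarith)).trans ?_
      have h3 : 3 / s.re ≤ 6 := by rw [div_le_iff₀ (by linarith)]; linarith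
      have h4 : ‖s‖ ≤ 2 + T := by
        refine (norm_le_abs_re_add_abs_im s).trans (add_le_add ?_ hT)
        rw [abs_le]; constructor <;> linarith
      have h5 : 0 ≤ 3 / s.re := div_nonneg (by norm_num) (by linarith)
      calc 1 + ‖s‖ * (3 / s.re) ≤ 1 + (2 + T) * 6 := by gcongr
        _ = 13 + 6 * T := by ring
    · simp; positivity

/-- The Mellin transform of `t ↦ max 0 (1 - t)`. -/
noncomputable def cesaroKernel (s : ℂ) : ℂ := 1 / s - 1 / (s + 1)

theorem cesaroKernel_eq {s : ℂ} (hs : 0 < s.re) : cesaroKernel s = 1 / (s * (s + 1)) := by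
  have h1 : s ≠ 0 := by rintro rfl; simp at hs
  have h2 : s + 1 ≠ 0 := by
    intro h
    have := congrArg re h
    simp at this
    linarith
  rw [cesaroKernel]
  field_simp
  ring

theorem norm_cesaroKernel_le {s : ℂ} (hs : 0 < s.re) :
    ‖cesaroKernel s‖ ≤ (s.re ^ 2 + s.im ^ 2)⁻¹ := by
  rw [cesaroKernel_eq hs, norm_div, norm_one, norm_mul, one_div]
  have hp : 0 < s.re ^ 2 + s.im ^ 2 := by positivity
  have h1 : ‖s‖ ^ 2 = s.re ^ 2 + s.im ^ 2 := by
    rw [Complex.sq_norm, normSq_apply]; ring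
  have h2 : ‖s‖ ≤ ‖s + 1‖ := by
    refine (sq_le_sq₀ (norm_nonneg _) (norm_nonneg _)).mp ?_
    rw [Complex.sq_norm, Complex.sq_norm, normSq_apply, normSq_apply]
    simp
    nlinarith
  gcongr
  rw [← h1, pow_two]
  gcongr

theorem norm_cesaroKernel_line_le {σ : ℝ} (hσ : 1 ≤ σ) (y : ℝ) :
    ‖cesaroKernel (σ + y * I)‖ ≤ (1 + y ^ 2)⁻¹ := by
  have hre : ((σ : ℂ) + y * I).re = σ := by simp
  have him : ((σ : ℂ) + y * I).im = y := by simp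
  refine (norm_cesaroKernel_le (by rw [hre]; linarith)).trans ?_
  rw [hre, him]
  gcongr
  nlinarith

theorem continuousAt_cesaroKernel {s : ℂ} (hs : 0 < s.re) : ContinuousAt cesaroKernel s := by
  have h1 : s ≠ 0 := by rintro rfl; simp at hs
  have h2 : s + 1 ≠ 0 := by
    intro h
    have := congrArg re h
    simp at this
    linarith
  unfold cesaroKernel
  exact (continuousAt_const.div continuousAt_id h1).sub
    (continuousAt_const.div (continuousAt_id.add continuousAt_const) h2)

theorem continuous_cesaroKernel_line {σ : ℝ} (hσ : 0 < σ) :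
    Continuous fun y : ℝ => cesaroKernel (σ + y * I) := by
  refine continuous_iff_continuousAt.mpr fun y => ?_
  exact ContinuousAt.comp (f := fun y : ℝ => (σ : ℂ) + y * I) (g := cesaroKernel)
    (continuousAt_cesaroKernel (by simpa using hσ)) (by fun_prop)

theorem integrable_cesaroKernel_line {σ : ℝ} (hσ : 1 ≤ σ) :
    MeasureTheory.Integrable fun y : ℝ => cesaroKernel (σ + y * I) :=
  integrable_inv_one_add_sq.mono' (continuous_cesaroKernel_line (by linarith)).aestronglyMeasurable
    (Filter.Eventually.of_forall fun y => norm_cesaroKernel_line_le hσ y)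

theorem integral_cpow_mul_cesaroKernel {σ u : ℝ} (hσ : 1 ≤ σ) (hu : 0 < u) :
    ∫ y : ℝ, (u : ℂ) ^ (-((σ : ℂ) + y * I)) * cesaroKernel (σ + y * I) =
      2 * Real.pi * (max 0 (1 - u) : ℝ) := by
  have hm : ∀ s : ℂ, 0 < s.re → HasMellin (fun t : ℝ => (Set.Ioc 0 1).indicator (fun _ => (1 : ℂ)) t -
      (Set.Ioc 0 1).indicator (fun t : ℝ => (t : ℂ) ^ (1 : ℂ)) t) s (cesaroKernel s) := by
    intro s hs
    have h1 := hasMellin_one_Ioc hs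
    have h2 := hasMellin_cpow_Ioc (1 : ℂ) (s := s) (by simp; linarith)
    have h3 := hasMellin_sub h1.1 h2.1
    rwa [h1.2, h2.2] at h3
  set f : ℝ → ℂ := fun t : ℝ => (Set.Ioc 0 1).indicator (fun _ => (1 : ℂ)) t -
      (Set.Ioc 0 1).indicator (fun t : ℝ => (t : ℂ) ^ (1 : ℂ)) t with hf
  have hfe : ∀ t : ℝ, 0 < t → f t = (max 0 (1 - t) : ℝ) := by
    intro t ht
    by_cases h : t ≤ 1
    · have hmem : t ∈ Set.Ioc (0 : ℝ) 1 := ⟨ht, h⟩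
      simp [hf, hmem, h]
    · have hmem : t ∉ Set.Ioc (0 : ℝ) 1 := fun hh => h hh.2
      have h' : 1 - t ≤ 0 := by linarith
      simp [hf, hmem, max_eq_left h']
  have hline : ∀ y : ℝ, mellin f (σ + y * I) = cesaroKernel (σ + y * I) := fun y =>
    (hm _ (by simp; linarith)).2
  have hcont : ContinuousAt f u := by
    have hc : ContinuousAt (fun t : ℝ => ((max 0 (1 - t) : ℝ) : ℂ)) u := by fun_prop
    refine hc.congr ?_
    filter_upwards [lt_mem_nhds hu] with t ht
    exact (hfe t ht).symm
  have hinv := mellinInv_mellin_eq σ f hu (hm σ (by simp; linarith)).1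
    (by
      unfold VerticalIntegrable
      simp_rw [hline]
      exact integrable_cesaroKernel_line hσ) hcont
  rw [hfe u hu, mellinInv] at hinv
  simp_rw [hline, smul_eq_mul] at hinv
  rw [← hinv, Complex.real_smul]
  push_cast
  have hpi : (Real.pi : ℂ) ≠ 0 := ofReal_ne_zero.mpr Real.pi_ne_zero
  rw [← mul_assoc, mul_one_div_cancel (mul_ne_zero two_ne_zero hpi), one_mul]

theorem norm_term_line (a : ℕ → ℂ) (σ y : ℝ) (n : ℕ) :
    ‖LSeries.term a (σ + y * I) n‖ = ‖LSeries.term a σ n‖ := by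
  rw [LSeries.norm_term_eq, LSeries.norm_term_eq]
  simp

open MeasureTheory in
/-- Smoothed Perron formula. -/
theorem two_pi_mul_sum_eq_integral {a : ℕ → ℂ} {σ : ℝ} (hσ : 1 ≤ σ) (ha : LSeriesSummable a σ)
    {N : ℕ} (hN : N ≠ 0) :
    2 * Real.pi * ∑ n ∈ Icc 1 N, a n * (1 - (n / N : ℝ)) =
      ∫ y : ℝ, LSeries a (σ + y * I) * ((N : ℂ) ^ ((σ : ℂ) + y * I) * cesaroKernel (σ + y * I)) := by
  have hN0 : (0 : ℝ) < N := by positivity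
  have hNc : (N : ℂ) ≠ 0 := by exact_mod_cast hN
  set g : ℝ → ℂ := fun y => (N : ℂ) ^ ((σ : ℂ) + y * I) * cesaroKernel (σ + y * I) with hg
  have hnormg : ∀ y, ‖g y‖ = (N : ℝ) ^ σ * ‖cesaroKernel (σ + y * I)‖ := by
    intro y
    rw [hg, norm_mul, norm_natCast_cpow_of_pos (by omega)]
    simp
  have hterm : ∀ n : ℕ, Continuous fun y : ℝ => LSeries.term a (σ + y * I) n := by
    intro n
    simp_rw [LSeries.term_def]
    split_ifs with h
    · exact continuous_const
    · have hn : (n : ℂ) ≠ 0 := by exact_mod_cast h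
      refine continuous_const.div ?_ fun y => ?_
      · exact Continuous.const_cpow (by fun_prop) (Or.inl hn)
      · rw [Ne, cpow_eq_zero_iff]; tauto
  have hgc : Continuous g :=
    (Continuous.const_cpow (by fun_prop) (Or.inl hNc)).mul
      (continuous_cesaroKernel_line (by linarith))
  have hnorm : ∀ (n : ℕ) (y : ℝ), ‖LSeries.term a (σ + y * I) n * g y‖ =
      ‖LSeries.term a σ n‖ * (N : ℝ) ^ σ * ‖cesaroKernel (σ + y * I)‖ := by
    intro n y
    rw [norm_mul, norm_term_line, hnormg, mul_assoc]
  have hInt : ∀ n, Integrable fun y : ℝ => LSeries.term a (σ + y * I) n * g y := by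
    intro n
    refine ((integrable_cesaroKernel_line hσ).norm.const_mul
      (‖LSeries.term a σ n‖ * (N : ℝ) ^ σ)).mono' ((hterm n).mul hgc).aestronglyMeasurable
      (Filter.Eventually.of_forall fun y => (hnorm n y).le)
  have hsum : Summable fun n => ∫ y : ℝ, ‖LSeries.term a (σ + y * I) n * g y‖ := by
    simp_rw [hnorm, integral_const_mul, mul_assoc]
    exact ha.norm.mul_right _
  have h := hasSum_integral_of_summable_integral_norm hInt hsum
  simp_rw [tsum_mul_right] at h
  have hval : ∀ n, n ≠ 0 → ∫ y : ℝ, LSeries.term a (σ + y * I) n * g y =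
      2 * Real.pi * (a n * (max 0 (1 - n / N) : ℝ)) := by
    intro n hn
    have hn0 : (0 : ℝ) < n := by positivity
    have hnc : (n : ℂ) ≠ 0 := by exact_mod_cast hn
    have := integral_cpow_mul_cesaroKernel (u := n / N) hσ (by positivity)
    calc ∫ y : ℝ, LSeries.term a (σ + y * I) n * g y = ∫ y : ℝ, a n *
          (((n / N : ℝ) : ℂ) ^ (-((σ : ℂ) + y * I)) * cesaroKernel (σ + y * I)) := by
          congr 1
          ext y
          rw [LSeries.term_of_ne_zero hn, hg]
          have hd : ((n / N : ℝ) : ℂ) ^ (-((σ : ℂ) + y * I)) =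
              (N : ℂ) ^ ((σ : ℂ) + y * I) / (n : ℂ) ^ ((σ : ℂ) + y * I) := by
            rw [cpow_neg, Complex.ofReal_div, div_cpow_ofReal_nonneg hn0.le hN0.le, inv_div]
            simp
          rw [hd]
          field_simp
      _ = _ := by
          rw [integral_const_mul, this]; ring
  have h0 : ∫ y : ℝ, LSeries.term a (σ + y * I) 0 * g y = 0 := by simp
  have h' := hasSum_sum_of_ne_finset_zero (f := fun n => ∫ y : ℝ, LSeries.term a (σ + y * I) n * g y)
    (s := Icc 1 N) (L := SummationFilter.unconditional ℕ) (by
      intro n hn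
      rcases Nat.eq_zero_or_pos n with rfl | hpos
      · exact h0
      · rw [hval n hpos.ne']
        have : N < n := by rw [mem_Icc] at hn; omega
        have : (1 : ℝ) - n / N ≤ 0 := by
          rw [sub_nonpos, le_div_iff₀ hN0, one_mul]; exact_mod_cast this.le
        rw [max_eq_left this]; simp)
  have heq := h'.unique h
  change _ = ∫ y : ℝ, (∑' n, LSeries.term a (σ + y * I) n) * g y
  rw [← heq, mul_sum]
  refine sum_congr rfl fun n hn => ?_
  rw [mem_Icc] at hn
  rw [hval n (by omega), max_eq_right]
  · push_cast; ring
  · rw [sub_nonneg, div_le_one hN0]; exact_mod_cast hn.2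

theorem arctan_neg_add_pi_div_two_le {T : ℝ} (hT : 0 < T) :
    Real.pi / 2 - Real.arctan T ≤ 1 / T := by
  rw [← Real.arctan_inv_of_pos hT, ← one_div]
  have h0 : 0 < Real.arctan (1 / T) := by
    rw [← Real.arctan_zero]; exact Real.arctan_strictMono (by positivity)
  have := Real.lt_tan h0 (Real.arctan_lt_pi_div_two _)
  rw [Real.tan_arctan] at this
  exact this.le

open MeasureTheory in
theorem norm_integral_le_add_of_norm_le {H : ℝ → ℂ} (hH : Integrable H) {C T : ℝ} (hC : 0 ≤ C)
    (hT : 0 < T)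
    (hb : ∀ y, ‖H y‖ ≤ C * (1 + y ^ 2)⁻¹) :
    ‖∫ y, H y‖ ≤ ‖∫ y in (-T)..T, H y‖ + 2 * C / T := by
  have h1 := intervalIntegral.integral_Iic_add_Ioi (b := T) hH.integrableOn hH.integrableOn
  have h2 := intervalIntegral.integral_Iic_sub_Iic (a := -T) (b := T) hH.integrableOn
    hH.integrableOn
  have hi : Integrable fun y : ℝ => C * (1 + y ^ 2)⁻¹ := integrable_inv_one_add_sq.const_mul C
  have h3 : ‖∫ y in Set.Iic (-T), H y‖ ≤ C / T := by
    refine (norm_integral_le_of_norm_le hi.integrableOn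
      (Filter.Eventually.of_forall hb)).trans ?_
    rw [integral_const_mul, integral_Iic_inv_one_add_sq, Real.arctan_neg, div_eq_mul_one_div C]
    refine mul_le_mul_of_nonneg_left ?_ hC
    linarith [arctan_neg_add_pi_div_two_le hT]
  have h4 : ‖∫ y in Set.Ioi T, H y‖ ≤ C / T := by
    refine (norm_integral_le_of_norm_le hi.integrableOn
      (Filter.Eventually.of_forall hb)).trans ?_
    rw [integral_const_mul, integral_Ioi_inv_one_add_sq, div_eq_mul_one_div C]
    refine mul_le_mul_of_nonneg_left ?_ hC
    exact arctan_neg_add_pi_div_two_le hT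
  have h5 : ∫ y, H y = (∫ y in (-T)..T, H y) + ((∫ y in Set.Iic (-T), H y) +
      ∫ y in Set.Ioi T, H y) := by
    rw [← h1, ← h2]; ring
  rw [h5]
  refine (norm_add_le _ _).trans ?_
  have h6 := norm_add_le (∫ y in Set.Iic (-T), H y) (∫ y in Set.Ioi T, H y)
  have h7 : 2 * C / T = C / T + C / T := by ring
  linarith

theorem norm_vertical_integral_le {G : ℂ → ℂ} {σ₀ σ₁ T V W : ℝ} (h01 : σ₀ ≤ σ₁) (hT : 0 < T)
    (hd : ∀ s : ℂ, σ₀ ≤ s.re → s.re ≤ σ₁ → |s.im| ≤ T → DifferentiableAt ℂ G s)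
    (hV : ∀ y : ℝ, |y| ≤ T → ‖G (σ₀ + y * I)‖ ≤ V)
    (hW : ∀ x y : ℝ, σ₀ ≤ x → x ≤ σ₁ → |y| = T → ‖G (x + y * I)‖ ≤ W) :
    ‖∫ y in (-T)..T, G (σ₁ + y * I)‖ ≤ V * (2 * T) + 2 * (W * (σ₁ - σ₀)) := by
  have h := Complex.integral_boundary_rect_eq_zero_of_differentiableOn G ⟨σ₀, -T⟩ ⟨σ₁, T⟩ (by
    intro s hs
    rw [mem_reProdIm, Set.uIcc_of_le h01, Set.uIcc_of_le (by linarith)] at hs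
    exact (hd s hs.1.1 hs.1.2 (abs_le.mpr hs.2)).differentiableWithinAt)
  simp only [smul_eq_mul] at h
  have h1 : ‖∫ y in (-T)..T, G (σ₀ + y * I)‖ ≤ V * (2 * T) := by
    refine (intervalIntegral.norm_integral_le_of_norm_le_const (C := V) fun y hy => ?_).trans
      (le_of_eq ?_)
    · rw [Set.uIoc_of_le (by linarith)] at hy
      exact hV y (abs_le.mpr ⟨hy.1.le, hy.2⟩)
    · rw [abs_of_nonneg (by linarith)]; ring
  have h2 : ∀ v : ℝ, |v| = T → ‖∫ x : ℝ in σ₀..σ₁, G (x + v * I)‖ ≤ W * (σ₁ - σ₀) := by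
    intro v hv
    refine (intervalIntegral.norm_integral_le_of_norm_le_const (C := W) fun x hx => ?_).trans
      (le_of_eq ?_)
    · rw [Set.uIoc_of_le h01] at hx
      exact hW x v hx.1.le hx.2 hv
    · rw [abs_of_nonneg (by linarith)]
  have h3 := h2 T (abs_of_pos hT)
  have h4 := h2 (-T) (by rw [abs_neg, abs_of_pos hT])
  have h5 : I * (∫ y in (-T)..T, G (σ₁ + y * I)) = I * (∫ y in (-T)..T, G (σ₀ + y * I)) +
      ((∫ x : ℝ in σ₀..σ₁, G (x + T * I)) - ∫ x : ℝ in σ₀..σ₁, G (x + (-T : ℝ) * I)) := by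
    linear_combination h
  have h6 := congrArg norm h5
  rw [norm_mul, norm_I, one_mul] at h6
  rw [h6]
  refine (norm_add_le _ _).trans ?_
  rw [norm_mul, norm_I, one_mul]
  have h7 := norm_sub_le (∫ x : ℝ in σ₀..σ₁, G (x + T * I))
    (∫ x : ℝ in σ₀..σ₁, G (x + (-T : ℝ) * I))
  linarith

theorem natCast_rpow_one_add_inv_log {N : ℕ} (hN : 2 ≤ N) :
    (N : ℝ) ^ (1 + 1 / Real.log N) = N * Real.exp 1 := by
  have h1 : (1 : ℝ) < N := by exact_mod_cast hN
  have h2 : 0 < Real.log N := Real.log_pos h1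
  rw [Real.rpow_add (by linarith), Real.rpow_one, Real.rpow_def_of_pos (by linarith),
    mul_one_div_cancel h2.ne']

theorem norm_smoothed_sum_le {a : ℕ → ℂ} {F : ℂ → ℂ} {N : ℕ} (hN : 3 ≤ N) {D σ₀ T B : ℝ}
    (hD0 : 0 ≤ D) (hT : 0 < T) (hσ0 : 1 / 2 ≤ σ₀) (hσ1 : σ₀ ≤ 1)
    (hs : ∀ σ : ℝ, 1 < σ → LSeriesSummable a σ)
    (hD : ∀ σ y : ℝ, 1 < σ → σ ≤ 2 → ‖LSeries a (σ + y * I)‖ ≤ D / (σ - 1))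
    (hF : ∀ s : ℂ, 1 < s.re → LSeries a s = F s)
    (hd : ∀ s : ℂ, σ₀ ≤ s.re → s.re ≤ 1 + 1 / Real.log N → |s.im| ≤ T → DifferentiableAt ℂ F s)
    (hB : ∀ s : ℂ, σ₀ ≤ s.re → s.re ≤ 1 + 1 / Real.log N → |s.im| ≤ T → ‖F s‖ ≤ B) :
    ‖∑ n ∈ Icc 1 N, a n * (1 - (n / N : ℝ))‖ ≤
      6 * D * Real.log N * N / T + 8 * T * B * (N : ℝ) ^ σ₀ + 9 * B * N / T ^ 2 := by
  have hN3 : (3 : ℝ) ≤ N := by exact_mod_cast hN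
  have hN0 : (0 : ℝ) < N := by linarith
  have hNc : (N : ℂ) ≠ 0 := by exact_mod_cast hN0.ne'
  have hlog : 1 ≤ Real.log N := by
    rw [Real.le_log_iff_exp_le hN0]; linarith [Real.exp_one_lt_d9]
  have he : Real.exp 1 ≤ 3 := by linarith [Real.exp_one_lt_d9]
  have hpow := natCast_rpow_one_add_inv_log (N := N) (by omega)
  set σ₁ := 1 + 1 / Real.log N with hσ
  have h1σ : 1 < σ₁ := by rw [hσ]; linarith [one_div_pos.mpr (lt_of_lt_of_le one_pos hlog)]
  have hσ2 : σ₁ ≤ 2 := by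
    have : 1 / Real.log N ≤ 1 := by rw [div_le_one (by linarith)]; exact hlog
    linarith
  have hB0 : 0 ≤ B := (norm_nonneg _).trans (hB σ₀ (by simp) (by simp; linarith) (by simpa using hT.le))
  have hP := two_pi_mul_sum_eq_integral h1σ.le (hs σ₁ h1σ) (N := N) (by omega)
  set G : ℂ → ℂ := fun s => F s * ((N : ℂ) ^ s * cesaroKernel s) with hG
  have hGline : ∀ y : ℝ, LSeries a (σ₁ + y * I) *
      ((N : ℂ) ^ ((σ₁ : ℂ) + y * I) * cesaroKernel (σ₁ + y * I)) = G (σ₁ + y * I) := by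
    intro y
    rw [hF _ (by simpa using h1σ)]
  have hNn : ∀ s : ℂ, ‖(N : ℂ) ^ s‖ = (N : ℝ) ^ s.re := fun s =>
    norm_natCast_cpow_of_pos (by omega) s
  have hGd : ∀ s : ℂ, σ₀ ≤ s.re → s.re ≤ σ₁ → |s.im| ≤ T → DifferentiableAt ℂ G s := by
    intro s h1 h2 h3
    have hs0 : 0 < s.re := by linarith
    have hn1 : s ≠ 0 := by rintro rfl; simp at hs0
    have hn2 : s + 1 ≠ 0 := by
      intro h
      have := congrArg re h
      simp at this
      linarith
    refine (hd s h1 h2 h3).mul ((DifferentiableAt.const_cpow differentiableAt_id (Or.inl hNc)).mul ?_)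
    unfold cesaroKernel
    exact ((differentiableAt_const _).div differentiableAt_id hn1).sub
      ((differentiableAt_const _).div (differentiableAt_id.add (differentiableAt_const _)) hn2)
  have hV : ∀ y : ℝ, |y| ≤ T → ‖G (σ₀ + y * I)‖ ≤ 4 * B * (N : ℝ) ^ σ₀ := by
    intro y hy
    have hre : ((σ₀ : ℂ) + y * I).re = σ₀ := by simp
    have him : ((σ₀ : ℂ) + y * I).im = y := by simp
    have h1 := hB (σ₀ + y * I) (by rw [hre]) (by rw [hre]; linarith) (by rwa [him])
    have h2 := norm_cesaroKernel_le (s := σ₀ + y * I) (by rw [hre]; linarith)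
    have h3 : (((σ₀ : ℂ) + y * I).re ^ 2 + ((σ₀ : ℂ) + y * I).im ^ 2)⁻¹ ≤ 4 := by
      rw [hre, him]
      refine inv_le_of_inv_le₀ (by norm_num) ?_
      nlinarith [sq_nonneg y]
    rw [hG, norm_mul, norm_mul, hNn, hre]
    calc _ ≤ B * ((N : ℝ) ^ σ₀ * 4) := by gcongr; exact h2.trans h3
      _ = _ := by ring
  have hW : ∀ x y : ℝ, σ₀ ≤ x → x ≤ σ₁ → |y| = T → ‖G (x + y * I)‖ ≤ 3 * B * N / T ^ 2 := by
    intro x y hx0 hx1 hy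
    have hre : ((x : ℂ) + y * I).re = x := by simp
    have him : ((x : ℂ) + y * I).im = y := by simp
    have h1 := hB (x + y * I) (by rwa [hre]) (by rwa [hre]) (by rw [him, hy])
    have h2 := norm_cesaroKernel_le (s := x + y * I) (by rw [hre]; linarith)
    have h3 : (((x : ℂ) + y * I).re ^ 2 + ((x : ℂ) + y * I).im ^ 2)⁻¹ ≤ (T ^ 2)⁻¹ := by
      rw [hre, him, ← hy, sq_abs]
      have : 0 < y ^ 2 := by rw [← sq_abs, hy]; positivity
      gcongr
      nlinarith [sq_nonneg x]
    have h4 : (N : ℝ) ^ x ≤ N * 3 := by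
      calc (N : ℝ) ^ x ≤ (N : ℝ) ^ σ₁ := by gcongr; linarith
        _ ≤ N * 3 := by rw [hpow]; gcongr
    rw [hG, norm_mul, norm_mul, hNn, hre]
    calc _ ≤ B * ((N * 3) * (T ^ 2)⁻¹) := by gcongr; exact h2.trans h3
      _ = _ := by rw [div_eq_mul_inv]; ring
  have hvert := norm_vertical_integral_le (by linarith) hT hGd hV hW
  simp_rw [hGline] at hP
  have hGcont : Continuous fun y : ℝ => (N : ℂ) ^ ((σ₁ : ℂ) + y * I) :=
    Continuous.const_cpow (by fun_prop) (Or.inl hNc)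
  have hbound : ∀ y : ℝ, ‖G (σ₁ + y * I)‖ ≤ (3 * D * Real.log N * N) * (1 + y ^ 2)⁻¹ := by
    intro y
    have h1 := hD σ₁ y h1σ hσ2
    rw [hF _ (by simpa using h1σ)] at h1
    have h2 : D / (σ₁ - 1) = D * Real.log N := by
      rw [hσ, add_sub_cancel_left, div_div_eq_mul_div, div_one]
    rw [h2] at h1
    have hre : ((σ₁ : ℂ) + y * I).re = σ₁ := by simp
    rw [hG, norm_mul, norm_mul, hNn, hre, hpow]
    calc _ ≤ D * Real.log N * ((N * 3) * (1 + y ^ 2)⁻¹) := by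
          gcongr
          exact norm_cesaroKernel_line_le h1σ.le y
      _ = _ := by ring
  have hmeas : MeasureTheory.AEStronglyMeasurable (fun y : ℝ => G (σ₁ + y * I)) := by
    have hc : Continuous fun y : ℝ => LSeries a (σ₁ + y * I) := by
      have : ∀ y : ℝ, LSeries a (σ₁ + y * I) = ∑' n, LSeries.term a (σ₁ + y * I) n := fun y => rfl
      simp_rw [this]
      refine continuous_tsum (u := fun n => ‖LSeries.term a σ₁ n‖) (fun n => ?_) (hs σ₁ h1σ).norm
        (fun n y => (norm_term_line a σ₁ y n).le)
      simp_rw [LSeries.term_def]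
      split_ifs with h
      · exact continuous_const
      · have hn : (n : ℂ) ≠ 0 := by exact_mod_cast h
        refine continuous_const.div ?_ fun y => ?_
        · exact Continuous.const_cpow (by fun_prop) (Or.inl hn)
        · rw [Ne, cpow_eq_zero_iff]; tauto
    simp_rw [← hGline]
    exact (hc.mul (hGcont.mul (continuous_cesaroKernel_line (by linarith)))).aestronglyMeasurable
  have hInt : MeasureTheory.Integrable (fun y : ℝ => G (σ₁ + y * I)) :=
    (integrable_inv_one_add_sq.const_mul _).mono' hmeas (Filter.Eventually.of_forall hbound)
  have htot := norm_integral_le_add_of_norm_le hInt (by positivity) hT hbound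
  rw [← hP, norm_mul, norm_mul, norm_real, Complex.norm_ofNat, Real.norm_of_nonneg Real.pi_pos.le] at htot
  have hpi := Real.pi_gt_three
  set S := ‖∑ n ∈ Icc 1 N, a n * (1 - ((n / N : ℝ) : ℂ))‖ with hS
  have hS0 : 0 ≤ S := norm_nonneg _
  have h1 : S ≤ 2 * Real.pi * S := le_mul_of_one_le_left hS0 (by linarith)
  have h2 : 2 * (3 * B * N / T ^ 2 * (σ₁ - σ₀)) ≤ 9 * B * N / T ^ 2 := by
    have : 0 ≤ 3 * B * N / T ^ 2 := by positivity
    have h3 : 9 * B * N / T ^ 2 = 3 * B * N / T ^ 2 * 3 := by ring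
    rw [h3]
    nlinarith
  have h3 : 2 * (3 * D * Real.log N * N) / T = 6 * D * Real.log N * N / T := by ring
  have h4 : 4 * B * (N : ℝ) ^ σ₀ * (2 * T) = 8 * T * B * (N : ℝ) ^ σ₀ := by ring
  linarith

theorem norm_LSeries_twist_vonMangoldt_le {q : ℕ} (χ : DirichletCharacter ℂ q) {s : ℂ}
    (hs : 1 < s.re) :
    ‖LSeries (fun n : ℕ => χ n * (ArithmeticFunction.vonMangoldt n : ℂ)) s‖ ≤
      (LSeries (fun n => (ArithmeticFunction.vonMangoldt n : ℂ)) s.re).re := by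
  have hs' : 1 < (s.re : ℂ).re := by simpa using hs
  have hsum := ArithmeticFunction.LSeriesSummable_vonMangoldt hs'
  have hle : ∀ n, ‖LSeries.term (fun n : ℕ => χ n * (ArithmeticFunction.vonMangoldt n : ℂ)) s n‖ ≤
      ‖LSeries.term (fun n => (ArithmeticFunction.vonMangoldt n : ℂ)) (s.re : ℂ) n‖ := by
    intro n
    rw [LSeries.norm_term_eq, LSeries.norm_term_eq, ofReal_re]
    split_ifs
    · rfl
    · rw [norm_mul]
      gcongr
      exact mul_le_of_le_one_left (norm_nonneg _) (χ.norm_le_one _)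
  have hre : ∀ n, LSeries.term (fun n => (ArithmeticFunction.vonMangoldt n : ℂ)) (s.re : ℂ) n =
      (‖LSeries.term (fun n => (ArithmeticFunction.vonMangoldt n : ℂ)) (s.re : ℂ) n‖ : ℂ) := by
    intro n
    rw [LSeries.norm_term_eq, LSeries.term_def]
    split_ifs with h
    · simp
    · rw [norm_real, Real.norm_of_nonneg ArithmeticFunction.vonMangoldt_nonneg, ofReal_re,
        ofReal_div, ofReal_cpow (Nat.cast_nonneg n)]
      simp
  refine (norm_tsum_le_tsum_norm (LSeriesSummable_twist q χ hs).norm).trans ?_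
  refine ((LSeriesSummable_twist q χ hs).norm.tsum_le_tsum hle hsum.norm).trans (le_of_eq ?_)
  rw [LSeries]
  rw [tsum_congr hre, ← ofReal_tsum, ofReal_re]

theorem LSeriesSummable_centeredTwist {q : ℕ} (χ : DirichletCharacter ℂ q) {s : ℂ}
    (hs : 1 < s.re) : LSeriesSummable (centeredTwist χ) s := by
  have h2 := LSeriesSummable_twist q χ hs
  by_cases hχ : χ = 1
  · have h3 : centeredTwist χ = (fun n : ℕ => χ n * (ArithmeticFunction.vonMangoldt n : ℂ)) - 1 := by
      ext n; simp [centeredTwist, hχ]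
    rw [h3]
    exact h2.sub (LSeriesSummable_one_iff.mpr hs)
  · have h3 : centeredTwist χ = (fun n : ℕ => χ n * (ArithmeticFunction.vonMangoldt n : ℂ)) := by
      ext n; simp [centeredTwist, hχ]
    rwa [h3]

theorem exists_norm_LSeries_centeredTwist_le : ∃ D : ℝ, 0 < D ∧
    ∀ (q : ℕ) (χ : DirichletCharacter ℂ q) (σ y : ℝ), 1 < σ → σ ≤ 2 →
      ‖LSeries (centeredTwist χ) (σ + y * I)‖ ≤ D / (σ - 1) := by
  obtain ⟨C, hC, hCb⟩ := exists_re_LSeries_vonMangoldt_le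
  refine ⟨C + 6, by linarith, fun q χ σ y h1 h2 => ?_⟩
  have hre : ((σ : ℂ) + y * I).re = σ := by simp
  have hs : 1 < ((σ : ℂ) + y * I).re := by rwa [hre]
  have hA := norm_LSeries_twist_vonMangoldt_le χ hs
  rw [hre] at hA
  have hB := hCb σ h1 h2
  have hσ : 0 < σ - 1 := by linarith
  have hC1 : C ≤ C / (σ - 1) := by rw [le_div_iff₀ hσ]; nlinarith
  have hsplit : (C + 6) / (σ - 1) = 1 / (σ - 1) + C / (σ - 1) + 5 / (σ - 1) := by ring
  have h5 : 0 ≤ 5 / (σ - 1) := by positivity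
  by_cases hχ : χ = 1
  · have h3 : centeredTwist χ = (fun n : ℕ => χ n * (ArithmeticFunction.vonMangoldt n : ℂ)) - 1 := by
      ext n; simp [centeredTwist, hχ]
    rw [h3, LSeries_sub (LSeriesSummable_twist q χ hs) (LSeriesSummable_one_iff.mpr hs)]
    refine (norm_sub_le _ _).trans ?_
    have h6 := norm_LSeries_le_zeta (f := 1) (fun n => by simp) hs
    rw [hre] at h6
    have h7 := norm_riemannZeta_le h1 h2
    linarith
  · have h3 : centeredTwist χ = (fun n : ℕ => χ n * (ArithmeticFunction.vonMangoldt n : ℂ)) := by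
      ext n; simp [centeredTwist, hχ]
    rw [h3]
    linarith

/-- Prime number theorem for a character with a zero-free strip of width `3δ` up to height
`T + 1`. -/
theorem exists_norm_smoothed_sum_centeredTwist_le : ∃ D : ℝ, 0 < D ∧
    ∀ (q : ℕ) [NeZero q] (χ : DirichletCharacter ℂ q) (δ T : ℝ) (N : ℕ), 3 ≤ N → 0 < δ →
      δ ≤ 1 / 8 → 1 ≤ T → 1 ≤ 4 * δ * Real.log N →
      (∀ ρ, entireL χ ρ = 0 → |ρ.im| ≤ T + 1 → ρ.re ≤ 1 - 3 * δ) →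
      ‖∑ n ∈ Icc 1 N, centeredTwist χ n * (1 - (n / N : ℝ))‖ ≤
        D * (Real.log N * N / T + (Real.log (180 * q * (T + 3) ^ 2 / δ ^ 2) / δ + T) *
          (T * (N : ℝ) ^ (1 - 2 * δ) + N / T ^ 2)) := by
  obtain ⟨D, hD, hDb⟩ := exists_norm_LSeries_centeredTwist_le
  refine ⟨6 * D + 300, by linarith, fun q _ χ δ T N hN hδ hδ1 hT hδN hz => ?_⟩
  have hq : (1 : ℝ) ≤ q := by exact_mod_cast NeZero.one_le
  have hN3 : (3 : ℝ) ≤ N := by exact_mod_cast hN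
  have hlog : 0 < Real.log N := Real.log_pos (by linarith)
  have h14 : 1 / Real.log N ≤ 4 * δ := by rwa [div_le_iff₀ hlog]
  set M := Real.log (180 * q * (T + 3) ^ 2 / δ ^ 2) with hM
  have hMpos : 0 < M := by
    refine Real.log_pos ?_
    rw [lt_div_iff₀ (by positivity)]
    nlinarith
  have h := norm_smoothed_sum_le (a := centeredTwist χ) (F := centeredTwistL χ) hN (D := D)
    (σ₀ := 1 - 2 * δ) (T := T) (B := 28 * M / δ + (13 + 6 * T)) hD.le (by linarith) (by linarith)
    (by linarith) (fun σ hσ => LSeriesSummable_centeredTwist χ (by simpa using hσ))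
    (hDb q χ) (fun s hs => LSeries_centeredTwist χ hs)
    (fun s h1 h2 h3 => differentiableAt_centeredTwistL (by linarith) fun h0 => by
      have := hz s h0 (by linarith)
      linarith)
    (fun s h1 h2 h3 => norm_centeredTwistL_le hδ hδ1 hz h1 (by linarith) h3)
  refine h.trans ?_
  set B := 28 * M / δ + (13 + 6 * T) with hBdef
  have hB : B ≤ 28 * (M / δ + T) := by rw [hBdef, mul_div_assoc]; linarith
  have hB0 : 0 ≤ M / δ + T := by positivity
  have hP : (0 : ℝ) ≤ (N : ℝ) ^ (1 - 2 * δ) := by positivity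
  have hNT : (0 : ℝ) ≤ N / T ^ 2 := by positivity
  have h1 : 8 * T * B * (N : ℝ) ^ (1 - 2 * δ) + 9 * B * N / T ^ 2 ≤
      300 * ((M / δ + T) * (T * (N : ℝ) ^ (1 - 2 * δ) + N / T ^ 2)) := by
    calc 8 * T * B * (N : ℝ) ^ (1 - 2 * δ) + 9 * B * N / T ^ 2
        = B * (8 * (T * (N : ℝ) ^ (1 - 2 * δ)) + 9 * (N / T ^ 2)) := by ring
      _ ≤ (28 * (M / δ + T)) * (8 * (T * (N : ℝ) ^ (1 - 2 * δ)) + 9 * (N / T ^ 2)) := by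
          gcongr
      _ = (M / δ + T) * (224 * (T * (N : ℝ) ^ (1 - 2 * δ)) + 252 * (N / T ^ 2)) := by ring
      _ ≤ (M / δ + T) * (300 * (T * (N : ℝ) ^ (1 - 2 * δ)) + 300 * (N / T ^ 2)) := by
          gcongr <;> norm_num
      _ = _ := by ring
  have h2 : 0 ≤ Real.log N * N / T := by positivity
  have h3 : 0 ≤ (M / δ + T) * (T * (N : ℝ) ^ (1 - 2 * δ) + N / T ^ 2) := by positivity
  have h4 : 6 * D * Real.log N * N / T = 6 * D * (Real.log N * N / T) := by ring
  nlinarith [mul_nonneg hD.le h3]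

theorem exists_rpow_le_exp (A : ℝ) : ∃ R₀ : ℝ, 1 ≤ R₀ ∧ ∀ R : ℝ, R₀ ≤ R → (R ^ 2) ^ A ≤ Real.exp R := by
  have h := (isLittleO_rpow_exp_atTop (2 * A)).bound (c := 1) one_pos
  obtain ⟨R₀, hR⟩ := Filter.eventually_atTop.mp h
  refine ⟨max R₀ 1, le_max_right _ _, fun R hR' => ?_⟩
  have h1 : (1 : ℝ) ≤ R := (le_max_right _ _).trans hR'
  have h2 := hR R ((le_max_left _ _).trans hR')
  rw [one_mul, Real.norm_of_nonneg (by positivity), Real.norm_of_nonneg (by positivity)] at h2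
  rwa [← Real.rpow_natCast R 2, ← Real.rpow_mul (by linarith)]

theorem exists_zero_free_of_le_pow {A : ℝ} (hA : 0 < A) : ∃ k R₀ : ℝ, 0 < k ∧ k ≤ 1 / 24 ∧ 2 ≤ R₀ ∧
    ∀ R : ℝ, R₀ ≤ R → ∀ (q : ℕ) [NeZero q] (χ : DirichletCharacter ℂ q), (q : ℝ) ≤ (R ^ 2) ^ A →
      ∀ T : ℝ, 1 ≤ T → T ≤ Real.exp R → Real.log (q * (T + 3)) ≤ 3 * R ∧
        ∀ ρ, entireL χ ρ = 0 → |ρ.im| ≤ T + 1 → ρ.re ≤ 1 - k / R := by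
  obtain ⟨κ, hκ0, hκ1, hκ⟩ := exists_zero_free_region
  obtain ⟨c, hc, hS⟩ := exists_siegel (ε := 1 / (2 * A)) (by positivity)
  obtain ⟨R₀, hR1, hR₀⟩ := exists_rpow_le_exp A
  have hm : 0 < min c (1 / 3) := lt_min hc (by norm_num)
  refine ⟨κ * min c (1 / 3), max R₀ 2, by positivity, ?_, le_max_right _ _, ?_⟩
  · calc κ * min c (1 / 3) ≤ 1 / 8 * (1 / 3) := by
          gcongr
          exact min_le_right _ _
      _ = 1 / 24 := by norm_num
  intro R hR q _ χ hq T hT1 hT2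
  have hR2 : 2 ≤ R := (le_max_right _ _).trans hR
  have hRpos : 0 < R := by linarith
  have hq1 : (1 : ℝ) ≤ q := by exact_mod_cast NeZero.one_le
  have hqe : (q : ℝ) ≤ Real.exp R := hq.trans (hR₀ R ((le_max_left _ _).trans hR))
  have h5 : (5 : ℝ) ≤ Real.exp R := by
    calc (5 : ℝ) ≤ 2.7 ^ 2 := by norm_num
      _ ≤ Real.exp 1 ^ 2 := by gcongr; linarith [Real.exp_one_gt_d9]
      _ = Real.exp 2 := by rw [← Real.exp_nat_mul]; norm_num
      _ ≤ Real.exp R := Real.exp_le_exp.mpr hR2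
  have hlog : ∀ u : ℝ, 0 < u → u ≤ T + 4 → Real.log (q * u) ≤ 3 * R := by
    intro u hu0 hu
    rw [Real.log_le_iff_le_exp (by positivity)]
    calc (q : ℝ) * u ≤ Real.exp R * (5 * T) := by gcongr; linarith
      _ ≤ Real.exp R * (Real.exp R * Real.exp R) := by gcongr
      _ = Real.exp (3 * R) := by rw [← Real.exp_add, ← Real.exp_add]; ring_nf
  refine ⟨hlog _ (by linarith) (by linarith), fun ρ hρ him => ?_⟩
  have hη : 0 < c / R := by positivity
  have hsieg : χ ^ 2 = 1 → ∀ s : ℂ, ‖s - 1‖ < c / R → entireL χ s ≠ 0 := by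
    intro h2 s hs
    refine hS q χ h2 s (hs.trans_le ?_)
    rw [div_eq_mul_inv]
    gcongr
    rw [Real.rpow_neg (by linarith)]
    gcongr
    calc (q : ℝ) ^ (1 / (2 * A)) ≤ ((R ^ 2) ^ A) ^ (1 / (2 * A)) := by gcongr
      _ = R := by
        have : A * (1 / (2 * A)) = 1 / 2 := by field_simp
        rw [← Real.rpow_mul (sq_nonneg R), this, ← Real.sqrt_eq_rpow, Real.sqrt_sq hRpos.le]
  refine (hκ q χ (c / R) hη hsieg ρ hρ).trans ?_
  have h1 := hlog (|ρ.im| + 3) (by positivity) (by linarith)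
  have h0 : 1 ≤ Real.log (q * (|ρ.im| + 3)) := one_le_log_mul_add_three _
  have h2 : min c (1 / 3) / R ≤ min (c / R) (1 / Real.log (q * (|ρ.im| + 3))) := by
    refine le_min ?_ ?_
    · gcongr
      exact min_le_left _ _
    · calc min c (1 / 3) / R ≤ (1 / 3) / R := by gcongr; exact min_le_right _ _
        _ = 1 / (3 * R) := by field_simp
        _ ≤ _ := by gcongr
  have h3 := mul_le_mul_of_nonneg_left h2 hκ0.le
  rw [← mul_div_assoc] at h3
  linarith

theorem sq_le_mul_exp {b R : ℝ} (hb : 0 < b) (hR : 0 ≤ R) : R ^ 2 ≤ 2 / b ^ 2 * Real.exp (b * R) := by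
  have h := Real.quadratic_le_exp_of_nonneg (x := b * R) (by positivity)
  rw [div_mul_eq_mul_div, le_div_iff₀ (by positivity)]
  have : 0 ≤ b * R := by positivity
  nlinarith

theorem exists_norm_sum_centeredTwist_le_of_large {A : ℝ} (hA : 0 < A) :
    ∃ C b R₀ : ℝ, 0 < C ∧ 0 < b ∧ b ≤ 1 ∧ 2 ≤ R₀ ∧ ∀ R : ℝ, R₀ ≤ R → ∀ (q : ℕ) [NeZero q]
      (χ : DirichletCharacter ℂ q), (q : ℝ) ≤ (R ^ 2) ^ A → ∀ N : ℕ, 3 ≤ N →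
      R ^ 2 / 2 ≤ Real.log N → Real.log N ≤ 2 * R ^ 2 →
      ‖∑ n ∈ Icc 1 N, centeredTwist χ n * (1 - (n / N : ℝ))‖ ≤ C * N * Real.exp (-b * R) := by
  obtain ⟨k, R₁, hk0, hk1, hR1, hzf⟩ := exists_zero_free_of_le_pow hA
  obtain ⟨D, hD, hsm⟩ := exists_norm_smoothed_sum_centeredTwist_le
  set b := k / 12 with hb
  have hb0 : 0 < b := by positivity
  set K := ((72 + 18 / k) / k) * (2 / b ^ 2) + 1 with hK
  have hK0 : 0 < K := by positivity
  refine ⟨D * (16 / b ^ 2 + 2 * K), b / 2, max R₁ (3 / (2 * k)), by positivity, by positivity,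
    by linarith, hR1.trans (le_max_left _ _), ?_⟩
  intro R hR q _ χ hq N hN hN1 hN2
  have hRR : R₁ ≤ R := (le_max_left _ _).trans hR
  have hRk : 3 / (2 * k) ≤ R := (le_max_right _ _).trans hR
  have hR2 : 2 ≤ R := hR1.trans hRR
  have hRpos : 0 < R := by linarith
  have hN0 : (0 : ℝ) < N := by positivity
  set T := Real.exp (b * R) with hTdef
  have hbR : 0 ≤ b * R := by positivity
  have hT1 : 1 ≤ T := Real.one_le_exp hbR
  have hT2 : T ≤ Real.exp R := Real.exp_le_exp.mpr (by nlinarith)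
  obtain ⟨hlog, hz⟩ := hzf R hRR q χ hq T hT1 hT2
  set δ := k / (3 * R) with hδ
  have hδ0 : 0 < δ := by positivity
  have hδ3 : 3 * δ = k / R := by rw [hδ]; field_simp
  have hδ1 : δ ≤ 1 / 8 := by
    rw [hδ, div_le_iff₀ (by positivity)]; linarith
  have hRk' : 3 ≤ R * (2 * k) := by rwa [div_le_iff₀ (by positivity)] at hRk
  have hδR : δ * R ^ 2 = k * R / 3 := by rw [hδ]; field_simp
  have hδN : 1 ≤ 4 * δ * Real.log N := by
    have : 4 * δ * (R ^ 2 / 2) ≤ 4 * δ * Real.log N := by gcongr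
    linarith
  have h := hsm q χ δ T N hN hδ0 hδ1 hT1 hδN (by rw [hδ3]; exact hz)
  refine h.trans ?_
  set M := Real.log (180 * q * (T + 3) ^ 2 / δ ^ 2) with hM
  have hMle : M ≤ 24 * R + 6 * R / k := by
    have h1 := log_growth_le (q := q) (t := T) hδ0
    rw [abs_of_nonneg (by linarith)] at h1
    have h2 : Real.log (1 / δ) ≤ 1 / δ := (Real.log_le_sub_one_of_pos (by positivity)).trans
      (by linarith)
    have h3 : 1 / δ = 3 * R / k := by rw [hδ]; field_simp
    have h4 : 6 * R / k = 2 * (3 * R / k) := by ring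
    rw [h4]
    linarith
  have hMδ : M / δ + T ≤ K * T := by
    have h1 : M / δ ≤ ((72 + 18 / k) / k) * R ^ 2 := by
      calc M / δ ≤ (24 * R + 6 * R / k) / δ := by gcongr
        _ = ((72 + 18 / k) / k) * R ^ 2 := by rw [hδ]; field_simp; ring
    have h2 : ((72 + 18 / k) / k) * R ^ 2 ≤ ((72 + 18 / k) / k) * (2 / b ^ 2 * T) := by
      gcongr
      exact sq_le_mul_exp hb0 hRpos.le
    rw [hK, add_mul, one_mul, mul_assoc]
    linarith
  have hNpow : (N : ℝ) ^ (1 - 2 * δ) ≤ N * Real.exp (-(4 * (b * R))) := by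
    rw [Real.rpow_sub hN0, Real.rpow_one, Real.exp_neg, div_eq_mul_inv]
    gcongr
    rw [Real.rpow_def_of_pos hN0]
    refine Real.exp_le_exp.mpr ?_
    have : (R ^ 2 / 2) * (2 * δ) ≤ Real.log N * (2 * δ) := by gcongr
    rw [hb]
    linarith
  have hT4 : Real.exp (-(4 * (b * R))) = (T ^ 4)⁻¹ := by
    rw [Real.exp_neg, hTdef, ← Real.exp_nat_mul]; norm_num
  have hE : Real.exp (-(b / 2) * R) = Real.exp (b / 2 * R) / T := by
    rw [hTdef, ← Real.exp_sub]; ring_nf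
  have hTE : 1 / T ≤ Real.exp (-(b / 2) * R) := by
    rw [hE]; gcongr; exact Real.one_le_exp (by positivity)
  have ht1 : Real.log N * N / T ≤ 16 / b ^ 2 * (N * Real.exp (-(b / 2) * R)) := by
    have h1 : R ^ 2 ≤ 2 / (b / 2) ^ 2 * Real.exp (b / 2 * R) := sq_le_mul_exp (by positivity) hRpos.le
    have h2 : 2 / (b / 2) ^ 2 = 8 / b ^ 2 := by field_simp; norm_num
    rw [h2] at h1
    calc Real.log N * N / T ≤ (2 * (8 / b ^ 2 * Real.exp (b / 2 * R))) * N / T := by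
          gcongr; linarith
      _ = _ := by rw [hE]; ring
  have ht2 : (M / δ + T) * (T * (N : ℝ) ^ (1 - 2 * δ) + N / T ^ 2) ≤
      2 * K * (N * Real.exp (-(b / 2) * R)) := by
    calc (M / δ + T) * (T * (N : ℝ) ^ (1 - 2 * δ) + N / T ^ 2)
        ≤ (K * T) * (T * (N * (T ^ 4)⁻¹) + N / T ^ 2) := by
          rw [← hT4]; gcongr
      _ = K * N * (1 / T) * (1 / T + 1) := by field_simp
      _ ≤ K * N * Real.exp (-(b / 2) * R) * (1 + 1) := by
          gcongr
          rw [div_le_one (by linarith)]; exact hT1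
      _ = _ := by ring
  calc _ ≤ D * (16 / b ^ 2 * (N * Real.exp (-(b / 2) * R)) + 2 * K * (N * Real.exp (-(b / 2) * R))) := by
        gcongr
    _ = _ := by ring

theorem sum_vonMangoldt_Icc_le (y : ℕ) :
    ∑ n ∈ Icc 1 y, ArithmeticFunction.vonMangoldt n ≤ (Real.log 4 + 4) * y := by
  have h := Chebyshev.psi_le_const_mul_self (x := (y : ℝ)) (by positivity)
  rw [Chebyshev.psi_eq_sum_Icc, Nat.floor_natCast] at h
  refine le_trans (Finset.sum_le_sum_of_subset_of_nonneg (fun n hn => ?_) fun _ _ _ =>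
    ArithmeticFunction.vonMangoldt_nonneg) h
  simp only [mem_Icc] at hn ⊢
  omega

theorem norm_sum_centeredTwist_mul_sub_le {q : ℕ} (χ : DirichletCharacter ℂ q) (y : ℕ) :
    ‖∑ n ∈ Icc 1 y, centeredTwist χ n * ((y : ℂ) - n)‖ ≤ (Real.log 4 + 5) * (y : ℝ) ^ 2 := by
  calc _ ≤ ∑ n ∈ Icc 1 y, (ArithmeticFunction.vonMangoldt n + 1) * (y : ℝ) := by
        refine norm_sum_le_of_le _ fun n hn => ?_
        rw [norm_mul]
        have hn' := mem_Icc.mp hn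
        gcongr
        · exact norm_centeredTwist_le χ n
        · rw [← Nat.cast_sub hn'.2, Complex.norm_natCast]
          exact_mod_cast Nat.sub_le _ _
    _ = (∑ n ∈ Icc 1 y, ArithmeticFunction.vonMangoldt n + y) * y := by
        rw [← Finset.sum_mul, Finset.sum_add_distrib]
        simp
    _ ≤ ((Real.log 4 + 4) * y + y) * y := by
        gcongr
        exact sum_vonMangoldt_Icc_le y
    _ = _ := by ring

theorem exists_norm_sum_centeredTwist_mul_sub_le {A : ℝ} (hA : 0 < A) :
    ∃ C b R₀ : ℝ, 0 < C ∧ 0 < b ∧ b ≤ 1 ∧ 2 ≤ R₀ ∧ ∀ R : ℝ, R₀ ≤ R → ∀ (q : ℕ) [NeZero q]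
      (χ : DirichletCharacter ℂ q), (q : ℝ) ≤ (R ^ 2) ^ A → ∀ y : ℕ, (y : ℝ) ≤ 2 * Real.exp (R ^ 2) →
      ‖∑ n ∈ Icc 1 y, centeredTwist χ n * ((y : ℂ) - n)‖ ≤
        C * Real.exp (R ^ 2) ^ 2 * Real.exp (-b * R) := by
  obtain ⟨C, b, R₀, hC, hb, hb1, hR₀, h⟩ := exists_norm_sum_centeredTwist_le_of_large hA
  have hl : 0 < Real.log 4 := Real.log_pos (by norm_num)
  refine ⟨4 * C + (Real.log 4 + 5), b, R₀, by positivity, hb, hb1, hR₀, fun R hR q _ χ hq y hy => ?_⟩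
  have hR2 : 2 ≤ R := hR₀.trans hR
  have hE : 0 < Real.exp (R ^ 2) := Real.exp_pos _
  by_cases hbig : Real.exp (R ^ 2 / 2) ≤ y
  · have hy3 : 3 ≤ y := by
      have h1 : (2 : ℝ) < y := by
        calc (2 : ℝ) < R ^ 2 / 2 + 1 := by nlinarith
          _ ≤ Real.exp (R ^ 2 / 2) := Real.add_one_le_exp _
          _ ≤ y := hbig
      have : 2 < y := by exact_mod_cast h1
      omega
    have hy0 : (0 : ℝ) < y := by positivity
    have hlo : R ^ 2 / 2 ≤ Real.log y := (Real.le_log_iff_exp_le hy0).mpr hbig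
    have hhi : Real.log y ≤ 2 * R ^ 2 := by
      rw [Real.log_le_iff_le_exp hy0, two_mul, Real.exp_add]
      refine hy.trans ?_
      gcongr
      nlinarith [Real.add_one_le_exp (R ^ 2)]
    have key := h R hR q χ hq y hy3 hlo hhi
    have hrw : ∑ n ∈ Icc 1 y, centeredTwist χ n * ((y : ℂ) - n) =
        y * ∑ n ∈ Icc 1 y, centeredTwist χ n * (1 - (n / y : ℝ)) := by
      rw [Finset.mul_sum]
      refine Finset.sum_congr rfl fun n _ => ?_
      have : (y : ℂ) ≠ 0 := by exact_mod_cast (by omega : y ≠ 0)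
      push_cast
      field_simp
    rw [hrw, norm_mul, Complex.norm_natCast]
    calc (y : ℝ) * _ ≤ y * (C * y * Real.exp (-b * R)) := by gcongr
      _ = C * (y : ℝ) ^ 2 * Real.exp (-b * R) := by ring
      _ ≤ C * (2 * Real.exp (R ^ 2)) ^ 2 * Real.exp (-b * R) := by gcongr
      _ = (4 * C) * Real.exp (R ^ 2) ^ 2 * Real.exp (-b * R) := by ring
      _ ≤ _ := by gcongr; linarith
  · push Not at hbig
    refine (norm_sum_centeredTwist_mul_sub_le χ y).trans ?_
    rw [mul_assoc]
    have h1 : (y : ℝ) ^ 2 ≤ Real.exp (R ^ 2) ^ 2 * Real.exp (-b * R) := by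
      calc (y : ℝ) ^ 2 ≤ Real.exp (R ^ 2 / 2) ^ 2 := by gcongr
        _ ≤ _ := by
          rw [← Real.exp_nat_mul, ← Real.exp_nat_mul, ← Real.exp_add]
          refine Real.exp_le_exp.mpr ?_
          push_cast
          nlinarith
    refine mul_le_mul (by linarith) h1 (sq_nonneg _) (by positivity)

theorem sum_sub_succ_eq (f : ℕ → ℝ) (m H : ℕ) :
    ∑ n ∈ Icc 1 (m + H), f n * (((m + H : ℕ) : ℝ) - n) - ∑ n ∈ Icc 1 m, f n * ((m : ℝ) - n) =
      H * ∑ n ∈ Icc 1 m, f n + ∑ n ∈ Ioc m (m + H), f n * (((m + H : ℕ) : ℝ) - n) := by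
  have h : Icc 1 (m + H) = Icc 1 m ∪ Ioc m (m + H) := by
    ext n; simp only [mem_Icc, mem_union, mem_Ioc]; omega
  have hd : Disjoint (Icc 1 m) (Ioc m (m + H)) := by
    rw [Finset.disjoint_left]; intro n; simp only [mem_Icc, mem_Ioc]; omega
  rw [h, Finset.sum_union hd, add_sub_right_comm, ← Finset.sum_sub_distrib, Finset.mul_sum]
  congr 1
  refine Finset.sum_congr rfl fun n _ => ?_
  push_cast; ring

/-- Removing a linear smoothing weight from an asymptotic formula for a nonnegative sequence. -/
theorem abs_sum_sub_mul_le_of_smoothed {f : ℕ → ℝ} (hf : ∀ n, 0 ≤ f n) {g B : ℝ} (hg0 : 0 ≤ g)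
    (hg1 : g ≤ 1) {Y : ℕ}
    (h : ∀ y ≤ Y, |∑ n ∈ Icc 1 y, f n * ((y : ℝ) - n) - g * (y * (y - 1) / 2)| ≤ B)
    {m H : ℕ} (hH : 1 ≤ H) (hm : m + H ≤ Y) :
    |∑ n ∈ Icc 1 m, f n - g * m| ≤ H + 2 * B / H := by
  have hH0 : (0 : ℝ) < H := by exact_mod_cast hH
  have hB : 0 ≤ B := (abs_nonneg _).trans (h 0 (Nat.zero_le _))
  have hpsi : 0 ≤ ∑ n ∈ Icc 1 m, f n := Finset.sum_nonneg fun n _ => hf n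
  have hBH : 2 * B / H * H = 2 * B := by field_simp
  have h0 := abs_le.mp (h m (by omega))
  have hgH : g * (H : ℝ) ^ 2 ≤ (H : ℝ) ^ 2 := mul_le_of_le_one_left (by positivity) hg1
  have hgH' : g * (H : ℝ) ≤ H := mul_le_of_le_one_left (by positivity) hg1
  rw [abs_le]
  constructor
  · by_cases hmH : m < H
    · have : (m : ℝ) ≤ H := by exact_mod_cast hmH.le
      have : g * m ≤ g * H := by gcongr
      have : 0 ≤ 2 * B / H := by positivity
      linarith
    · obtain ⟨k, rfl⟩ : ∃ k, m = k + H := ⟨m - H, by omega⟩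
      have h1 := abs_le.mp (h k (by omega))
      have e := sum_sub_succ_eq f k H
      have hle : ∑ n ∈ Ioc k (k + H), f n * (((k + H : ℕ) : ℝ) - n) ≤
          H * ∑ n ∈ Ioc k (k + H), f n := by
        rw [Finset.mul_sum]
        refine Finset.sum_le_sum fun n hn => ?_
        rw [mul_comm]
        have : (k : ℝ) < n := by exact_mod_cast (mem_Ioc.mp hn).1
        refine mul_le_mul_of_nonneg_right ?_ (hf n)
        push_cast; linarith
      have hs : ∑ n ∈ Icc 1 (k + H), f n = ∑ n ∈ Icc 1 k, f n + ∑ n ∈ Ioc k (k + H), f n := by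
        have h : Icc 1 (k + H) = Icc 1 k ∪ Ioc k (k + H) := by
          ext n; simp only [mem_Icc, mem_union, mem_Ioc]; omega
        rw [h, Finset.sum_union]
        rw [Finset.disjoint_left]; intro n; simp only [mem_Icc, mem_Ioc]; omega
      set S := ∑ n ∈ Icc 1 (k + H), f n with hS
      have key : g * (((k + H : ℕ) : ℝ) * (((k + H : ℕ) : ℝ) - 1) / 2) - g * (k * (k - 1) / 2) - 2 * B ≤
          H * S := by
        rw [hs, mul_add]; linarith
      have key2 : (g * ((k + H : ℕ) : ℝ) - H - 2 * B / H) * H ≤ S * H := by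
        have e2 : g * (((k + H : ℕ) : ℝ) * (((k + H : ℕ) : ℝ) - 1) / 2) - g * (k * (k - 1) / 2) =
            g * ((k + H : ℕ) : ℝ) * H - g * H ^ 2 / 2 - g * H / 2 := by push_cast; ring
        have : (H : ℝ) ≤ H ^ 2 := by
          have : (1 : ℝ) ≤ H := by exact_mod_cast hH
          nlinarith
        rw [e2] at key
        rw [sub_mul, sub_mul, hBH]
        linarith
      have := le_of_mul_le_mul_right key2 hH0
      linarith
  · have h1 := abs_le.mp (h (m + H) hm)
    have e := sum_sub_succ_eq f m H
    have hpos : 0 ≤ ∑ n ∈ Ioc m (m + H), f n * (((m + H : ℕ) : ℝ) - n) := by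
      refine Finset.sum_nonneg fun n hn => mul_nonneg (hf n) ?_
      have : (n : ℝ) ≤ ((m + H : ℕ) : ℝ) := by exact_mod_cast (mem_Ioc.mp hn).2
      linarith
    set S := ∑ n ∈ Icc 1 m, f n with hS
    have key : H * S ≤
        g * (((m + H : ℕ) : ℝ) * (((m + H : ℕ) : ℝ) - 1) / 2) - g * (m * (m - 1) / 2) + 2 * B := by
      linarith
    have e2 : g * (((m + H : ℕ) : ℝ) * (((m + H : ℕ) : ℝ) - 1) / 2) - g * (m * (m - 1) / 2) =
        g * m * H + g * H ^ 2 / 2 - g * H / 2 := by push_cast; ring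
    have key2 : S * H ≤ (g * m + H + 2 * B / H) * H := by
      rw [add_mul, add_mul, hBH]
      have : 0 ≤ g * H := by positivity
      nlinarith
    have := le_of_mul_le_mul_right key2 hH0
    linarith

open ArithmeticFunction.vonMangoldt in
theorem residueClass_sub_inv_totient {q : ℕ} [NeZero q] {r : ZMod q} (hr : IsUnit r) (n : ℕ) :
    (residueClass r n : ℂ) - (q.totient : ℂ)⁻¹ =
      (q.totient : ℂ)⁻¹ * ∑ χ : DirichletCharacter ℂ q, χ r⁻¹ * centeredTwist χ n := by
  classical
  have hr' : IsUnit r⁻¹ := by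
    obtain ⟨u, rfl⟩ := hr
    rw [ZMod.inv_coe_unit]
    exact u⁻¹.isUnit
  rw [residueClass_apply hr]
  simp only [centeredTwist, mul_sub, Finset.sum_sub_distrib, ← mul_assoc, mul_ite, mul_one, mul_zero,
    Finset.sum_ite_eq', mem_univ, if_true, MulChar.one_apply hr']

theorem sum_Icc_sub_eq (y : ℕ) : ∑ n ∈ Icc 1 y, ((y : ℝ) - n) = y * (y - 1) / 2 := by
  induction y with
  | zero => simp
  | succ k ih =>
    have h := sum_sub_succ_eq (fun _ => 1) k 1
    simp only [one_mul, Finset.sum_const, Nat.card_Icc, Nat.Ioc_succ_singleton,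
      Finset.sum_singleton, nsmul_eq_mul, Nat.add_sub_cancel] at h
    rw [ih] at h
    push_cast at h ⊢
    linarith

open ArithmeticFunction.vonMangoldt in
theorem exists_abs_smoothed_residueClass_sub_le {A : ℝ} (hA : 0 < A) :
    ∃ C b R₀ : ℝ, 0 < C ∧ 0 < b ∧ b ≤ 1 ∧ 2 ≤ R₀ ∧ ∀ R : ℝ, R₀ ≤ R → ∀ (q : ℕ) [NeZero q]
      (r : ZMod q), IsUnit r → (q : ℝ) ≤ (R ^ 2) ^ A → ∀ y : ℕ, (y : ℝ) ≤ 2 * Real.exp (R ^ 2) →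
      |∑ n ∈ Icc 1 y, residueClass r n * ((y : ℝ) - n) - (q.totient : ℝ)⁻¹ * (y * (y - 1) / 2)| ≤
        C * Real.exp (R ^ 2) ^ 2 * Real.exp (-b * R) := by
  obtain ⟨C, b, R₀, hC, hb, hb1, hR₀, h⟩ := exists_norm_sum_centeredTwist_mul_sub_le hA
  refine ⟨C, b, R₀, hC, hb, hb1, hR₀, fun R hR q _ r hr hq y hy => ?_⟩
  set B := C * Real.exp (R ^ 2) ^ 2 * Real.exp (-b * R) with hB
  have hφ : 0 < q.totient := Nat.totient_pos.mpr q.pos_of_neZero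
  rw [← sum_Icc_sub_eq, Finset.mul_sum, ← Finset.sum_sub_distrib, ← Real.norm_eq_abs,
    ← Complex.norm_real]
  have e : ((∑ n ∈ Icc 1 y, (residueClass r n * ((y : ℝ) - n) -
      (q.totient : ℝ)⁻¹ * ((y : ℝ) - n)) : ℝ) : ℂ) = (q.totient : ℂ)⁻¹ *
      ∑ χ : DirichletCharacter ℂ q, χ r⁻¹ * ∑ n ∈ Icc 1 y, centeredTwist χ n * ((y : ℂ) - n) := by
    push_cast
    simp only [Finset.mul_sum]
    rw [Finset.sum_comm]
    refine Finset.sum_congr rfl fun n _ => ?_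
    rw [← sub_mul, residueClass_sub_inv_totient hr, Finset.mul_sum, Finset.sum_mul]
    refine Finset.sum_congr rfl fun χ _ => ?_
    ring
  rw [e, norm_mul, norm_inv, Complex.norm_natCast, inv_mul_le_iff₀ (by exact_mod_cast hφ)]
  refine (norm_sum_le_of_le _ fun χ _ => ?_).trans_eq (b := ∑ _χ : DirichletCharacter ℂ q, B) ?_
  · rw [norm_mul]
    refine (mul_le_of_le_one_left (norm_nonneg _) (χ.norm_le_one _)).trans (h R hR q χ hq y hy)
  · rw [Finset.sum_const, nsmul_eq_mul, Finset.card_univ, ← Nat.card_eq_fintype_card,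
      DirichletCharacter.card_eq_totient_of_hasEnoughRootsOfUnity]

open ArithmeticFunction.vonMangoldt in
/-- The Siegel–Walfisz theorem, uniformly in the initial segment. -/
theorem exists_abs_sum_residueClass_sub_le {A : ℝ} (hA : 0 < A) :
    ∃ C b R₀ : ℝ, 0 < C ∧ 0 < b ∧ 2 ≤ R₀ ∧ ∀ R : ℝ, R₀ ≤ R → ∀ (q : ℕ) [NeZero q]
      (r : ZMod q), IsUnit r → (q : ℝ) ≤ (R ^ 2) ^ A → ∀ m : ℕ, (m : ℝ) ≤ Real.exp (R ^ 2) →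
      |∑ n ∈ Icc 1 m, residueClass r n - (q.totient : ℝ)⁻¹ * m| ≤
        C * Real.exp (R ^ 2) * Real.exp (-b * R) := by
  obtain ⟨C, b, R₀, hC, hb, hb1, hR₀, h⟩ := exists_abs_smoothed_residueClass_sub_le hA
  refine ⟨1 + 4 * C, b / 2, R₀, by positivity, by positivity, hR₀, fun R hR q _ r hr hq m hm => ?_⟩
  have hR2 : 2 ≤ R := hR₀.trans hR
  set X := Real.exp (R ^ 2) with hX
  set E := Real.exp (-(b / 2) * R) with hE
  have hX0 : 0 < X := Real.exp_pos _
  have hE0 : 0 < E := Real.exp_pos _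
  have hE1 : E ≤ 1 := by rw [hE, Real.exp_le_one_iff]; nlinarith
  have hEE : Real.exp (-b * R) = E ^ 2 := by rw [hE, ← Real.exp_nat_mul]; ring_nf
  have hXE : 1 ≤ X * E := by
    rw [hX, hE, ← Real.exp_add]
    refine Real.one_le_exp ?_
    nlinarith
  set H := ⌊X * E⌋₊ with hH
  have hH1 : 1 ≤ H := Nat.one_le_floor_iff _ |>.mpr hXE
  have hHle : (H : ℝ) ≤ X * E := Nat.floor_le (by positivity)
  have hHge : X * E / 2 ≤ H := by
    have h1 : X * E < H + 1 := Nat.lt_floor_add_one _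
    have h2 : (1 : ℝ) ≤ H := by exact_mod_cast hH1
    linarith
  have hH0 : (0 : ℝ) < H := by exact_mod_cast hH1
  have hφ : 1 ≤ q.totient := Nat.totient_pos.mpr q.pos_of_neZero
  have key := abs_sum_sub_mul_le_of_smoothed (f := fun n => residueClass r n) (Y := m + H)
    (B := C * X ^ 2 * E ^ 2)
    (fun n => residueClass_nonneg r n) (g := (q.totient : ℝ)⁻¹) (by positivity)
    (inv_le_one_of_one_le₀ (by exact_mod_cast hφ)) (fun y hy => ?_) hH1 le_rfl
  · refine key.trans ?_
    have : 2 * (C * X ^ 2 * E ^ 2) / H ≤ 2 * (C * X ^ 2 * E ^ 2) / (X * E / 2) := by gcongr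
    have e : 2 * (C * X ^ 2 * E ^ 2) / (X * E / 2) = 4 * C * (X * E) := by field_simp; norm_num
    rw [e] at this
    linarith
  · rw [← hEE]
    refine h R hR q r hr hq y ?_
    have h1 : (y : ℝ) ≤ m + H := by exact_mod_cast hy
    nlinarith

theorem sum_primitiveRoots_eq_moebius {q : ℕ} (hq : 0 < q) :
    ∑ z ∈ primitiveRoots q ℂ, z = (ArithmeticFunction.moebius q : ℂ) := by
  classical
  have h : ∀ n > 0, ∑ d ∈ n.divisors, ∑ z ∈ primitiveRoots d ℂ, z = if n = 1 then (1 : ℂ) else 0 := by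
    intro n hn
    have hz := Complex.isPrimitiveRoot_exp n hn.ne'
    rw [← Finset.sum_biUnion fun a _ b _ hab => IsPrimitiveRoot.disjoint hab,
      ← IsPrimitiveRoot.nthRoots_one_eq_biUnion_primitiveRoots]
    split_ifs with h1
    · subst h1
      have : Polynomial.nthRootsFinset 1 (1 : ℂ) = {1} := by
        ext z; simp [Polynomial.mem_nthRootsFinset]
      rw [this, Finset.sum_singleton]
    · have hinj : Polynomial.nthRootsFinset n (1 : ℂ) =
          (Finset.range n).image fun i => Complex.exp (2 * Real.pi * I / n) ^ i := by
        have : NeZero n := ⟨hn.ne'⟩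
        ext z
        rw [Polynomial.mem_nthRootsFinset hn, Finset.mem_image]
        constructor
        · intro h
          obtain ⟨i, hi, h⟩ := hz.eq_pow_of_pow_eq_one h
          exact ⟨i, Finset.mem_range.mpr hi, h⟩
        · rintro ⟨i, -, rfl⟩
          rw [← pow_mul, mul_comm i n, pow_mul, hz.pow_eq_one, one_pow]
      rw [hinj, Finset.sum_image fun i hi j hj hij => hz.pow_inj (by simpa using hi) (by simpa using hj) hij]
      exact hz.geom_sum_eq_zero (by omega)
  have h2 := (ArithmeticFunction.sum_eq_iff_sum_mul_moebius_eq.mp h) q hq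
  rw [← h2, Finset.sum_eq_single (q, 1)]
  · simp
  · rintro ⟨a, b⟩ hab hne
    have hb : b ≠ 1 := by
      rintro rfl
      simp only [Nat.mem_divisorsAntidiagonal, mul_one] at hab
      exact hne (by rw [hab.1])
    simp [hb]
  · intro hnot
    exact absurd (by simp [Nat.mem_divisorsAntidiagonal, hq.ne']) hnot

open ZMod in
open Classical in
/-- Ramanujan's sum at an argument coprime to the modulus. -/
theorem sum_stdAddChar_units_eq_moebius {q : ℕ} [NeZero q] {a : ℕ} (ha : a.Coprime q) :
    ∑ r : ZMod q with IsUnit r, stdAddChar ((a : ZMod q) * r) = (ArithmeticFunction.moebius q : ℂ) := by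
  have hq : 0 < q := q.pos_of_neZero
  rw [← sum_primitiveRoots_eq_moebius hq]
  set z : ℂ := stdAddChar (a : ZMod q) with hz
  have hzr : IsPrimitiveRoot z q := by
    have h := (Complex.isPrimitiveRoot_exp q hq.ne').pow_of_coprime a ha
    convert h using 1
    rw [hz, ← Int.cast_natCast, stdAddChar_coe, ← Complex.exp_nat_mul]
    congr 1
    push_cast; ring
  have hpow : ∀ r : ZMod q, stdAddChar ((a : ZMod q) * r) = z ^ r.val := by
    intro r
    conv_lhs => rw [← ZMod.natCast_zmod_val r, mul_comm, ← nsmul_eq_mul]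
    rw [AddChar.map_nsmul_eq_pow]
  refine Finset.sum_bij (fun r _ => stdAddChar ((a : ZMod q) * r)) ?_ ?_ ?_ fun _ _ => rfl
  · intro r hr
    rw [mem_filter] at hr
    rw [mem_primitiveRoots hq, hpow]
    refine hzr.pow_of_coprime _ ?_
    have h := hr.2
    rwa [← ZMod.natCast_zmod_val r, ZMod.isUnit_iff_coprime] at h
  · intro r _ s _ hrs
    have h := injective_stdAddChar hrs
    exact ((ZMod.isUnit_iff_coprime a q).mpr ha).mul_left_cancel h
  · intro w hw
    rw [mem_primitiveRoots hq, hzr.isPrimitiveRoot_iff] at hw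
    obtain ⟨i, hi, hic, rfl⟩ := hw
    refine ⟨(i : ZMod q), ?_, ?_⟩
    · rw [mem_filter]
      exact ⟨mem_univ _, (ZMod.isUnit_iff_coprime i q).mpr hic⟩
    · rw [hpow, ZMod.val_natCast_of_lt hi]

/-- Partial summation against powers of a number of norm one. -/
theorem norm_sum_mul_pow_le {d : ℕ → ℂ} {w : ℂ} (hw : ‖w‖ = 1) {B : ℝ} {N : ℕ}
    (h : ∀ m ≤ N, ‖∑ n ∈ Icc 1 m, d n‖ ≤ B) :
    ‖∑ n ∈ Icc 1 N, d n * w ^ n‖ ≤ B * (1 + N * ‖w - 1‖) := by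
  have key : ∀ m ≤ N, ‖∑ n ∈ Icc 1 m, d n * w ^ n - (∑ n ∈ Icc 1 m, d n) * w ^ m‖ ≤
      B * (m * ‖w - 1‖) := by
    intro m
    induction m with
    | zero => simp
    | succ k ih =>
      intro hk
      have h1 := ih (by omega)
      have h2 := h k (by omega)
      rw [Finset.sum_Icc_succ_top (by omega), Finset.sum_Icc_succ_top (by omega)]
      have e : ∑ n ∈ Icc 1 k, d n * w ^ n + d (k + 1) * w ^ (k + 1) -
          (∑ n ∈ Icc 1 k, d n + d (k + 1)) * w ^ (k + 1) =
          (∑ n ∈ Icc 1 k, d n * w ^ n - (∑ n ∈ Icc 1 k, d n) * w ^ k) -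
            (∑ n ∈ Icc 1 k, d n) * (w ^ k * (w - 1)) := by ring
      rw [e]
      refine (norm_sub_le _ _).trans ?_
      rw [norm_mul (∑ n ∈ Icc 1 k, d n), norm_mul (w ^ k), norm_pow, hw, one_pow, one_mul]
      have h3 : ‖∑ n ∈ Icc 1 k, d n‖ * ‖w - 1‖ ≤ B * ‖w - 1‖ := by gcongr
      push_cast
      linarith
  have h1 := key N le_rfl
  have h2 := h N le_rfl
  have e : ∑ n ∈ Icc 1 N, d n * w ^ n = (∑ n ∈ Icc 1 N, d n * w ^ n - (∑ n ∈ Icc 1 N, d n) * w ^ N) +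
      (∑ n ∈ Icc 1 N, d n) * w ^ N := by ring
  rw [e]
  refine (norm_add_le _ _).trans ?_
  rw [norm_mul _ (w ^ N), norm_pow, hw, one_pow, mul_one]
  linarith

open Classical in
theorem card_filter_isUnit (q : ℕ) [NeZero q] :
    ({r : ZMod q | IsUnit r} : Finset (ZMod q)).card = q.totient := by
  rw [← ZMod.card_units_eq_totient, ← Finset.card_univ, ← Finset.card_map ⟨Units.val, Units.val_injective⟩]
  congr 1
  ext r
  rw [mem_filter]
  simp [IsUnit]

open ArithmeticFunction.vonMangoldt in
theorem sum_residueClass (q : ℕ) [NeZero q] (g : ZMod q → ℂ) (n : ℕ) :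
    ∑ r : ZMod q, g r * (residueClass r n : ℂ) = g n * (ArithmeticFunction.vonMangoldt n : ℂ) := by
  rw [Finset.sum_eq_single (n : ZMod q)]
  · simp [residueClass]
  · intro r _ hr
    simp [residueClass, hr.symm]
  · simp

open ArithmeticFunction.vonMangoldt ZMod in
theorem norm_sum_vonMangoldt_mul_stdAddChar_sub_le {q : ℕ} [NeZero q] {a : ℕ} (ha : a.Coprime q)
    {m : ℕ} {B : ℝ} (hψ : ∑ n ∈ Icc 1 m, ArithmeticFunction.vonMangoldt n ≤ m + B)
    (h : ∀ r : ZMod q, IsUnit r →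
      |∑ n ∈ Icc 1 m, residueClass r n - (q.totient : ℝ)⁻¹ * m| ≤ B) :
    ‖∑ n ∈ Icc 1 m, ((ArithmeticFunction.vonMangoldt n : ℂ) * stdAddChar ((a : ZMod q) * (n : ZMod q)) -
      (ArithmeticFunction.moebius q : ℂ) / q.totient)‖ ≤ 3 * q * B := by
  classical
  set P : ZMod q → ℝ := fun r => ∑ n ∈ Icc 1 m, residueClass r n with hP
  have hB : 0 ≤ B := (abs_nonneg _).trans (h 1 isUnit_one)
  have hP0 : ∀ r, 0 ≤ P r := fun r => Finset.sum_nonneg fun n _ => residueClass_nonneg r n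
  have hφ : 0 < q.totient := Nat.totient_pos.mpr q.pos_of_neZero
  have hφ0 : (q.totient : ℂ) ≠ 0 := by exact_mod_cast hφ.ne'
  have hφ0' : (q.totient : ℝ) ≠ 0 := by exact_mod_cast hφ.ne'
  have hφq : (q.totient : ℝ) ≤ q := by exact_mod_cast Nat.totient_le q
  have hq1 : (1 : ℝ) ≤ q := by exact_mod_cast NeZero.one_le
  have hnorm : ∀ x : ZMod q, ‖(stdAddChar x : ℂ)‖ = 1 := fun x => by
    rw [stdAddChar_apply, Circle.norm_coe]
  have hswap : ∀ g : ZMod q → ℂ, ∑ r, g r * (P r : ℂ) =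
      ∑ n ∈ Icc 1 m, g n * (ArithmeticFunction.vonMangoldt n : ℂ) := by
    intro g
    simp only [hP, ofReal_sum, Finset.mul_sum]
    rw [Finset.sum_comm]
    exact Finset.sum_congr rfl fun n _ => sum_residueClass q g n
  have htot : ∑ r, P r = ∑ n ∈ Icc 1 m, ArithmeticFunction.vonMangoldt n := by
    have := hswap fun _ => 1
    simp only [one_mul] at this
    exact_mod_cast this
  have hsplit := Finset.sum_filter_add_sum_filter_not univ (fun r : ZMod q => IsUnit r) P
  have hunits : m - q.totient * B ≤ ∑ r : ZMod q with IsUnit r, P r := by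
    calc m - q.totient * B = ∑ r : ZMod q with IsUnit r, ((q.totient : ℝ)⁻¹ * m - B) := by
          rw [Finset.sum_const, card_filter_isUnit, nsmul_eq_mul]; field_simp
      _ ≤ _ := by
          refine Finset.sum_le_sum fun r hr => ?_
          have := (abs_le.mp (h r (mem_filter.mp hr).2)).1
          simp only [hP]
          linarith
  have hnon : ∑ r : ZMod q with ¬ IsUnit r, P r ≤ (1 + q.totient) * B := by
    rw [htot] at hsplit
    linarith
  have hnon' : ‖∑ r : ZMod q with ¬ IsUnit r, stdAddChar ((a : ZMod q) * r) * (P r : ℂ)‖ ≤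
      (1 + q.totient) * B := by
    refine (norm_sum_le_of_le _ fun r _ => ?_).trans hnon
    rw [norm_mul, hnorm, one_mul, norm_real, Real.norm_of_nonneg (hP0 r)]
  have hun' : ‖∑ r : ZMod q with IsUnit r, stdAddChar ((a : ZMod q) * r) *
      ((P r - (q.totient : ℝ)⁻¹ * m : ℝ) : ℂ)‖ ≤ q.totient * B := by
    refine (norm_sum_le_of_le _ (f := fun r : ZMod q => stdAddChar ((a : ZMod q) * r) *
      ((P r - (q.totient : ℝ)⁻¹ * m : ℝ) : ℂ)) fun r hr => ?_).trans_eq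
      (b := ∑ r : ZMod q with IsUnit r, B) ?_
    · rw [norm_mul, hnorm, one_mul, norm_real]
      exact h r (mem_filter.mp hr).2
    · rw [Finset.sum_const, card_filter_isUnit, nsmul_eq_mul]
  have e : ∑ n ∈ Icc 1 m, ((ArithmeticFunction.vonMangoldt n : ℂ) * stdAddChar ((a : ZMod q) * (n : ZMod q)) -
      (ArithmeticFunction.moebius q : ℂ) / q.totient) =
      ∑ r : ZMod q with IsUnit r, stdAddChar ((a : ZMod q) * r) *
        ((P r - (q.totient : ℝ)⁻¹ * m : ℝ) : ℂ) +
      ∑ r : ZMod q with ¬ IsUnit r, stdAddChar ((a : ZMod q) * r) * (P r : ℂ) := by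
    have h1 := Finset.sum_filter_add_sum_filter_not univ (fun r : ZMod q => IsUnit r)
      fun r => stdAddChar ((a : ZMod q) * r) * (P r : ℂ)
    rw [hswap fun r => stdAddChar ((a : ZMod q) * r)] at h1
    have h2 : ∑ r : ZMod q with IsUnit r, stdAddChar ((a : ZMod q) * r) *
        ((P r - (q.totient : ℝ)⁻¹ * m : ℝ) : ℂ) =
        ∑ r : ZMod q with IsUnit r, stdAddChar ((a : ZMod q) * r) * (P r : ℂ) -
          (ArithmeticFunction.moebius q : ℂ) * ((q.totient : ℂ)⁻¹ * m) := by
      rw [← sum_stdAddChar_units_eq_moebius ha, Finset.sum_mul, ← Finset.sum_sub_distrib]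
      refine Finset.sum_congr rfl fun r _ => ?_
      push_cast; ring
    rw [h2, Finset.sum_sub_distrib, Finset.sum_const, Nat.card_Icc, Nat.add_sub_cancel,
      nsmul_eq_mul, Finset.sum_congr rfl fun n _ => mul_comm (ArithmeticFunction.vonMangoldt n : ℂ) _,
      ← h1]
    ring
  rw [e]
  refine (norm_add_le _ _).trans ?_
  have : q.totient * B ≤ q * B := by gcongr
  have : B ≤ q * B := by nlinarith
  linarith

theorem ce_natCast_mul (n : ℕ) (β : ℝ) : ce (n * β) = ce β ^ n := by
  rw [ce, ce, ← Complex.exp_nat_mul]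
  congr 1
  push_cast; ring

theorem norm_ce (x : ℝ) : ‖ce x‖ = 1 := by
  rw [ce, show Complex.I * (2 * Real.pi * x) = ((2 * Real.pi * x : ℝ) : ℂ) * I by push_cast; ring,
    Complex.norm_exp_ofReal_mul_I]

theorem norm_ce_sub_one_le (x : ℝ) : ‖ce x - 1‖ ≤ 7 * |x| := by
  have h := Real.norm_exp_I_mul_ofReal_sub_one_le (x := 2 * Real.pi * x)
  rw [Real.norm_eq_abs, abs_mul, abs_of_pos Real.two_pi_pos] at h
  have e : ce x = Complex.exp (I * ((2 * Real.pi * x : ℝ) : ℂ)) := by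
    rw [ce]; push_cast; rfl
  rw [e]
  refine h.trans ?_
  gcongr
  linarith [Real.pi_lt_d2]

theorem ce_natCast_mul_div_add {q : ℕ} [NeZero q] (a n : ℕ) (β : ℝ) :
    ce (n * ((a : ℝ) / q + β)) = ZMod.stdAddChar ((a : ZMod q) * (n : ZMod q)) * ce β ^ n := by
  have h : ((a : ZMod q) * (n : ZMod q)) = (((a : ℤ) * (n : ℤ) : ℤ) : ZMod q) := by push_cast; rfl
  rw [h, ZMod.stdAddChar_coe, ← ce_natCast_mul, ce, ce, ← Complex.exp_add]
  congr 1
  push_cast; ring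

theorem exp_sum_sub_eq {q : ℕ} [NeZero q] (a N : ℕ) (β : ℝ) :
    (N : ℂ)⁻¹ * ∑ n ∈ Finset.Icc 1 N,
        ((ArithmeticFunction.vonMangoldt n : ℝ) : ℂ) * ce (n * ((a : ℝ) / q + β))
      - ((ArithmeticFunction.moebius q : ℤ) : ℂ) / (Nat.totient q : ℂ)
        * ((N : ℂ)⁻¹ * ∑ n ∈ Finset.Icc 1 N, ce (n * β)) =
    (N : ℂ)⁻¹ * ∑ n ∈ Icc 1 N, ((ArithmeticFunction.vonMangoldt n : ℂ) *
      ZMod.stdAddChar ((a : ZMod q) * (n : ZMod q)) - (ArithmeticFunction.moebius q : ℂ) / q.totient) *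
        ce β ^ n := by
  simp only [ce_natCast_mul_div_add]
  simp only [sub_mul, Finset.sum_sub_distrib, ← Finset.mul_sum, ce_natCast_mul, mul_assoc]
  ring

theorem norm_exp_sum_sub_le (q a N : ℕ) (hq : 0 < q) (hN : 0 < N) (β : ℝ) :
    ‖(N : ℂ)⁻¹ * ∑ n ∈ Finset.Icc 1 N,
        ((ArithmeticFunction.vonMangoldt n : ℝ) : ℂ) * ce (n * ((a : ℝ) / q + β))
      - ((ArithmeticFunction.moebius q : ℤ) : ℂ) / (Nat.totient q : ℂ)
        * ((N : ℂ)⁻¹ * ∑ n ∈ Finset.Icc 1 N, ce (n * β))‖ ≤ Real.log 4 + 5 := by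
  have hN0 : (0 : ℝ) < N := by exact_mod_cast hN
  have hφ : (1 : ℝ) ≤ q.totient := by exact_mod_cast Nat.totient_pos.mpr hq
  refine (norm_sub_le _ _).trans ?_
  have h1 : ‖∑ n ∈ Finset.Icc 1 N,
      ((ArithmeticFunction.vonMangoldt n : ℝ) : ℂ) * ce (n * ((a : ℝ) / q + β))‖ ≤
      (Real.log 4 + 4) * N := by
    refine (norm_sum_le_of_le _ fun n _ => ?_).trans (sum_vonMangoldt_Icc_le N)
    rw [norm_mul, norm_ce, mul_one, norm_real, Real.norm_of_nonneg ArithmeticFunction.vonMangoldt_nonneg]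
  have h2 : ‖∑ n ∈ Finset.Icc 1 N, ce (n * β)‖ ≤ N := by
    refine (norm_sum_le _ _).trans_eq ?_
    simp [norm_ce]
  have h3 : ‖((ArithmeticFunction.moebius q : ℤ) : ℂ) / (Nat.totient q : ℂ)‖ ≤ 1 := by
    rw [norm_div, Complex.norm_natCast, Complex.norm_intCast]
    refine div_le_one_of_le₀ (le_trans ?_ hφ) (by positivity)
    exact_mod_cast ArithmeticFunction.abs_moebius_le_one
  rw [norm_mul, norm_mul, norm_mul, norm_inv, Complex.norm_natCast]
  have h4 : (N : ℝ)⁻¹ * ‖∑ n ∈ Finset.Icc 1 N,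
      ((ArithmeticFunction.vonMangoldt n : ℝ) : ℂ) * ce (n * ((a : ℝ) / q + β))‖ ≤ Real.log 4 + 4 := by
    rw [inv_mul_le_iff₀ hN0]; linarith
  have h5 : (N : ℝ)⁻¹ * ‖∑ n ∈ Finset.Icc 1 N, ce (n * β)‖ ≤ 1 := by
    rw [inv_mul_le_iff₀ hN0]; linarith
  have h6 := mul_le_one₀ h3 (by positivity) h5
  linarith

/-- Major arc approximation of the exponential sum over primes: for `α = a/q + β` with
`a/q` reduced, `q ≤ ((1-ε) log N)^A` and `|β| < (log N)^A / N`,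
`(1/N) ∑_{n ≤ N} Λ(n) e(nα)` equals `(μ(q)/φ(q)) (1/N) ∑_{n ≤ N} e(nβ)` up to
`C₁(A) exp(-C₂(A) (1-ε) √(log N))`. -/
theorem exp_sum_primes_major_arc (A : ℝ) (hA : 0 < A) :
    ∃ C₁ C₂ : ℝ, 0 < C₁ ∧ 0 < C₂ ∧
      ∀ ε : ℝ, 0 < ε → ε < 1 → ∀ N : ℕ, 2 ≤ N →
      ∀ a q : ℕ, 1 ≤ q → Nat.Coprime a q → (q : ℝ) ≤ ((1 - ε) * Real.log N) ^ A →
      ∀ β : ℝ, |β| < (Real.log N) ^ A / N →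
      ‖(N : ℂ)⁻¹ * ∑ n ∈ Finset.Icc 1 N,
            ((ArithmeticFunction.vonMangoldt n : ℝ) : ℂ) * ce (n * ((a : ℝ) / q + β))
          - ((ArithmeticFunction.moebius q : ℤ) : ℂ) / (Nat.totient q : ℂ)
            * ((N : ℂ)⁻¹ * ∑ n ∈ Finset.Icc 1 N, ce (n * β))‖
        ≤ C₁ * Real.exp (-C₂ * (1 - ε) * Real.sqrt (Real.log N)) := by
  obtain ⟨C, b, R₀, hC, hb, hR₀, hSW⟩ := exists_abs_sum_residueClass_sub_le hA
  obtain ⟨R₁, hR₁⟩ := Filter.eventually_atTop.mp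
    ((isLittleO_rpow_exp_pos_mul_atTop (4 * A) (half_pos hb)).bound (c := 1) one_pos)
  have hl : 0 < Real.log 4 := Real.log_pos (by norm_num)
  set R₂ := max R₀ R₁ with hR₂
  refine ⟨24 * C + (Real.log 4 + 5) * Real.exp (b / 2 * R₂), b / 2, by positivity, by positivity, ?_⟩
  intro ε hε hε1 N hN a q hq ha hqN β hβ
  have : NeZero q := ⟨by omega⟩
  have hN0 : (0 : ℝ) < N := by positivity
  have hlogN : 0 < Real.log N := Real.log_pos (by exact_mod_cast hN)
  set R := Real.sqrt (Real.log N) with hR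
  have hRpos : 0 < R := Real.sqrt_pos.mpr hlogN
  have hRsq : R ^ 2 = Real.log N := Real.sq_sqrt hlogN.le
  have hexp : Real.exp (R ^ 2) = N := by rw [hRsq, Real.exp_log hN0]
  have hmono : Real.exp (-(b / 2) * R) ≤ Real.exp (-(b / 2) * (1 - ε) * R) := by
    refine Real.exp_le_exp.mpr ?_
    have : 0 < b / 2 * ε * R := by positivity
    nlinarith
  by_cases hsmall : R < R₂
  · refine (norm_exp_sum_sub_le q a N hq (by omega) β).trans ?_
    have h1 : 1 ≤ Real.exp (b / 2 * R₂) * Real.exp (-(b / 2) * R) := by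
      rw [← Real.exp_add]
      refine Real.one_le_exp ?_
      nlinarith
    calc Real.log 4 + 5 ≤ (Real.log 4 + 5) * (Real.exp (b / 2 * R₂) * Real.exp (-(b / 2) * R)) :=
          le_mul_of_one_le_right (by positivity) h1
      _ = ((Real.log 4 + 5) * Real.exp (b / 2 * R₂)) * Real.exp (-(b / 2) * R) := by ring
      _ ≤ _ := by
        gcongr
        linarith
  push Not at hsmall
  have hRR₀ : R₀ ≤ R := (le_max_left _ _).trans hsmall
  have hRR₁ : R₁ ≤ R := (le_max_right _ _).trans hsmall
  have hpoly := hR₁ R hRR₁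
  rw [one_mul, Real.norm_of_nonneg (by positivity), Real.norm_of_nonneg (by positivity)] at hpoly
  set L := (R ^ 2) ^ A with hL
  have hLL : L ^ 2 = R ^ (4 * A) := by
    rw [hL, ← Real.rpow_natCast R 2, ← Real.rpow_mul hRpos.le, ← Real.rpow_natCast,
      ← Real.rpow_mul hRpos.le]
    push_cast; ring_nf
  have hqL : (q : ℝ) ≤ L := by
    refine hqN.trans ?_
    rw [hL, hRsq]
    refine Real.rpow_le_rpow (by nlinarith) (by nlinarith) hA.le
  have hq1 : (1 : ℝ) ≤ q := by exact_mod_cast hq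
  have hL1 : 1 ≤ L := hq1.trans hqL
  rw [← hRsq, lt_div_iff₀ hN0] at hβ
  set E := Real.exp (-b * R) with hE
  have hD : ∀ m ≤ N, ‖∑ n ∈ Icc 1 m, ((ArithmeticFunction.vonMangoldt n : ℂ) *
      ZMod.stdAddChar ((a : ZMod q) * (n : ZMod q)) - (ArithmeticFunction.moebius q : ℂ) / q.totient)‖ ≤
        3 * q * (C * N * E) := by
    intro m hm
    have hm' : (m : ℝ) ≤ Real.exp (R ^ 2) := by rw [hexp]; exact_mod_cast hm
    refine norm_sum_vonMangoldt_mul_stdAddChar_sub_le ha ?_ fun r hr => ?_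
    · have h := hSW R hRR₀ 1 (1 : ZMod 1) isUnit_one (by simpa using hL1) m hm'
      rw [hexp] at h
      have h2 := (abs_le.mp h).2
      have e : ∀ n : ℕ, ArithmeticFunction.vonMangoldt.residueClass (1 : ZMod 1) n =
          ArithmeticFunction.vonMangoldt n := fun n => by
        simp [ArithmeticFunction.vonMangoldt.residueClass, eq_iff_true_of_subsingleton]
      simp only [e, Nat.totient_one, Nat.cast_one, inv_one, one_mul] at h2
      linarith
    · have h := hSW R hRR₀ q r hr hqL m hm'
      rwa [hexp] at h
  have key := norm_sum_mul_pow_le (norm_ce β) hD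
  rw [exp_sum_sub_eq, norm_mul, norm_inv, Complex.norm_natCast, inv_mul_le_iff₀ hN0]
  refine key.trans ?_
  have hw : N * ‖ce β - 1‖ ≤ 7 * L := by
    calc N * ‖ce β - 1‖ ≤ N * (7 * |β|) := by gcongr; exact norm_ce_sub_one_le β
      _ = 7 * (|β| * N) := by ring
      _ ≤ 7 * L := by gcongr
  calc 3 * q * (C * N * E) * (1 + N * ‖ce β - 1‖) ≤ 3 * L * (C * N * E) * (L + 7 * L) := by gcongr
    _ = 24 * C * N * (E * L ^ 2) := by ring
    _ ≤ 24 * C * N * (E * Real.exp (b / 2 * R)) := by rw [hLL]; gcongr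
    _ = 24 * C * N * Real.exp (-(b / 2) * R) := by rw [hE, ← Real.exp_add]; ring_nf
    _ ≤ 24 * C * N * Real.exp (-(b / 2) * (1 - ε) * R) := by gcongr
    _ = N * ((24 * C + 0) * Real.exp (-(b / 2) * (1 - ε) * R)) := by ring
    _ ≤ _ := by gcongr; positivity
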